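/- For every λ ∈ ℝ, under GβE(N) the random variable (log|Ψ_N(λ)| + (1/(3β))·log N) / √((2/(3β))·log N) converges in distribution, as N → ∞, to a standard real Gaussian. Moreover the convergence holds jointly with the same limit: for any λ₁, …, λ_k ∈ ℝ, the random vector with coordinates (log|Ψ_N(λ_j)| + (1/(3β))·log N) / √((2/(3β))·log N), j = 1, …, k, converges in distribution to (Z, Z, …, Z), where Z is a standard real Gaussian. -/

import Mathlib

open MeasureTheory Filter Topology ProbabilityTheory

/-- Unnormalised density of the Gaussian β-ensemble:
`exp(−βN·Σ λ_i²)·∏_{j<i} |λ_i − λ_j|^β`. -/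
noncomputable def gbeDensity (β : ℝ) (N : ℕ) (x : Fin N → ℝ) : ℝ :=
  Real.exp (-(β * N * ∑ i, (x i) ^ 2)) *
    ∏ p ∈ Finset.univ.filter (fun p : Fin N × Fin N => p.2 < p.1), |x p.1 - x p.2| ^ β

/-- The Gaussian β-ensemble `GβE(N)`: the normalised measure on `ℝ^N` with density
proportional to `gbeDensity β N`. -/
noncomputable def gbe (β : ℝ) (N : ℕ) : Measure (Fin N → ℝ) :=
  ((volume.withDensity fun x => ENNReal.ofReal (gbeDensity β N x)) Set.univ)⁻¹ •
    volume.withDensity fun x => ENNReal.ofReal (gbeDensity β N x)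

/-- The evaluation point `1 + λ/(2N^{2/3})`. -/
noncomputable def zpt (N : ℕ) (lam : ℝ) : ℝ := 1 + lam / (2 * (N : ℝ) ^ ((2 : ℝ) / 3))

/-- `w_N(z) = ((2π)^{1/4}·e^{Nz²}·2^{−N}·(Nz²)^{−1/12}·√(N!/N^N))^{−1}`. -/
noncomputable def wN (N : ℕ) (z : ℝ) : ℝ :=
  ((2 * Real.pi) ^ ((1 : ℝ) / 4) * Real.exp (N * z ^ 2) * (2 : ℝ) ^ (-(N : ℝ)) *
      ((N : ℝ) * z ^ 2) ^ (-(1 : ℝ) / 12) *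
      Real.sqrt ((N.factorial : ℝ) / (N : ℝ) ^ (N : ℕ)))⁻¹

/-- `Ψ_N(λ) = w_N(1 + λ/(2N^{2/3}))·φ_N(1 + λ/(2N^{2/3}))` where
`φ_N(z) = ∏_i (z − λ_i)`. -/
noncomputable def PsiN (N : ℕ) (lam : ℝ) (x : Fin N → ℝ) : ℝ :=
  wN N (zpt N lam) * ∏ i, (zpt N lam - x i)

/-- The recentred and rescaled logarithm
`(log|Ψ_N(λ)| + (1/(3β))·log N) / √((2/(3β))·log N)`. -/
noncomputable def cltVar (β : ℝ) (N : ℕ) (lam : ℝ) (x : Fin N → ℝ) : ℝ :=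
  (Real.log |PsiN N lam x| + (1 / (3 * β)) * Real.log N) /
    Real.sqrt ((2 / (3 * β)) * Real.log N)

namespace GaussianBeta

/-- Continuous functions with bounded norm. -/
def BddCont {X E : Type*} [TopologicalSpace X] [NormedAddCommGroup E] (f : X → E) : Prop :=
  Continuous f ∧ ∃ C, ∀ x, ‖f x‖ ≤ C

namespace BddCont

variable {X Y E : Type*} [TopologicalSpace X] [TopologicalSpace Y] [NormedAddCommGroup E]

lemma const (c : E) : BddCont (fun _ : X => c) := ⟨continuous_const, ‖c‖, fun _ => le_rfl⟩

lemma congr {f g : X → E} (hf : BddCont f) (h : ∀ x, g x = f x) : BddCont g :=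
  (funext h : g = f) ▸ hf

lemma add {f g : X → E} (hf : BddCont f) (hg : BddCont g) : BddCont (fun x => f x + g x) := by
  obtain ⟨hf, C, hC⟩ := hf
  obtain ⟨hg, D, hD⟩ := hg
  exact ⟨hf.add hg, C + D, fun x => (norm_add_le _ _).trans (add_le_add (hC x) (hD x))⟩

lemma neg {f : X → E} (hf : BddCont f) : BddCont (fun x => - f x) := by
  obtain ⟨hf, C, hC⟩ := hf
  exact ⟨hf.neg, C, fun x => by simpa using hC x⟩

lemma sub {f g : X → E} (hf : BddCont f) (hg : BddCont g) : BddCont (fun x => f x - g x) := by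
  simpa [sub_eq_add_neg] using hf.add hg.neg

lemma mul {R : Type*} [NormedRing R] {f g : X → R} (hf : BddCont f) (hg : BddCont g) :
    BddCont (fun x => f x * g x) := by
  obtain ⟨hf, C, hC⟩ := hf
  obtain ⟨hg, D, hD⟩ := hg
  exact ⟨hf.mul hg, C * D, fun x => (norm_mul_le _ _).trans
    (mul_le_mul (hC x) (hD x) (norm_nonneg _) ((norm_nonneg _).trans (hC x)))⟩

lemma pow {f : X → ℂ} (hf : BddCont f) (n : ℕ) : BddCont (fun x => f x ^ n) := by
  induction n with
  | zero => simpa using const (X := X) (1 : ℂ)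
  | succ n ih => simpa [pow_succ] using ih.mul hf

lemma rpow {f : X → ℝ} (hf : BddCont f) (n : ℕ) : BddCont (fun x => f x ^ n) := by
  induction n with
  | zero => simpa using const (X := X) (1 : ℝ)
  | succ n ih => simpa [pow_succ] using ih.mul hf

lemma sum {ι : Type*} (s : Finset ι) {f : ι → X → E} (hf : ∀ i ∈ s, BddCont (f i)) :
    BddCont (fun x => ∑ i ∈ s, f i x) := by
  classical
  induction s using Finset.induction_on with
  | empty => simpa using const (X := X) (0 : E)
  | insert a s ha ih =>
    simp only [Finset.sum_insert ha]
    exact (hf a (Finset.mem_insert_self a s)).add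
      (ih fun i hi => hf i (Finset.mem_insert_of_mem hi))

lemma norm {f : X → E} (hf : BddCont f) : BddCont (fun x => ‖f x‖) :=
  ⟨hf.1.norm, hf.2.imp fun _ h x => by simpa using h x⟩

lemma conj {f : X → ℂ} (hf : BddCont f) : BddCont (fun x => (starRingEnd ℂ) (f x)) :=
  ⟨Complex.continuous_conj.comp hf.1, hf.2.imp fun _ h x => by simpa using h x⟩

lemma ofReal {f : X → ℝ} (hf : BddCont f) : BddCont (fun x => (f x : ℂ)) :=
  ⟨Complex.continuous_ofReal.comp hf.1, hf.2.imp fun _ h x => by simpa using h x⟩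

lemma re {f : X → ℂ} (hf : BddCont f) : BddCont (fun x => (f x).re) :=
  ⟨Complex.continuous_re.comp hf.1, hf.2.imp fun _ h x => (Complex.abs_re_le_norm _).trans (h x)⟩

lemma im {f : X → ℂ} (hf : BddCont f) : BddCont (fun x => (f x).im) :=
  ⟨Complex.continuous_im.comp hf.1, hf.2.imp fun _ h x => (Complex.abs_im_le_norm _).trans (h x)⟩

lemma comp {f : Y → E} (hf : BddCont f) {g : X → Y} (hg : Continuous g) :
    BddCont (fun x => f (g x)) :=
  ⟨hf.1.comp hg, hf.2.imp fun _ h x => h (g x)⟩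

lemma integrable {N : ℕ} {F : Type*} [NormedAddCommGroup F] [SecondCountableTopology F]
    {f : (Fin N → ℝ) → F} (hf : BddCont f) (μ : Measure (Fin N → ℝ)) [IsFiniteMeasure μ] :
    Integrable f μ := by
  obtain ⟨hf, C, hC⟩ := hf
  exact Integrable.of_bound hf.aestronglyMeasurable C (Eventually.of_forall hC)

end BddCont

/-- The ordered pairs over which the Vandermonde product runs. -/
abbrev pairs (N : ℕ) : Finset (Fin N × Fin N) :=
  Finset.univ.filter (fun p : Fin N × Fin N => p.2 < p.1)

/-- The density `gbeDensity` with the coincidence singularities smoothed out. -/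
noncomputable def regDensity (β : ℝ) (N : ℕ) (δ : ℝ) (x : Fin N → ℝ) : ℝ :=
  Real.exp (-(β * N * ∑ i, (x i) ^ 2)) * ∏ p ∈ pairs N, ((x p.1 - x p.2) ^ 2 + δ) ^ (β / 2)

lemma regDensity_zero (β : ℝ) (N : ℕ) (x : Fin N → ℝ) :
    regDensity β N 0 x = gbeDensity β N x := by
  unfold regDensity gbeDensity
  congr 1
  refine Finset.prod_congr rfl fun p _ => ?_
  rw [add_zero, ← sq_abs, ← Real.rpow_natCast, ← Real.rpow_mul (abs_nonneg _)]
  congr 1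
  push_cast
  ring

lemma regDensity_nonneg {β : ℝ} {N : ℕ} {δ : ℝ} (hδ : 0 ≤ δ) (x : Fin N → ℝ) :
    0 ≤ regDensity β N δ x :=
  mul_nonneg (Real.exp_pos _).le
    (Finset.prod_nonneg fun _ _ => Real.rpow_nonneg (by positivity) _)

lemma continuous_regDensity {β : ℝ} (hβ : 0 < β) (N : ℕ) (δ : ℝ) :
    Continuous (regDensity β N δ) := by
  unfold regDensity
  refine Continuous.mul (by fun_prop) (continuous_finsetProd _ fun p _ => ?_)
  exact Continuous.rpow_const (by fun_prop) fun _ => Or.inr (by positivity)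

/-- An integrable majorant of `regDensity β N δ` for `δ ≤ 1`. -/
noncomputable def densityBound (β : ℝ) (N : ℕ) (x : Fin N → ℝ) : ℝ :=
  ∏ i, (2 * (1 + x i ^ 2)) ^ (β / 2 * (pairs N).card) * Real.exp (-(β * N * x i ^ 2))

lemma regDensity_le {β : ℝ} (hβ : 0 < β) {N : ℕ} {δ : ℝ} (hδ : 0 ≤ δ) (hδ1 : δ ≤ 1)
    (x : Fin N → ℝ) : regDensity β N δ x ≤ densityBound β N x := by
  unfold regDensity densityBound
  rw [Finset.prod_mul_distrib, mul_comm, ← Real.exp_sum, Finset.sum_neg_distrib, ← Finset.mul_sum]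
  refine mul_le_mul_of_nonneg_right ?_ (Real.exp_pos _).le
  rw [Real.finsetProd_rpow Finset.univ (fun i => 2 * (1 + x i ^ 2)) (fun i _ => by positivity),
    Real.rpow_mul (Finset.prod_nonneg fun i _ => by positivity), Real.rpow_natCast]
  refine (Finset.prod_le_prod (fun _ _ => Real.rpow_nonneg (by positivity) _)
    fun p hp => ?_).trans_eq (Finset.prod_const _)
  refine Real.rpow_le_rpow (by positivity) ?_ (by positivity)
  have hne : p.1 ≠ p.2 := (Finset.mem_filter.1 hp).2.ne'
  have h1 : ∏ i ∈ {p.1, p.2}, (2 * (1 + x i ^ 2)) ≤ ∏ i, (2 * (1 + x i ^ 2)) :=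
    Finset.prod_le_prod_of_subset_of_one_le (Finset.subset_univ _) (fun i _ => by positivity)
      (fun i _ _ => by nlinarith [sq_nonneg (x i)])
  rw [Finset.prod_pair hne] at h1
  refine le_trans ?_ h1
  nlinarith [sq_nonneg (x p.1 + x p.2), sq_nonneg (x p.1 * x p.2), sq_nonneg (x p.1),
    sq_nonneg (x p.2)]

lemma integrable_weight {b r : ℝ} (hb : 0 < b) (hr : 0 ≤ r) :
    Integrable (fun t : ℝ => (2 * (1 + t ^ 2)) ^ r * Real.exp (-(b * t ^ 2))) := by
  set ε := min 1 (b / (2 * (r + 1))) with hε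
  have hε0 : 0 < ε := lt_min one_pos (by positivity)
  have hε1 : ε ≤ 1 := min_le_left _ _
  have hεr : ε * r ≤ b / 2 := by
    have h1 : ε ≤ b / (2 * (r + 1)) := min_le_right _ _
    rw [le_div_iff₀ (by positivity)] at h1
    nlinarith
  have hg : Integrable (fun t : ℝ => (2 / ε) ^ r * Real.exp (-(b / 2) * t ^ 2)) :=
    (integrable_exp_neg_mul_sq (by positivity)).const_mul _
  refine hg.mono' ?_ (Eventually.of_forall fun t => ?_)
  · refine Continuous.aestronglyMeasurable (Continuous.mul ?_ (by fun_prop))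
    exact Continuous.rpow_const (by fun_prop) fun _ => Or.inr hr
  · rw [Real.norm_of_nonneg (by positivity)]
    have h2 : 2 * (1 + t ^ 2) ≤ 2 / ε * Real.exp (ε * t ^ 2) := by
      have := Real.add_one_le_exp (ε * t ^ 2)
      rw [div_mul_eq_mul_div, le_div_iff₀ hε0]
      nlinarith [sq_nonneg t]
    have h3 : (2 * (1 + t ^ 2)) ^ r ≤ (2 / ε) ^ r * Real.exp (ε * r * t ^ 2) := by
      refine (Real.rpow_le_rpow (by positivity) h2 hr).trans_eq ?_
      rw [Real.mul_rpow (by positivity) (Real.exp_pos _).le, ← Real.exp_mul]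
      ring_nf
    calc _ ≤ (2 / ε) ^ r * Real.exp (ε * r * t ^ 2) * Real.exp (-(b * t ^ 2)) :=
          mul_le_mul_of_nonneg_right h3 (Real.exp_pos _).le
      _ = (2 / ε) ^ r * Real.exp (ε * r * t ^ 2 - b * t ^ 2) := by
          rw [mul_assoc, ← Real.exp_add]; ring_nf
      _ ≤ _ := by
          refine mul_le_mul_of_nonneg_left (Real.exp_le_exp.2 ?_) (by positivity)
          nlinarith [sq_nonneg t]

lemma integrable_densityBound {β : ℝ} (hβ : 0 < β) {N : ℕ} (hN : 0 < N) :
    Integrable (densityBound β N) := by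
  unfold densityBound
  exact Integrable.fintype_prod
    (f := fun _ t => (2 * (1 + t ^ 2)) ^ (β / 2 * (pairs N).card) * Real.exp (-(β * N * t ^ 2)))
    fun i => integrable_weight (by positivity) (by positivity)

lemma integrable_mul_regDensity {β : ℝ} (hβ : 0 < β) {N : ℕ} (hN : 0 < N) {δ : ℝ} (hδ : 0 ≤ δ)
    (hδ1 : δ ≤ 1) {f : (Fin N → ℝ) → ℂ} (hf : BddCont f) :
    Integrable (fun x => f x * (regDensity β N δ x : ℂ)) := by
  obtain ⟨hf, C, hC⟩ := hf
  refine ((integrable_densityBound hβ hN).const_mul C).mono'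
    (hf.mul (Complex.continuous_ofReal.comp
      (continuous_regDensity hβ N δ))).aestronglyMeasurable (Eventually.of_forall fun x => ?_)
  rw [norm_mul, Complex.norm_real, Real.norm_of_nonneg (regDensity_nonneg hδ x)]
  exact mul_le_mul (hC x) (regDensity_le hβ hδ hδ1 x) (regDensity_nonneg hδ x)
    ((norm_nonneg _).trans (hC x))

lemma hasDerivAt_line {N : ℕ} (x : Fin N → ℝ) (i j : Fin N) :
    HasDerivAt (fun t : ℝ => (x + t • (Pi.single i 1 : Fin N → ℝ)) j)
      ((Pi.single i 1 : Fin N → ℝ) j) 0 := by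
  simpa using ((hasDerivAt_id (0 : ℝ)).mul_const ((Pi.single i 1 : Fin N → ℝ) j)).const_add (x j)

lemma hasLineDerivAt_sum {N : ℕ} {f f' : ℝ → ℂ} (hf : ∀ t, HasDerivAt f (f' t) t)
    (x : Fin N → ℝ) (i : Fin N) :
    HasLineDerivAt ℝ (fun x : Fin N → ℝ => ∑ j, f (x j)) (f' (x i)) x (Pi.single i 1) := by
  have h : ∀ j ∈ Finset.univ, HasDerivAt
      (fun t : ℝ => f ((x + t • (Pi.single i 1 : Fin N → ℝ)) j))
      ((Pi.single i 1 : Fin N → ℝ) j • f' (x j)) 0 := fun j _ => by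
    have h0 : HasDerivAt f (f' (x j)) ((x + (0 : ℝ) • (Pi.single i 1 : Fin N → ℝ)) j) := by
      simpa using hf (x j)
    exact h0.scomp 0 (hasDerivAt_line x i j)
  have := HasDerivAt.fun_sum h
  simpa [HasLineDerivAt, Pi.single_apply, Finset.sum_ite_eq'] using this

lemma hasLineDerivAt_apply {N : ℕ} {f f' : ℝ → ℂ} (hf : ∀ t, HasDerivAt f (f' t) t)
    (x : Fin N → ℝ) (i : Fin N) :
    HasLineDerivAt ℝ (fun x : Fin N → ℝ => f (x i)) (f' (x i)) x (Pi.single i 1) := by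
  have h0 : HasDerivAt f (f' (x i)) ((x + (0 : ℝ) • (Pi.single i 1 : Fin N → ℝ)) i) := by
    simpa using hf (x i)
  have := h0.scomp 0 (hasDerivAt_line x i i)
  simpa [HasLineDerivAt, Function.comp_def] using this

/-- Logarithmic derivative of `regDensity` in the `i`-th coordinate. -/
noncomputable def regScore (β : ℝ) (N : ℕ) (δ : ℝ) (i : Fin N) (x : Fin N → ℝ) : ℝ :=
  -(2 * β * N * x i) + β * ∑ p ∈ pairs N,
    (x p.1 - x p.2) * ((Pi.single i 1 : Fin N → ℝ) p.1 - (Pi.single i 1 : Fin N → ℝ) p.2) /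
      ((x p.1 - x p.2) ^ 2 + δ)

lemma hasLineDerivAt_regDensity (β : ℝ) (N : ℕ) {δ : ℝ} (hδ : 0 < δ) (i : Fin N)
    (x : Fin N → ℝ) :
    HasLineDerivAt ℝ (regDensity β N δ) (regScore β N δ i x * regDensity β N δ x) x
      (Pi.single i 1) := by
  have hexp : ∀ y, regDensity β N δ y = Real.exp (-(β * N * ∑ i, (y i) ^ 2) +
      ∑ p ∈ pairs N, Real.log ((y p.1 - y p.2) ^ 2 + δ) * (β / 2)) := fun y => by
    rw [Real.exp_add, Real.exp_sum]
    unfold regDensity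
    congr 1
    exact Finset.prod_congr rfl fun p _ => Real.rpow_def_of_pos (by positivity) _
  set e : Fin N → ℝ := Pi.single i 1 with he
  have h1 : HasDerivAt (fun t : ℝ => ∑ j, ((x + t • e) j) ^ 2) (2 * x i) 0 := by
    have := HasDerivAt.fun_sum (u := Finset.univ) fun j _ => (hasDerivAt_line x i j).pow 2
    refine this.congr_deriv ?_
    simp [Pi.single_apply]
  have h2 : HasDerivAt (fun t : ℝ => ∑ p ∈ pairs N,
      Real.log (((x + t • e) p.1 - (x + t • e) p.2) ^ 2 + δ) * (β / 2))
      (∑ p ∈ pairs N, 2 * (x p.1 - x p.2) * (e p.1 - e p.2) /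
        ((x p.1 - x p.2) ^ 2 + δ) * (β / 2)) 0 := by
    refine HasDerivAt.fun_sum fun p _ => HasDerivAt.mul_const ?_ _
    have h3 := (((hasDerivAt_line x i p.1).sub (hasDerivAt_line x i p.2)).pow 2).add_const δ
    have h4 := h3.log (by simp; positivity)
    simpa [Pi.sub_apply] using h4
  have h5 := ((h1.const_mul (β * N)).neg.add h2).exp
  simp only [HasLineDerivAt]
  have h6 : (fun t : ℝ => regDensity β N δ (x + t • e)) = fun t => Real.exp
      (-(β * N * ∑ i, ((x + t • e) i) ^ 2) + ∑ p ∈ pairs N,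
        Real.log (((x + t • e) p.1 - (x + t • e) p.2) ^ 2 + δ) * (β / 2)) := by
    ext t; rw [hexp]
  rw [h6]
  refine h5.congr_deriv ?_
  rw [hexp]
  simp only [Pi.add_apply, Pi.neg_apply, zero_smul, Pi.zero_apply, add_zero]
  rw [mul_comm]
  congr 1
  unfold regScore
  rw [Finset.mul_sum]
  congr 1
  · ring
  · exact Finset.sum_congr rfl fun p _ => by ring


lemma bddCont_score {N : ℕ} {δ : ℝ} (hδ : 0 < δ) (β : ℝ) {h : ℝ → ℂ} (hb : BddCont h)
    (hb' : BddCont fun t : ℝ => (t : ℂ) * h t) (i : Fin N) :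
    BddCont fun x : Fin N → ℝ => h (x i) * (regScore β N δ i x : ℂ) := by
  have e : ∀ p : Fin N × Fin N, BddCont (fun x : Fin N → ℝ => (x p.1 - x p.2) *
      ((Pi.single i 1 : Fin N → ℝ) p.1 - (Pi.single i 1 : Fin N → ℝ) p.2) /
      ((x p.1 - x p.2) ^ 2 + δ)) := fun p => by
    have h1 : BddCont (fun t : ℝ => t / (t ^ 2 + δ)) := by
      refine ⟨Continuous.div continuous_id (by fun_prop) fun t => by positivity,
        1 + 1 / δ, fun t => ?_⟩
      rw [Real.norm_eq_abs, abs_div, abs_of_pos (by positivity : 0 < t ^ 2 + δ),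
        div_le_iff₀ (by positivity)]
      have h2 : (1 + 1 / δ) * (t ^ 2 + δ) = t ^ 2 + δ + t ^ 2 / δ + 1 := by field_simp; ring
      have h3 : 0 ≤ t ^ 2 / δ := by positivity
      rw [h2]
      nlinarith [sq_abs t, sq_nonneg (|t| - 1), abs_nonneg t]
    have h4 := (h1.comp (g := fun x : Fin N → ℝ => x p.1 - x p.2) (by fun_prop)).mul
      (BddCont.const ((Pi.single i 1 : Fin N → ℝ) p.1 - (Pi.single i 1 : Fin N → ℝ) p.2))
    refine h4.congr fun x => ?_
    ring
  have h5 : BddCont fun x : Fin N → ℝ => β * ∑ p ∈ pairs N, (x p.1 - x p.2) *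
      ((Pi.single i 1 : Fin N → ℝ) p.1 - (Pi.single i 1 : Fin N → ℝ) p.2) /
      ((x p.1 - x p.2) ^ 2 + δ) := (BddCont.const β).mul (BddCont.sum _ fun p _ => e p)
  have h6 := ((BddCont.const (-(2 * β * N : ℂ))).mul
    (hb'.comp (g := fun x : Fin N → ℝ => x i) (by fun_prop))).add
    ((hb.comp (g := fun x : Fin N → ℝ => x i) (by fun_prop)).mul h5.ofReal)
  refine h6.congr fun x => ?_
  unfold regScore
  push_cast
  ring

section Loop

variable {β : ℝ} {N : ℕ} {h h' : ℝ → ℂ} {D : ℝ → ℝ → ℂ} {F : (Fin N → ℝ) → ℂ}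
  {F' : Fin N → (Fin N → ℝ) → ℂ}

/-- The integrand of the loop equation, with the weight `θ d` in front of the pair term
at distance `d`. -/
noncomputable def loopTerm (β : ℝ) (h h' : ℝ → ℂ) (D : ℝ → ℝ → ℂ) (F : (Fin N → ℝ) → ℂ)
    (F' : Fin N → (Fin N → ℝ) → ℂ) (θ : ℝ → ℝ) (x : Fin N → ℝ) : ℂ :=
  ∑ i, h (x i) * F' i x + F x * (∑ i, h' (x i) - 2 * β * N * ∑ i, (x i : ℂ) * h (x i) +
    β * ∑ p ∈ pairs N, D (x p.1) (x p.2) * (θ (x p.1 - x p.2) : ℂ))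

lemma integral_loopTerm_reg (hβ : 0 < β) (hN : 0 < N) (hh : ∀ t, HasDerivAt h (h' t) t)
    (bh : BddCont h) (bh' : BddCont h') (bth : BddCont fun t : ℝ => (t : ℂ) * h t)
    (hD : ∀ s t : ℝ, h s - h t = D s t * (s - t))
    (bF : BddCont F) (bF' : ∀ i, BddCont (F' i))
    (hF : ∀ i x, HasLineDerivAt ℝ F (F' i x) x (Pi.single i 1)) {δ : ℝ} (hδ : 0 < δ)
    (hδ1 : δ ≤ 1) :
    ∫ x, loopTerm β h h' D F F' (fun d => d ^ 2 / (d ^ 2 + δ)) x * (regDensity β N δ x : ℂ) = 0 := by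
  have bi : ∀ i : Fin N, BddCont fun x : Fin N → ℝ => h (x i) := fun i =>
    bh.comp (g := fun x : Fin N → ℝ => x i) (by fun_prop)
  have bi' : ∀ i : Fin N, BddCont fun x : Fin N → ℝ => h' (x i) := fun i =>
    bh'.comp (g := fun x : Fin N → ℝ => x i) (by fun_prop)
  have I1 : ∀ i : Fin N, Integrable fun x : Fin N → ℝ =>
      (h' (x i) * F x + h (x i) * F' i x) * (regDensity β N δ x : ℂ) := fun i =>
    integrable_mul_regDensity hβ hN hδ.le hδ1 (((bi' i).mul bF).add ((bi i).mul (bF' i)))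
  have I2 : ∀ i : Fin N, Integrable fun x : Fin N → ℝ =>
      (h (x i) * (regScore β N δ i x : ℂ) * F x) * (regDensity β N δ x : ℂ) := fun i =>
    integrable_mul_regDensity hβ hN hδ.le hδ1 ((bddCont_score hδ β bh bth i).mul bF)
  have key : ∀ i : Fin N,
      ∫ x : Fin N → ℝ, (h (x i) * (regScore β N δ i x : ℂ) * F x) * (regDensity β N δ x : ℂ) =
      -∫ x : Fin N → ℝ, (h' (x i) * F x + h (x i) * F' i x) * (regDensity β N δ x : ℂ) := fun i => by
    have := integral_bilinear_hasLineDerivAt_right_eq_neg_left_of_integrable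
      (μ := (volume : Measure (Fin N → ℝ))) (B := ContinuousLinearMap.mul ℝ ℂ)
      (f := fun x => h (x i) * F x) (f' := fun x => h' (x i) * F x + h (x i) * F' i x)
      (g := fun x => (regDensity β N δ x : ℂ))
      (g' := fun x => ((regScore β N δ i x * regDensity β N δ x : ℝ) : ℂ))
      (v := Pi.single i 1) (I1 i)
      (by refine (I2 i).congr (Eventually.of_forall fun x => ?_)
          simp only [ContinuousLinearMap.mul_apply']
          push_cast; ring)
      (integrable_mul_regDensity hβ hN hδ.le hδ1 ((bi i).mul bF))
      (fun x _ => by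
        have h1 : HasDerivAt (fun t : ℝ => h ((x + t • (Pi.single i 1 : Fin N → ℝ)) i))
          (h' (x i)) 0 := hasLineDerivAt_apply hh x i
        have h2 : HasDerivAt (fun t : ℝ => F (x + t • (Pi.single i 1 : Fin N → ℝ)))
          (F' i x) 0 := hF i x
        simpa [HasLineDerivAt] using HasDerivAt.fun_mul h1 h2)
      (fun x _ => by
        exact HasDerivAt.ofReal_comp (hasLineDerivAt_regDensity β N hδ i x))
    simp only [ContinuousLinearMap.mul_apply'] at this
    rw [← this]
    refine integral_congr_ae (Eventually.of_forall fun x => ?_)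
    simp only
    push_cast; ring
  have hterm : ∀ x : Fin N → ℝ,
      loopTerm β h h' D F F' (fun d => d ^ 2 / (d ^ 2 + δ)) x * (regDensity β N δ x : ℂ) =
      ∑ i, ((h' (x i) * F x + h (x i) * F' i x) * (regDensity β N δ x : ℂ) +
        (h (x i) * (regScore β N δ i x : ℂ) * F x) * (regDensity β N δ x : ℂ)) := fun x => by
    have hs : ∑ i, h (x i) * (regScore β N δ i x : ℂ) =
        -(2 * β * N * ∑ i, (x i : ℂ) * h (x i)) + β * ∑ p ∈ pairs N,
          D (x p.1) (x p.2) * (((x p.1 - x p.2) ^ 2 / ((x p.1 - x p.2) ^ 2 + δ) : ℝ) : ℂ) := by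
      unfold regScore
      simp only [Complex.ofReal_add, Complex.ofReal_mul, Complex.ofReal_neg, mul_add,
        Finset.sum_add_distrib]
      congr 1
      · rw [Finset.mul_sum, ← Finset.sum_neg_distrib]
        exact Finset.sum_congr rfl fun i _ => by push_cast; ring
      · simp only [Complex.ofReal_sum, Finset.mul_sum]
        rw [Finset.sum_comm]
        refine Finset.sum_congr rfl fun p _ => ?_
        have e1 : ∀ j : Fin N, ∑ i, h (x i) * ((Pi.single i 1 : Fin N → ℝ) j : ℂ) = h (x j) :=
          fun j => by simp [Pi.single_apply, apply_ite Complex.ofReal]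
        calc _ = ∑ i, (h (x i) * ((Pi.single i 1 : Fin N → ℝ) p.1 : ℂ) -
              h (x i) * ((Pi.single i 1 : Fin N → ℝ) p.2 : ℂ)) *
              (β * ((x p.1 - x p.2 : ℝ) : ℂ) / (((x p.1 - x p.2) ^ 2 + δ : ℝ) : ℂ)) :=
            Finset.sum_congr rfl fun i _ => by push_cast; ring
          _ = _ := by
            rw [← Finset.sum_mul, Finset.sum_sub_distrib, e1, e1, hD]
            push_cast; ring
    unfold loopTerm
    rw [Finset.sum_add_distrib, ← Finset.sum_mul, ← Finset.sum_mul, ← Finset.sum_mul, hs,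
      Finset.sum_add_distrib, ← Finset.sum_mul]
    ring
  simp_rw [hterm]
  rw [integral_finsetSum _ fun i _ => Integrable.fun_add (I1 i) (I2 i)]
  refine Finset.sum_eq_zero fun i _ => ?_
  rw [integral_add (I1 i) (I2 i), key i, add_neg_cancel]

lemma integral_loopTerm (hβ : 0 < β) (hN : 0 < N) (hh : ∀ t, HasDerivAt h (h' t) t)
    (bh : BddCont h) (bh' : BddCont h') (bth : BddCont fun t : ℝ => (t : ℂ) * h t)
    (hD : ∀ s t : ℝ, h s - h t = D s t * (s - t)) (bD : BddCont fun q : ℝ × ℝ => D q.1 q.2)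
    (bF : BddCont F) (bF' : ∀ i, BddCont (F' i))
    (hF : ∀ i x, HasLineDerivAt ℝ F (F' i x) x (Pi.single i 1)) :
    ∫ x, loopTerm β h h' D F F' (fun _ => 1) x * (gbeDensity β N x : ℂ) = 0 := by
  have b0 : BddCont fun x : Fin N → ℝ => ∑ i, h (x i) * F' i x +
      F x * (∑ i, h' (x i) - 2 * β * N * ∑ i, (x i : ℂ) * h (x i)) := by
    refine (BddCont.sum _ fun i _ => (bh.comp (g := fun x : Fin N → ℝ => x i)
      (by fun_prop)).mul (bF' i)).add (bF.mul (BddCont.sub (BddCont.sum _ fun i _ =>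
        bh'.comp (g := fun x : Fin N → ℝ => x i) (by fun_prop))
        ((BddCont.const (2 * β * N : ℂ)).mul (BddCont.sum _ fun i _ => 
          bth.comp (g := fun x : Fin N → ℝ => x i) (by fun_prop)))))
  have bp : ∀ p : Fin N × Fin N, BddCont fun x : Fin N → ℝ => D (x p.1) (x p.2) := fun p =>
    bD.comp (g := fun x : Fin N → ℝ => (x p.1, x p.2)) (by fun_prop)
  have b1 : BddCont fun x : Fin N → ℝ => ∑ p ∈ pairs N, ‖D (x p.1) (x p.2)‖ :=
    BddCont.sum _ fun p _ => (bp p).norm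
  obtain ⟨C0, hC0⟩ := b0.2
  obtain ⟨C1, hC1⟩ := b1.2
  obtain ⟨CF, hCF⟩ := bF.2
  have hsplit : ∀ θ x, loopTerm β h h' D F F' θ x = (∑ i, h (x i) * F' i x +
      F x * (∑ i, h' (x i) - 2 * β * N * ∑ i, (x i : ℂ) * h (x i))) +
      F x * (β * ∑ p ∈ pairs N, D (x p.1) (x p.2) * (θ (x p.1 - x p.2) : ℂ)) := fun θ x => by
    unfold loopTerm; ring
  have hbound : ∀ θ : ℝ → ℝ, (∀ d, |θ d| ≤ 1) → ∀ x, ‖loopTerm β h h' D F F' θ x‖ ≤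
      C0 + CF * (β * C1) := fun θ hθ x => by
    rw [hsplit]
    refine (norm_add_le _ _).trans (add_le_add (hC0 x) ?_)
    rw [norm_mul, norm_mul, Complex.norm_real, Real.norm_of_nonneg hβ.le]
    have h1 : ‖∑ p ∈ pairs N, D (x p.1) (x p.2) * (θ (x p.1 - x p.2) : ℂ)‖ ≤ C1 := by
      refine (norm_sum_le _ _).trans (le_trans (Finset.sum_le_sum fun p _ => ?_)
        ((le_abs_self _).trans (hC1 x)))
      rw [norm_mul, Complex.norm_real]
      exact mul_le_of_le_one_right (norm_nonneg _) (hθ _)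
    have h2 : 0 ≤ CF := (norm_nonneg _).trans (hCF x)
    exact mul_le_mul (hCF x) (mul_le_mul_of_nonneg_left h1 hβ.le) (by positivity) h2
  set δ : ℕ → ℝ := fun n => 1 / ((n : ℝ) + 1) with hδ
  have hδ0 : ∀ n, 0 < δ n := fun n => by positivity
  have hδ1 : ∀ n, δ n ≤ 1 := fun n => by
    rw [hδ]; simp only
    rw [div_le_one (by positivity)]; linarith [n.cast_nonneg (α := ℝ)]
  have hδt : Tendsto δ atTop (𝓝 0) := tendsto_one_div_add_atTop_nhds_zero_nat
  have hcont : ∀ n, Continuous fun x : Fin N → ℝ =>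
      loopTerm β h h' D F F' (fun d => d ^ 2 / (d ^ 2 + δ n)) x * (regDensity β N (δ n) x : ℂ) := by
    intro n
    simp_rw [hsplit]
    refine (b0.1.add (bF.1.mul (continuous_const.mul (continuous_finsetSum _ fun p _ =>
      (bp p).1.mul (Complex.continuous_ofReal.comp ?_))))).mul
      (Complex.continuous_ofReal.comp (continuous_regDensity hβ N _))
    exact Continuous.div (by fun_prop) (by fun_prop) fun x => by have := hδ0 n; positivity
  have hθle : ∀ n, ∀ d : ℝ, |d ^ 2 / (d ^ 2 + δ n)| ≤ 1 := fun n d => by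
    have := hδ0 n
    rw [abs_of_nonneg (by positivity), div_le_one (by positivity)]
    linarith
  have hlim := tendsto_integral_of_dominated_convergence (μ := (volume : Measure (Fin N → ℝ)))
    (F := fun n x => loopTerm β h h' D F F' (fun d => d ^ 2 / (d ^ 2 + δ n)) x *
      (regDensity β N (δ n) x : ℂ))
    (f := fun x => loopTerm β h h' D F F' (fun _ => 1) x * (gbeDensity β N x : ℂ))
    (fun x => (C0 + CF * (β * C1)) * densityBound β N x)
    (fun n => (hcont n).aestronglyMeasurable)
    ((integrable_densityBound hβ hN).const_mul _)
    (fun n => Eventually.of_forall fun x => by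
      rw [norm_mul, Complex.norm_real, Real.norm_of_nonneg (regDensity_nonneg (hδ0 n).le x)]
      have h1 := hbound _ (hθle n) x
      exact mul_le_mul h1 (regDensity_le hβ (hδ0 n).le (hδ1 n) x)
        (regDensity_nonneg (hδ0 n).le x) ((norm_nonneg _).trans h1))
    (Eventually.of_forall fun x => by
      have hρ : Tendsto (fun n => (regDensity β N (δ n) x : ℂ)) atTop
          (𝓝 (gbeDensity β N x : ℂ)) := by
        refine (Complex.continuous_ofReal.tendsto _).comp ?_
        rw [← regDensity_zero]
        unfold regDensity
        refine Tendsto.mul tendsto_const_nhds (tendsto_finsetProd _ fun p _ => ?_)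
        exact Tendsto.rpow_const (tendsto_const_nhds.add hδt) (Or.inr (by positivity))
      have hJ : Tendsto (fun n => loopTerm β h h' D F F' (fun d => d ^ 2 / (d ^ 2 + δ n)) x) atTop
          (𝓝 (loopTerm β h h' D F F' (fun d => if d = 0 then 0 else 1) x)) := by
        simp_rw [hsplit]
        refine tendsto_const_nhds.add (tendsto_const_nhds.mul (tendsto_const_nhds.mul
          (tendsto_finsetSum _ fun p _ => tendsto_const_nhds.mul
          ((Complex.continuous_ofReal.tendsto _).comp ?_))))
        by_cases hd : x p.1 - x p.2 = 0
        · simp [hd]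
        · rw [if_neg hd]
          have : Tendsto (fun n => (x p.1 - x p.2) ^ 2 / ((x p.1 - x p.2) ^ 2 + δ n)) atTop
              (𝓝 ((x p.1 - x p.2) ^ 2 / ((x p.1 - x p.2) ^ 2 + 0))) :=
            tendsto_const_nhds.div (tendsto_const_nhds.add hδt) (by positivity)
          rwa [add_zero, div_self (by positivity)] at this
      have heq : loopTerm β h h' D F F' (fun _ => 1) x * (gbeDensity β N x : ℂ) =
          loopTerm β h h' D F F' (fun d => if d = 0 then 0 else 1) x * (gbeDensity β N x : ℂ) := by
        by_cases hx : ∃ p ∈ pairs N, x p.1 - x p.2 = 0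
        · obtain ⟨p, hp, hp0⟩ := hx
          have : gbeDensity β N x = 0 := by
            unfold gbeDensity
            rw [Finset.prod_eq_zero hp (by rw [hp0, abs_zero, Real.zero_rpow hβ.ne']), mul_zero]
          simp [this]
        · push Not at hx
          congr 1
          rw [hsplit, hsplit]
          congr 3
          refine Finset.sum_congr rfl fun p hp => ?_
          rw [if_neg (hx p hp)]
      rw [heq]
      exact hJ.mul hρ)
  refine tendsto_nhds_unique hlim ?_
  have hz : ∀ n, ∫ x, loopTerm β h h' D F F' (fun d => d ^ 2 / (d ^ 2 + δ n)) x *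
      (regDensity β N (δ n) x : ℂ) = 0 := fun n =>
    integral_loopTerm_reg hβ hN hh bh bh' bth hD bF bF' hF (hδ0 n) (hδ1 n)
  simp_rw [hz]
  exact tendsto_const_nhds

end Loop

lemma gbeDensity_nonneg (β : ℝ) (N : ℕ) (x : Fin N → ℝ) : 0 ≤ gbeDensity β N x := by
  rw [← regDensity_zero]; exact regDensity_nonneg le_rfl x

lemma continuous_gbeDensity {β : ℝ} (hβ : 0 < β) (N : ℕ) : Continuous (gbeDensity β N) := by
  have := continuous_regDensity hβ N 0
  rwa [show regDensity β N 0 = gbeDensity β N from funext (regDensity_zero β N)] at this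

lemma isProbabilityMeasure_gbe {β : ℝ} (hβ : 0 < β) {N : ℕ} (hN : 0 < N) :
    IsProbabilityMeasure (gbe β N) := by
  have hint : Integrable (gbeDensity β N) := by
    refine (integrable_densityBound hβ hN).mono' (continuous_gbeDensity hβ N).aestronglyMeasurable
      (Eventually.of_forall fun x => ?_)
    rw [Real.norm_of_nonneg (gbeDensity_nonneg β N x), ← regDensity_zero]
    exact regDensity_le hβ le_rfl zero_le_one x
  have hfin : (volume.withDensity fun x => ENNReal.ofReal (gbeDensity β N x)) Set.univ ≠ ⊤ := by
    rw [withDensity_apply _ MeasurableSet.univ, setLIntegral_univ]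
    exact hint.lintegral_lt_top.ne
  have hpos : (volume.withDensity fun x => ENNReal.ofReal (gbeDensity β N x)) Set.univ ≠ 0 := by
    rw [withDensity_apply _ MeasurableSet.univ, setLIntegral_univ]
    have hm : Measurable fun x => ENNReal.ofReal (gbeDensity β N x) :=
      (continuous_gbeDensity hβ N).measurable.ennreal_ofReal
    rw [Ne, lintegral_eq_zero_iff hm]
    intro h0
    have hc : Continuous fun x => ENNReal.ofReal (gbeDensity β N x) :=
      ENNReal.continuous_ofReal.comp (continuous_gbeDensity hβ N)
    have h1 := (Continuous.ae_eq_iff_eq volume hc continuous_const).1 h0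
    have h2 := congrFun h1 (fun i : Fin N => ((i : ℕ) : ℝ))
    have h3 : 0 < gbeDensity β N (fun i : Fin N => ((i : ℕ) : ℝ)) := by
      refine mul_pos (Real.exp_pos _) (Finset.prod_pos fun p hp => Real.rpow_pos_of_pos ?_ _)
      rw [abs_pos, sub_ne_zero]
      exact fun he => (Finset.mem_filter.1 hp).2.ne' (Fin.ext (Nat.cast_injective he))
    have h4 : ENNReal.ofReal (gbeDensity β N (fun i : Fin N => ((i : ℕ) : ℝ))) = 0 := h2
    rw [ENNReal.ofReal_eq_zero] at h4
    linarith
  refine ⟨?_⟩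
  unfold gbe
  rw [Measure.smul_apply, smul_eq_mul]
  exact ENNReal.inv_mul_cancel hpos hfin

lemma integral_gbe {β : ℝ} (hβ : 0 < β) (N : ℕ) (f : (Fin N → ℝ) → ℂ) :
    ∃ c : ℝ, ∫ x, f x ∂(gbe β N) = c * ∫ x, f x * (gbeDensity β N x : ℂ) := by
  refine ⟨(((volume.withDensity fun x => ENNReal.ofReal (gbeDensity β N x))
    Set.univ)⁻¹).toReal, ?_⟩
  unfold gbe
  rw [integral_smul_measure, integral_withDensity_eq_integral_toReal_smul
    (continuous_gbeDensity hβ N).measurable.ennreal_ofReal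
    (Eventually.of_forall fun _ => ENNReal.ofReal_lt_top), Complex.real_smul]
  congr 2
  ext x
  rw [ENNReal.toReal_ofReal (gbeDensity_nonneg β N x), Complex.real_smul, mul_comm]

/-- The loop (Dyson–Schwinger) equation of the Gaussian β-ensemble. -/
theorem loop_equation {β : ℝ} {N : ℕ} {h h' : ℝ → ℂ} {D : ℝ → ℝ → ℂ} {F : (Fin N → ℝ) → ℂ}
    {F' : Fin N → (Fin N → ℝ) → ℂ} (hβ : 0 < β) (hN : 0 < N) (hh : ∀ t, HasDerivAt h (h' t) t)
    (bh : BddCont h) (bh' : BddCont h') (bth : BddCont fun t : ℝ => (t : ℂ) * h t)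
    (hD : ∀ s t : ℝ, h s - h t = D s t * (s - t)) (bD : BddCont fun q : ℝ × ℝ => D q.1 q.2)
    (bF : BddCont F) (bF' : ∀ i, BddCont (F' i))
    (hF : ∀ i x, HasLineDerivAt ℝ F (F' i x) x (Pi.single i 1)) :
    ∫ x, (∑ i, h (x i) * F' i x + F x * (∑ i, h' (x i) - 2 * β * N * ∑ i, (x i : ℂ) * h (x i) +
      β * ∑ p ∈ pairs N, D (x p.1) (x p.2))) ∂(gbe β N) = 0 := by
  obtain ⟨c, hc⟩ := integral_gbe hβ N (fun x => loopTerm β h h' D F F' (fun _ => 1) x)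
  rw [integral_loopTerm hβ hN hh bh bh' bth hD bD bF bF' hF, mul_zero] at hc
  simpa [loopTerm] using hc


lemma two_mul_sum_pairs {N : ℕ} (f : Fin N → Fin N → ℂ) (hf : ∀ i j, f i j = f j i) :
    2 * ∑ p ∈ pairs N, f p.1 p.2 = ∑ i, ∑ j, f i j - ∑ i, f i i := by
  have h1 : ∑ p ∈ pairs N, f p.1 p.2 = ∑ i, ∑ j, if j < i then f i j else 0 := by
    rw [Finset.sum_filter, ← Finset.univ_product_univ, Finset.sum_product]
  have h2 : ∑ p ∈ pairs N, f p.1 p.2 = ∑ i, ∑ j, if i < j then f i j else 0 := by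
    rw [h1, Finset.sum_comm]
    simp_rw [fun i j => hf j i]
  rw [two_mul]
  nth_rewrite 1 [h1]
  rw [h2, ← Finset.sum_add_distrib, ← Finset.sum_sub_distrib]
  refine Finset.sum_congr rfl fun i _ => ?_
  have h3 : f i i = ∑ j, if i = j then f i j else 0 := by simp
  rw [h3, ← Finset.sum_add_distrib, ← Finset.sum_sub_distrib]
  refine Finset.sum_congr rfl fun j _ => ?_
  rcases lt_trichotomy i j with h | h | h
  · simp [h, h.not_gt, h.ne]
  · simp [h]
  · simp [h, h.not_gt, h.ne']

/-- The resolvent function `t ↦ 1 / (z - t)`. -/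
noncomputable def res (z : ℂ) (t : ℝ) : ℂ := (z - t)⁻¹

section res

variable {z : ℂ} (hz : 0 < z.im)
include hz

lemma sub_ofReal_ne_zero (t : ℝ) : z - t ≠ 0 := fun h => by
  have := congrArg Complex.im h
  simp at this
  exact hz.ne' this

lemma norm_res_le (t : ℝ) : ‖res z t‖ ≤ 1 / z.im := by
  unfold res
  rw [norm_inv, ← one_div]
  refine one_div_le_one_div_of_le hz ?_
  have := Complex.abs_im_le_norm (z - t)
  simp at this
  exact (le_abs_self _).trans this

lemma hasDerivAt_res (t : ℝ) : HasDerivAt (res z) (res z t ^ 2) t := by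
  have h1 : HasDerivAt (fun t : ℝ => z - (t : ℂ)) (-1) t := by
    simpa using (Complex.ofRealCLM.hasDerivAt (x := t)).const_sub z
  have h2 := h1.fun_inv (sub_ofReal_ne_zero hz t)
  refine h2.congr_deriv ?_
  unfold res
  rw [inv_pow, neg_neg, one_div]

lemma hasDerivAt_res_pow (k : ℕ) (t : ℝ) :
    HasDerivAt (fun t => res z t ^ k) (k * res z t ^ (k + 1)) t := by
  refine ((hasDerivAt_res hz t).fun_pow k).congr_deriv ?_
  cases k with
  | zero => simp
  | succ k => simp only [Nat.add_sub_cancel]; ring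

lemma bddCont_res : BddCont (res z) :=
  ⟨continuous_iff_continuousAt.2 fun t => (hasDerivAt_res hz t).continuousAt, _, norm_res_le hz⟩

lemma ofReal_mul_res (t : ℝ) : (t : ℂ) * res z t = z * res z t - 1 := by
  have := mul_inv_cancel₀ (sub_ofReal_ne_zero hz t)
  unfold res
  linear_combination -this

lemma res_sub_res (s t : ℝ) : res z s - res z t = res z s * res z t * (s - t) := by
  have h1 := mul_inv_cancel₀ (sub_ofReal_ne_zero hz t)
  have h2 := mul_inv_cancel₀ (sub_ofReal_ne_zero hz s)
  unfold res
  linear_combination (-(z - s : ℂ)⁻¹) * h1 + (z - t : ℂ)⁻¹ * h2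

omit hz in
lemma im_res (t : ℝ) : (res z t).im = -(z.im * ‖res z t‖ ^ 2) := by
  unfold res
  rw [Complex.inv_im, norm_inv, inv_pow, ← Complex.normSq_eq_norm_sq]
  simp [div_eq_mul_inv]

end res

/-- The power sums of `1 / (z - x i)`. -/
noncomputable def psum {N : ℕ} (z : ℂ) (k : ℕ) (x : Fin N → ℝ) : ℂ := ∑ i, res z (x i) ^ k

/-- The power sums of `1 / |z - x i|`. -/
noncomputable def asum {N : ℕ} (z : ℂ) (k : ℕ) (x : Fin N → ℝ) : ℝ := ∑ i, ‖res z (x i)‖ ^ k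

/-- The centred resolvent trace. -/
noncomputable def resG {N : ℕ} (z : ℂ) (x : Fin N → ℝ) : ℂ := psum z 1 x - 2 * N * z

/-- The observable annihilated by the first loop equation. -/
noncomputable def loopA {N : ℕ} (β : ℝ) (z : ℂ) (x : Fin N → ℝ) : ℂ :=
  resG z x ^ 2 - 4 * N ^ 2 * (z ^ 2 - 1) - (1 - 2 / β) * psum z 2 x

/-- The observable annihilated by the second loop equation. -/
noncomputable def loopB {N : ℕ} (β : ℝ) (z : ℂ) (x : Fin N → ℝ) : ℂ :=
  resG z x * (psum z 2 x + 2 * N) + 4 * N ^ 2 * z - (1 - 2 / β) * psum z 3 x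

section sums

variable {N : ℕ} {z : ℂ} (hz : 0 < z.im)

lemma asum_nonneg (z : ℂ) (k : ℕ) (x : Fin N → ℝ) : 0 ≤ asum z k x :=
  Finset.sum_nonneg fun _ _ => by positivity

lemma norm_psum_le (z : ℂ) (k : ℕ) (x : Fin N → ℝ) : ‖psum z k x‖ ≤ asum z k x :=
  (norm_sum_le _ _).trans_eq (Finset.sum_congr rfl fun _ _ => norm_pow _ _)

include hz

lemma bddCont_res_apply (i : Fin N) : BddCont fun x : Fin N → ℝ => res z (x i) :=
  (bddCont_res hz).comp (g := fun x : Fin N → ℝ => x i) (by fun_prop)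

lemma bddCont_psum (k : ℕ) : BddCont (psum (N := N) z k) :=
  BddCont.sum _ fun i _ => (bddCont_res_apply hz i).pow k

lemma bddCont_asum (k : ℕ) : BddCont (asum (N := N) z k) :=
  BddCont.sum _ fun i _ => (bddCont_res_apply hz i).norm.rpow k

lemma bddCont_resG : BddCont (resG (N := N) z) := (bddCont_psum hz 1).sub (BddCont.const _)

lemma bddCont_loopA (β : ℝ) : BddCont (loopA (N := N) β z) :=
  (((bddCont_resG hz).pow 2).sub (BddCont.const _)).sub ((BddCont.const _).mul (bddCont_psum hz 2))

lemma bddCont_loopB (β : ℝ) : BddCont (loopB (N := N) β z) :=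
  (((bddCont_resG hz).mul ((bddCont_psum hz 2).add (BddCont.const _))).add (BddCont.const _)).sub
    ((BddCont.const _).mul (bddCont_psum hz 3))

lemma asum_succ_le (k : ℕ) (x : Fin N → ℝ) : asum z (k + 1) x ≤ asum z k x / z.im := by
  unfold asum
  rw [Finset.sum_div]
  refine Finset.sum_le_sum fun i _ => ?_
  rw [pow_succ, div_eq_mul_one_div]
  exact mul_le_mul_of_nonneg_left (norm_res_le hz _) (by positivity)

lemma asum_le (k : ℕ) (x : Fin N → ℝ) : asum z k x ≤ N / z.im ^ k := by
  unfold asum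
  refine (Finset.sum_le_sum (g := fun _ => (1 / z.im) ^ k) fun i _ =>
    pow_le_pow_left₀ (norm_nonneg _) (norm_res_le hz _) k).trans_eq ?_
  simp [div_eq_mul_inv]

omit hz in
lemma im_resG (x : Fin N → ℝ) : (resG z x).im = -(z.im * (asum z 2 x + 2 * N)) := by
  have h : (psum z 1 x).im = -(z.im * asum z 2 x) := by
    unfold psum asum
    rw [Complex.im_sum, Finset.mul_sum, ← Finset.sum_neg_distrib]
    exact Finset.sum_congr rfl fun i _ => by rw [pow_one, im_res]
  unfold resG
  rw [Complex.sub_im, h]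
  simp [Complex.mul_im]
  ring

lemma hasLineDerivAt_psum (k : ℕ) (i : Fin N) (x : Fin N → ℝ) :
    HasLineDerivAt ℝ (psum z k) (k * res z (x i) ^ (k + 1)) x (Pi.single i 1) :=
  hasLineDerivAt_sum (hasDerivAt_res_pow hz k) x i

lemma hasLineDerivAt_resG (i : Fin N) (x : Fin N → ℝ) :
    HasLineDerivAt ℝ (resG z) (res z (x i) ^ 2) x (Pi.single i 1) := by
  have h : HasDerivAt (fun t : ℝ => psum z 1 (x + t • (Pi.single i 1 : Fin N → ℝ)))
    ((1 : ℕ) * res z (x i) ^ 2) 0 := hasLineDerivAt_psum hz 1 i x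
  simpa [HasLineDerivAt, resG] using HasDerivAt.sub_const (2 * N * z) h

lemma hasLineDerivAt_loopA (β : ℝ) (i : Fin N) (x : Fin N → ℝ) :
    HasLineDerivAt ℝ (loopA β z) (2 * resG z x * res z (x i) ^ 2 -
      (1 - 2 / β) * (2 * res z (x i) ^ 3)) x (Pi.single i 1) := by
  have h1 : HasDerivAt (fun t : ℝ => resG z (x + t • (Pi.single i 1 : Fin N → ℝ)))
    (res z (x i) ^ 2) 0 := hasLineDerivAt_resG hz i x
  have h2 : HasDerivAt (fun t : ℝ => psum z 2 (x + t • (Pi.single i 1 : Fin N → ℝ)))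
    ((2 : ℕ) * res z (x i) ^ 3) 0 := hasLineDerivAt_psum hz 2 i x
  simpa [HasLineDerivAt, loopA] using ((h1.fun_pow 2).sub_const (4 * N ^ 2 * (z ^ 2 - 1))).fun_sub
    (h2.const_mul (1 - 2 / β : ℂ))

lemma hasLineDerivAt_loopB (β : ℝ) (i : Fin N) (x : Fin N → ℝ) :
    HasLineDerivAt ℝ (loopB β z) (res z (x i) ^ 2 * (psum z 2 x + 2 * N) +
      resG z x * (2 * res z (x i) ^ 3) - (1 - 2 / β) * (3 * res z (x i) ^ 4)) x
      (Pi.single i 1) := by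
  have h1 : HasDerivAt (fun t : ℝ => resG z (x + t • (Pi.single i 1 : Fin N → ℝ)))
    (res z (x i) ^ 2) 0 := hasLineDerivAt_resG hz i x
  have h2 : HasDerivAt (fun t : ℝ => psum z 2 (x + t • (Pi.single i 1 : Fin N → ℝ)))
    ((2 : ℕ) * res z (x i) ^ 3) 0 := hasLineDerivAt_psum hz 2 i x
  have h3 : HasDerivAt (fun t : ℝ => psum z 3 (x + t • (Pi.single i 1 : Fin N → ℝ)))
    ((3 : ℕ) * res z (x i) ^ 4) 0 := hasLineDerivAt_psum hz 3 i x
  simpa [HasLineDerivAt, loopB] using ((h1.fun_mul (h2.add_const (2 * N : ℂ))).add_const (4 * N ^ 2 * z)).fun_sub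
    (h3.const_mul (1 - 2 / β : ℂ))

end sums

section loops

variable {β : ℝ} {N : ℕ} {z : ℂ} {F : (Fin N → ℝ) → ℂ} {F' : Fin N → (Fin N → ℝ) → ℂ}

lemma sum_res_pairs (x : Fin N → ℝ) : 2 * ∑ p ∈ pairs N, res z (x p.1) * res z (x p.2) =
    psum z 1 x ^ 2 - psum z 2 x := by
  rw [two_mul_sum_pairs (fun i j => res z (x i) * res z (x j)) fun i j => mul_comm _ _]
  unfold psum
  rw [sq, Finset.sum_mul_sum]
  simp [sq]

lemma sum_res_sq_pairs (x : Fin N → ℝ) : 2 * ∑ p ∈ pairs N,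
    res z (x p.1) * res z (x p.2) * (res z (x p.1) + res z (x p.2)) =
    2 * psum z 1 x * psum z 2 x - 2 * psum z 3 x := by
  rw [two_mul_sum_pairs (fun i j => res z (x i) * res z (x j) * (res z (x i) + res z (x j)))
    fun i j => by ring]
  have h1 : ∑ i, ∑ j, res z (x i) * res z (x j) * (res z (x i) + res z (x j)) =
      psum z 2 x * psum z 1 x + psum z 1 x * psum z 2 x := by
    unfold psum
    rw [Finset.sum_mul_sum, Finset.sum_mul_sum, ← Finset.sum_add_distrib]
    refine Finset.sum_congr rfl fun i _ => ?_
    rw [← Finset.sum_add_distrib]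
    exact Finset.sum_congr rfl fun j _ => by ring
  rw [h1]
  unfold psum
  rw [Finset.mul_sum _ _ (2 : ℂ)]
  have h2 : ∀ i, res z (x i) * res z (x i) * (res z (x i) + res z (x i)) = 2 * res z (x i) ^ 3 :=
    fun i => by ring
  simp_rw [h2]
  rw [← Finset.mul_sum, ← Finset.mul_sum]
  ring

variable (hβ : 0 < β) (hN : 0 < N) (hz : 0 < z.im) (bF : BddCont F) (bF' : ∀ i, BddCont (F' i))
  (hF : ∀ i x, HasLineDerivAt ℝ F (F' i x) x (Pi.single i 1))
include hβ hN hz bF bF' hF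

lemma loop_one : ∫ x, (∑ i, res z (x i) * F' i x + β / 2 * (F x * loopA β z x)) ∂(gbe β N) = 0 := by
  have h := loop_equation (D := fun s t => res z s * res z t) hβ hN (hasDerivAt_res hz)
    (bddCont_res hz) ((bddCont_res hz).pow 2)
    ((((BddCont.const z).mul (bddCont_res hz)).sub (BddCont.const 1)).congr (ofReal_mul_res hz))
    (res_sub_res hz)
    (((bddCont_res hz).comp continuous_fst).mul ((bddCont_res hz).comp continuous_snd))
    bF bF' hF
  rw [← h]
  refine integral_congr_ae (Eventually.of_forall fun x => ?_)
  simp only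
  congr 1
  have h1 := sum_res_pairs (z := z) x
  have h2 : ∑ i, (x i : ℂ) * res z (x i) = z * psum z 1 x - N := by
    simp_rw [ofReal_mul_res hz]
    simp [psum, Finset.mul_sum]
  have h3 : ∑ i, res z (x i) ^ 2 = psum z 2 x := rfl
  rw [h2, h3]
  have hb : (β : ℂ) ≠ 0 := by exact_mod_cast hβ.ne'
  unfold loopA resG
  field_simp
  linear_combination (-F x * β) * h1

lemma loop_two : ∫ x, (∑ i, res z (x i) ^ 2 * F' i x + β * (F x * loopB β z x)) ∂(gbe β N) = 0 := by
  have h := loop_equation (D := fun s t => res z s * res z t * (res z s + res z t)) hβ hN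
    (hasDerivAt_res_pow hz 2)
    ((bddCont_res hz).pow 2) ((BddCont.const _).mul ((bddCont_res hz).pow 3))
    ((((BddCont.const z).mul ((bddCont_res hz).pow 2)).sub (bddCont_res hz)).congr
      (fun t => by linear_combination res z t * ofReal_mul_res hz t))
    (fun s t => by linear_combination (res z s + res z t) * res_sub_res hz s t)
    ((((bddCont_res hz).comp continuous_fst).mul ((bddCont_res hz).comp continuous_snd)).mul
    (((bddCont_res hz).comp continuous_fst).add ((bddCont_res hz).comp continuous_snd)))
    bF bF' hF
  rw [← h]
  refine integral_congr_ae (Eventually.of_forall fun x => ?_)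
  simp only
  congr 1
  have h1 := sum_res_sq_pairs (z := z) x
  have h2 : ∑ i, (x i : ℂ) * res z (x i) ^ 2 = z * psum z 2 x - psum z 1 x := by
    unfold psum
    rw [Finset.mul_sum, ← Finset.sum_sub_distrib]
    exact Finset.sum_congr rfl fun i _ => by linear_combination res z (x i) * ofReal_mul_res hz (x i)
  have h3 : ∑ i, ((2 : ℕ) : ℂ) * res z (x i) ^ (2 + 1) = 2 * psum z 3 x := by
    simp [psum, Finset.mul_sum]
  rw [h2, h3]
  have hb : (β : ℂ) ≠ 0 := by exact_mod_cast hβ.ne'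
  unfold loopB resG
  field_simp
  linear_combination (-F x * β / 2) * h1

end loops


lemma integral_le_of_forall_le {N : ℕ} {μ : Measure (Fin N → ℝ)} [IsProbabilityMeasure μ]
    {f g₁ g₂ g₃ : (Fin N → ℝ) → ℝ} (hf : BddCont f) (h₁ : BddCont g₁) (h₂ : BddCont g₂)
    (h₃ : BddCont g₃) {c₁ c₂ c₃ c : ℝ} (h : ∀ x, f x ≤ c₁ * g₁ x + c₂ * g₂ x + c₃ * g₃ x + c) :
    ∫ x, f x ∂μ ≤ c₁ * ∫ x, g₁ x ∂μ + c₂ * ∫ x, g₂ x ∂μ + c₃ * ∫ x, g₃ x ∂μ + c := by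
  have i₁ := (h₁.integrable μ).const_mul c₁
  have i₂ := (h₂.integrable μ).const_mul c₂
  have i₃ := (h₃.integrable μ).const_mul c₃
  have h3 := integral_mono (hf.integrable μ)
    (((i₁.fun_add i₂).fun_add i₃).fun_add (integrable_const c)) h
  rw [integral_add ((i₁.fun_add i₂).fun_add i₃) (integrable_const c),
    integral_add (i₁.fun_add i₂) i₃, integral_add i₁ i₂, integral_const_mul,
    integral_const_mul, integral_const_mul] at h3
  simpa using h3

lemma mul_integral_le_of_integral_eq_zero {N : ℕ} {μ : Measure (Fin N → ℝ)}
    [IsProbabilityMeasure μ] {g : (Fin N → ℝ) → ℂ} {r b : (Fin N → ℝ) → ℝ} {c : ℝ}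
    (hg : BddCont g) (hr : BddCont r) (hb : BddCont b) (hgb : ∀ x, ‖g x‖ ≤ b x)
    (h : ∫ x, (g x + c * (r x : ℂ)) ∂μ = 0) : c * ∫ x, r x ∂μ ≤ ∫ x, b x ∂μ := by
  rw [integral_add (hg.integrable μ) (((BddCont.const _).mul hr.ofReal).integrable μ),
    integral_const_mul, integral_complex_ofReal] at h
  have h1 : ‖∫ x, g x ∂μ‖ ≤ ∫ x, b x ∂μ := (norm_integral_le_integral_norm _).trans
    (integral_mono (hg.norm.integrable μ) (hb.integrable μ) hgb)
  have h2 : ∫ x, g x ∂μ = ((-(c * ∫ x, r x ∂μ) : ℝ) : ℂ) := by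
    push_cast
    linear_combination h
  rw [h2, Complex.norm_real, norm_neg] at h1
  exact (le_abs_self _).trans h1

lemma hasLineDerivAt_conj {N : ℕ} {F : (Fin N → ℝ) → ℂ} {c : ℂ} {x v : Fin N → ℝ}
    (h : HasLineDerivAt ℝ F c x v) :
    HasLineDerivAt ℝ (fun x => (starRingEnd ℂ) (F x)) ((starRingEnd ℂ) c) x v :=
  HasDerivAt.star (f := fun t : ℝ => F (x + t • v)) h

section moments

variable {β : ℝ} {N : ℕ} {z : ℂ} (hβ : 0 < β) (hN : 0 < N) (hz : 0 < z.im)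
include hβ hN hz

lemma integral_norm_loopA_sq_le : ∫ x, ‖loopA β z x‖ ^ 2 ∂(gbe β N) ≤ 2 / β *
    ∫ x, (2 * ‖resG z x‖ * asum z 3 x + 2 * |1 - 2 / β| * asum z 4 x) ∂(gbe β N) := by
  have := isProbabilityMeasure_gbe hβ hN
  have bA' : ∀ i : Fin N, BddCont fun x : Fin N → ℝ => (starRingEnd ℂ)
      (2 * resG z x * res z (x i) ^ 2 - (1 - 2 / β) * (2 * res z (x i) ^ 3)) := fun i =>
    ((((BddCont.const _).mul (bddCont_resG hz)).mul ((bddCont_res_apply hz i).pow 2)).sub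
      ((BddCont.const _).mul ((BddCont.const _).mul ((bddCont_res_apply hz i).pow 3)))).conj
  have h := loop_one hβ hN hz (bddCont_loopA hz β).conj bA'
    (fun i x => hasLineDerivAt_conj (hasLineDerivAt_loopA hz β i x))
  have h1 := mul_integral_le_of_integral_eq_zero (c := β / 2)
    (r := fun x : Fin N → ℝ => ‖loopA β z x‖ ^ 2)
    (b := fun x : Fin N → ℝ => 2 * ‖resG z x‖ * asum z 3 x + 2 * |1 - 2 / β| * asum z 4 x)
    (BddCont.sum Finset.univ fun i _ => (bddCont_res_apply hz i).mul (bA' i))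
    ((bddCont_loopA hz β).norm.rpow 2)
    ((((BddCont.const _).mul (bddCont_resG hz).norm).mul (bddCont_asum hz 3)).add
      ((BddCont.const _).mul (bddCont_asum hz 4)))
    (fun x => by
      refine (norm_sum_le _ _).trans ?_
      unfold asum
      rw [Finset.mul_sum, Finset.mul_sum, ← Finset.sum_add_distrib]
      refine Finset.sum_le_sum fun i _ => ?_
      rw [norm_mul, RCLike.norm_conj]
      refine (mul_le_mul_of_nonneg_left (norm_sub_le _ _) (norm_nonneg _)).trans_eq ?_
      have hk : ‖(1 - 2 / β : ℂ)‖ = |1 - 2 / β| := by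
        rw [← Real.norm_eq_abs, ← Complex.norm_real]; push_cast; rfl
      simp only [norm_mul, norm_pow, hk, Complex.norm_ofNat]
      ring)
    (by
      rw [← h]
      refine integral_congr_ae (Eventually.of_forall fun x => ?_)
      simp only [Complex.conj_mul']
      push_cast; rfl)
  rw [div_mul_eq_mul_div, le_div_iff₀ hβ]
  linarith

lemma integral_norm_loopB_sq_le : ∫ x, ‖loopB β z x‖ ^ 2 ∂(gbe β N) ≤ 1 / β *
    ∫ x, ((asum z 2 x + 2 * N) * asum z 4 x + 2 * ‖resG z x‖ * asum z 5 x +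
      3 * |1 - 2 / β| * asum z 6 x) ∂(gbe β N) := by
  have := isProbabilityMeasure_gbe hβ hN
  have bA' : ∀ i : Fin N, BddCont fun x : Fin N → ℝ => (starRingEnd ℂ)
      (res z (x i) ^ 2 * (psum z 2 x + 2 * N) +
      resG z x * (2 * res z (x i) ^ 3) - (1 - 2 / β) * (3 * res z (x i) ^ 4)) := fun i =>
    (((((bddCont_res_apply hz i).pow 2).mul ((bddCont_psum hz 2).add (BddCont.const _))).add
      ((bddCont_resG hz).mul ((BddCont.const _).mul ((bddCont_res_apply hz i).pow 3)))).sub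
      ((BddCont.const _).mul ((BddCont.const _).mul ((bddCont_res_apply hz i).pow 4)))).conj
  have h := loop_two hβ hN hz (bddCont_loopB hz β).conj bA'
    (fun i x => hasLineDerivAt_conj (hasLineDerivAt_loopB hz β i x))
  have h1 := mul_integral_le_of_integral_eq_zero (c := β)
    (r := fun x : Fin N → ℝ => ‖loopB β z x‖ ^ 2)
    (b := fun x : Fin N → ℝ => (asum z 2 x + 2 * N) * asum z 4 x +
      2 * ‖resG z x‖ * asum z 5 x + 3 * |1 - 2 / β| * asum z 6 x)
    (BddCont.sum Finset.univ fun i _ => ((bddCont_res_apply hz i).pow 2).mul (bA' i))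
    ((bddCont_loopB hz β).norm.rpow 2)
    (((((bddCont_asum hz 2).add (BddCont.const _)).mul (bddCont_asum hz 4)).add
      (((BddCont.const _).mul (bddCont_resG hz).norm).mul (bddCont_asum hz 5))).add
      ((BddCont.const _).mul (bddCont_asum hz 6)))
    (fun x => by
      refine (norm_sum_le _ _).trans ?_
      have hP : ‖psum z 2 x + 2 * N‖ ≤ asum z 2 x + 2 * N := by
        refine (norm_add_le _ _).trans (add_le_add (norm_psum_le z 2 x) ?_)
        simp
      have hk : ‖(1 - 2 / β : ℂ)‖ = |1 - 2 / β| := by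
        rw [← Real.norm_eq_abs, ← Complex.norm_real]; push_cast; rfl
      rw [asum.eq_def z 4, asum.eq_def z 5, asum.eq_def z 6]
      rw [Finset.mul_sum, Finset.mul_sum, Finset.mul_sum, ← Finset.sum_add_distrib,
        ← Finset.sum_add_distrib]
      refine Finset.sum_le_sum fun i _ => ?_
      rw [norm_mul, RCLike.norm_conj]
      refine (mul_le_mul_of_nonneg_left ((norm_sub_le _ _).trans
        (add_le_add_left (norm_add_le _ _) _)) (norm_nonneg _)).trans ?_
      simp only [norm_mul, norm_pow, hk, Complex.norm_ofNat]
      have := mul_le_mul_of_nonneg_left hP (by positivity : 0 ≤ ‖res z (x i)‖ ^ 4)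
      linarith)
    (by
      rw [← h]
      refine integral_congr_ae (Eventually.of_forall fun x => ?_)
      simp only [Complex.conj_mul']
      push_cast; rfl)
  rw [div_mul_eq_mul_div, le_div_iff₀ hβ]
  linarith

end moments


/-- Admissible spectral parameters: `s` is the branch of `√(z² - 1)` in the upper half plane,
comparable with its imaginary part, and `z` lies above the local eigenvalue spacing. -/
structure Admissible (q : ℝ) (N : ℕ) (z s : ℂ) : Prop where
  pos : 0 < N
  im_pos : 0 < z.im
  sq_eq : s ^ 2 = z ^ 2 - 1
  im_sqrt_pos : 0 < s.im
  norm_le : ‖s‖ ≤ q * s.im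
  one_le : 1 ≤ N * ‖s‖ * z.im

section pointwise

variable {N : ℕ} {z : ℂ} (hz : 0 < z.im)
include hz

lemma asum_two_le (x : Fin N → ℝ) : asum z 2 x + 2 * N ≤ z.im⁻¹ * ‖resG z x‖ := by
  have h1 := Complex.abs_im_le_norm (resG z x)
  rw [im_resG, abs_neg, abs_of_nonneg (by have := asum_nonneg z 2 x; positivity)] at h1
  rw [inv_mul_eq_div, le_div_iff₀ hz]
  linarith

lemma asum_add_two_le (k : ℕ) (x : Fin N → ℝ) :
    asum z (k + 2) x ≤ z.im⁻¹ ^ (k + 1) * ‖resG z x‖ := by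
  induction k with
  | zero =>
    have := asum_two_le hz x
    have h2 : (0 : ℝ) ≤ N := by positivity
    rw [zero_add, pow_one]
    linarith
  | succ k ih =>
    refine (asum_succ_le hz (k + 2) x).trans ?_
    rw [div_eq_inv_mul]
    refine (mul_le_mul_of_nonneg_left ih (by positivity)).trans_eq ?_
    ring

end pointwise

section bounds

variable {β : ℝ} {N : ℕ} {z s : ℂ} {q : ℝ}

lemma norm_kappa (β : ℝ) : ‖(1 - 2 / β : ℂ)‖ = |1 - 2 / β| := by
  rw [← Real.norm_eq_abs, ← Complex.norm_real]; push_cast; rfl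

section admissible

variable (h : Admissible q N z s)
include h

lemma Admissible.inv_im_le : z.im⁻¹ ≤ N * ‖s‖ := by
  rw [inv_le_iff_one_le_mul₀ h.im_pos]; exact h.one_le

lemma Admissible.prod_eq (β : ℝ) (x : Fin N → ℝ) :
    (resG z x + 2 * N * s) * (resG z x - 2 * N * s) = loopA β z x + (1 - 2 / β) * psum z 2 x := by
  unfold loopA
  linear_combination (-4 * (N : ℂ) ^ 2) * h.sq_eq

lemma Admissible.norm_psum_two_le (x : Fin N → ℝ) : ‖psum z 2 x‖ ≤ z.im⁻¹ * ‖resG z x‖ :=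
  (norm_psum_le z 2 x).trans (by simpa using asum_add_two_le h.im_pos 0 x)

lemma Admissible.sq_le (β : ℝ) (x : Fin N → ℝ) : ‖resG z x‖ ^ 2 ≤ ‖loopA β z x‖ +
    |1 - 2 / β| * (z.im⁻¹ * ‖resG z x‖) + 4 * (N * ‖s‖) ^ 2 := by
  have h1 : resG z x ^ 2 = loopA β z x + (1 - 2 / β) * psum z 2 x + 4 * (N * s) ^ 2 := by
    linear_combination h.prod_eq β x
  rw [← norm_pow, h1]
  refine (norm_add_le _ _).trans (add_le_add ((norm_add_le _ _).trans
    (add_le_add le_rfl ?_)) ?_)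
  · rw [norm_mul, norm_kappa]
    exact mul_le_mul_of_nonneg_left (h.norm_psum_two_le x) (abs_nonneg _)
  · simp

lemma Admissible.le_norm_sub (x : Fin N → ℝ) : 2 * (N * ‖s‖) ≤ q * ‖resG z x - 2 * N * s‖ := by
  have h1 := Complex.abs_im_le_norm (resG z x - 2 * N * s)
  have h2 : (resG z x - 2 * N * s).im = -(z.im * (asum z 2 x + 2 * N) + 2 * N * s.im) := by
    rw [Complex.sub_im, im_resG]
    simp [Complex.mul_im]; ring
  have h3 := asum_nonneg z 2 x
  have h4 := h.im_pos
  have h5 := h.im_sqrt_pos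
  rw [h2, abs_neg, abs_of_nonneg (by positivity)] at h1
  have h6 : 0 ≤ z.im * (asum z 2 x + 2 * N) := by positivity
  have hq : 0 ≤ q := by
    by_contra hq
    have := h.norm_le
    nlinarith [norm_nonneg s]
  have h7 : (N : ℝ) * ‖s‖ ≤ N * (q * s.im) := mul_le_mul_of_nonneg_left h.norm_le (by positivity)
  have h8 : q * (2 * N * s.im) ≤ q * ‖resG z x - 2 * N * s‖ :=
    mul_le_mul_of_nonneg_left (by linarith) hq
  linarith

lemma Admissible.dist_mul_le (β : ℝ) (x : Fin N → ℝ) :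
    2 * (N * ‖s‖) * ‖resG z x + 2 * N * s‖ ≤
      q * (‖loopA β z x‖ + |1 - 2 / β| * ‖psum z 2 x‖) := by
  have hq : 0 ≤ q := by
    by_contra hq
    have := h.norm_le
    have := h.im_sqrt_pos
    nlinarith [norm_nonneg s]
  calc _ ≤ q * ‖resG z x - 2 * N * s‖ * ‖resG z x + 2 * N * s‖ :=
        mul_le_mul_of_nonneg_right (h.le_norm_sub x) (norm_nonneg _)
    _ = q * ‖loopA β z x + (1 - 2 / β) * psum z 2 x‖ := by
        rw [← h.prod_eq β x, norm_mul]; ring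
    _ ≤ _ := by
        refine mul_le_mul_of_nonneg_left ((norm_add_le _ _).trans_eq ?_) hq
        rw [norm_mul, norm_kappa]

lemma Admissible.norm_pos : 0 < N * ‖s‖ := by
  have : 0 < N * ‖s‖ * z.im := one_pos.trans_le h.one_le
  exact pos_of_mul_pos_left this h.im_pos.le

lemma Admissible.dist_sq_le (β : ℝ) (x : Fin N → ℝ) :
    ‖resG z x + 2 * N * s‖ ^ 2 ≤ q ^ 2 / (2 * (N * ‖s‖) ^ 2) *
      (‖loopA β z x‖ ^ 2 + |1 - 2 / β| ^ 2 * ‖psum z 2 x‖ ^ 2) := by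
  have h1 := pow_le_pow_left₀ (by positivity) (h.dist_mul_le β x) 2
  have h0 := h.norm_pos
  rw [div_mul_eq_mul_div, le_div_iff₀ (by positivity)]
  have h2 : (‖loopA β z x‖ + |1 - 2 / β| * ‖psum z 2 x‖) ^ 2 ≤
      2 * (‖loopA β z x‖ ^ 2 + |1 - 2 / β| ^ 2 * ‖psum z 2 x‖ ^ 2) := by
    nlinarith [sq_nonneg (‖loopA β z x‖ - |1 - 2 / β| * ‖psum z 2 x‖)]
  have h3 := mul_le_mul_of_nonneg_left h2 (sq_nonneg q)
  nlinarith

end admissible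

/-- The constant in the loop-equation moment bounds. -/
noncomputable def momentConst (β : ℝ) : ℝ := 4 / β * (1 + |1 - 2 / β|)

section firstBounds

variable (hβ : 0 < β) (hN : 0 < N) (hz : 0 < z.im)
include hβ

lemma momentConst_pos : 0 < momentConst β := by unfold momentConst; positivity

include hN hz

lemma integral_norm_loopA_sq_le' : ∫ x, ‖loopA β z x‖ ^ 2 ∂(gbe β N) ≤
    momentConst β * z.im⁻¹ ^ 2 * (∫ x, ‖resG z x‖ ^ 2 ∂(gbe β N) + z.im⁻¹ ^ 2) := by
  have := isProbabilityMeasure_gbe hβ hN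
  set k := |1 - 2 / β| with hk
  have hk0 : 0 ≤ k := abs_nonneg _
  set w := z.im⁻¹ with hw
  have hw0 : 0 < w := inv_pos.2 hz
  have bg := (bddCont_resG (N := N) hz).norm.rpow 2
  have h2 := integral_le_of_forall_le (μ := gbe β N)
    (f := fun x : Fin N → ℝ => 2 * ‖resG z x‖ * asum z 3 x + 2 * k * asum z 4 x)
    (c₁ := (2 + k) * w ^ 2) (c₂ := 0) (c₃ := 0) (c := k * w ^ 4)
    ((((BddCont.const _).mul (bddCont_resG hz).norm).mul (bddCont_asum hz 3)).add
      ((BddCont.const _).mul (bddCont_asum hz 4))) bg bg bg (fun x => by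
      have h3 := mul_le_mul_of_nonneg_left (asum_add_two_le hz 1 x)
        (by positivity : 0 ≤ 2 * ‖resG z x‖)
      have h4 := mul_le_mul_of_nonneg_left (asum_add_two_le hz 2 x)
        (by positivity : 0 ≤ 2 * k)
      have h5 : 0 ≤ k * (w ^ 2 * (‖resG z x‖ - w) ^ 2) := by positivity
      rw [← hw] at h3 h4
      norm_num at h3 h4
      nlinarith)
  have h6 := integral_norm_loopA_sq_le hβ hN hz
  have h7 := mul_le_mul_of_nonneg_left h2 (by positivity : 0 ≤ 2 / β)
  refine h6.trans (h7.trans ?_)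
  have hM : 0 ≤ ∫ x, ‖resG z x‖ ^ 2 ∂(gbe β N) := integral_nonneg fun _ => by positivity
  unfold momentConst
  rw [← hk]
  have e : 4 / β = 2 / β * 2 := by ring
  have h8 : 0 ≤ 2 / β * w ^ 2 * (k * ∫ x, ‖resG z x‖ ^ 2 ∂(gbe β N)) := by positivity
  have h9 : 0 ≤ 2 / β * w ^ 2 * (w ^ 2 * (k + 2)) := by positivity
  rw [e]
  nlinarith

lemma integral_norm_loopB_sq_le' : ∫ x, ‖loopB β z x‖ ^ 2 ∂(gbe β N) ≤
    momentConst β * z.im⁻¹ ^ 4 * (∫ x, ‖resG z x‖ ^ 2 ∂(gbe β N) + z.im⁻¹ ^ 2) := by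
  have := isProbabilityMeasure_gbe hβ hN
  set k := |1 - 2 / β| with hk
  have hk0 : 0 ≤ k := abs_nonneg _
  set w := z.im⁻¹ with hw
  have hw0 : 0 < w := inv_pos.2 hz
  have bg := (bddCont_resG (N := N) hz).norm.rpow 2
  have h2 := integral_le_of_forall_le (μ := gbe β N)
    (f := fun x : Fin N → ℝ => (asum z 2 x + 2 * N) * asum z 4 x + 2 * ‖resG z x‖ * asum z 5 x +
      3 * k * asum z 6 x)
    (c₁ := (3 + 2 * k) * w ^ 4) (c₂ := 0) (c₃ := 0) (c := 2 * k * w ^ 6)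
    (((((bddCont_asum hz 2).add (BddCont.const _)).mul (bddCont_asum hz 4)).add
      (((BddCont.const _).mul (bddCont_resG hz).norm).mul (bddCont_asum hz 5))).add
      ((BddCont.const _).mul (bddCont_asum hz 6))) bg bg bg (fun x => by
      have h2 := mul_le_mul (asum_two_le hz x) (asum_add_two_le hz 2 x) (asum_nonneg z 4 x)
        (by rw [← hw]; positivity)
      have h3 := mul_le_mul_of_nonneg_left (asum_add_two_le hz 3 x)
        (by positivity : 0 ≤ 2 * ‖resG z x‖)
      have h4 := mul_le_mul_of_nonneg_left (asum_add_two_le hz 4 x)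
        (by positivity : 0 ≤ 3 * k)
      have h5 : 0 ≤ k * (w ^ 4 * (‖resG z x‖ - w) ^ 2) := by positivity
      have h6 : 0 ≤ k * (w ^ 4 * ‖resG z x‖ ^ 2) := by positivity
      have h7 : 0 ≤ k * w ^ 6 := by positivity
      rw [← hw] at h2 h3 h4
      norm_num at h2 h3 h4
      nlinarith)
  have h6 := integral_norm_loopB_sq_le hβ hN hz
  have h7 := mul_le_mul_of_nonneg_left h2 (by positivity : 0 ≤ 1 / β)
  refine h6.trans (h7.trans ?_)
  have hM : 0 ≤ ∫ x, ‖resG z x‖ ^ 2 ∂(gbe β N) := integral_nonneg fun _ => by positivity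
  unfold momentConst
  rw [← hk]
  have e : 4 / β = 1 / β * 4 := by ring
  have h8 : 0 ≤ 1 / β * w ^ 4 * ((1 + 2 * k) * ∫ x, ‖resG z x‖ ^ 2 ∂(gbe β N)) := by positivity
  have h9 : 0 ≤ 1 / β * w ^ 4 * (w ^ 2 * (2 * k + 4)) := by positivity
  rw [e]
  nlinarith

end firstBounds

section admissibleBounds

variable (hβ : 0 < β) (h : Admissible q N z s)
include hβ h

/-- The constant bounding the second moment of `resG`. -/
noncomputable def resConst (β : ℝ) : ℝ := 9 + 2 * momentConst β + 2 * |1 - 2 / β| ^ 2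

lemma integral_norm_resG_sq_le :
    ∫ x, ‖resG z x‖ ^ 2 ∂(gbe β N) ≤ resConst β * (N * ‖s‖) ^ 2 := by
  have := isProbabilityMeasure_gbe hβ h.pos
  have hz := h.im_pos
  have hK := momentConst_pos hβ
  have hwa := h.inv_im_le
  have hA := integral_norm_loopA_sq_le' hβ h.pos hz
  have bg := (bddCont_resG (N := N) hz).norm.rpow 2
  have h1 := fun x => h.sq_le β x
  set k := |1 - 2 / β| with hk
  set w := z.im⁻¹ with hw
  have hw0 : 0 < w := inv_pos.2 hz
  set a := N * ‖s‖ with ha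
  set K := momentConst β with hKd
  set M := ∫ x, ‖resG z x‖ ^ 2 ∂(gbe β N) with hM
  have h2 := integral_le_of_forall_le (μ := gbe β N) (c₁ := (4 * K * w ^ 2)⁻¹)
    (c₂ := 1 / 4) (c₃ := 0) (c := K * w ^ 2 + k ^ 2 * w ^ 2 + 4 * a ^ 2) bg
    ((bddCont_loopA hz β).norm.rpow 2) bg bg (fun x => by
      have h3 : ‖loopA β z x‖ ≤ (4 * K * w ^ 2)⁻¹ * ‖loopA β z x‖ ^ 2 + K * w ^ 2 := by
        have h4 : 0 ≤ (4 * K * w ^ 2)⁻¹ * (‖loopA β z x‖ - 2 * K * w ^ 2) ^ 2 := by positivity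
        have h5 : (4 * K * w ^ 2)⁻¹ * (‖loopA β z x‖ - 2 * K * w ^ 2) ^ 2 =
          (4 * K * w ^ 2)⁻¹ * ‖loopA β z x‖ ^ 2 + K * w ^ 2 - ‖loopA β z x‖ := by
          field_simp; ring
        linarith
      nlinarith [h1 x, sq_nonneg (‖resG z x‖ / 2 - k * w)])
  have h6 := mul_le_mul_of_nonneg_left hA (by positivity : 0 ≤ (4 * K * w ^ 2)⁻¹)
  have h7 : (4 * K * w ^ 2)⁻¹ * (K * w ^ 2 * (M + w ^ 2)) = (M + w ^ 2) / 4 := by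
    field_simp
  rw [h7] at h6
  have h8 : w ^ 2 ≤ a ^ 2 := pow_le_pow_left₀ hw0.le hwa 2
  have h9 := mul_le_mul_of_nonneg_left h8 (by positivity : 0 ≤ 1 / 4 + K + k ^ 2)
  unfold resConst
  nlinarith

omit h in
lemma resConst_nonneg : 0 ≤ resConst β := by
  have := momentConst_pos hβ
  unfold resConst
  positivity

lemma integral_norm_loopA_sq_le_sq : ∫ x, ‖loopA β z x‖ ^ 2 ∂(gbe β N) ≤
    momentConst β * (resConst β + 1) * z.im⁻¹ ^ 2 * (N * ‖s‖) ^ 2 := by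
  refine (integral_norm_loopA_sq_le' hβ h.pos h.im_pos).trans ?_
  have hK := momentConst_pos hβ
  have h1 := integral_norm_resG_sq_le hβ h
  have h2 : z.im⁻¹ ^ 2 ≤ (N * ‖s‖) ^ 2 := pow_le_pow_left₀ (inv_pos.2 h.im_pos).le h.inv_im_le 2
  calc _ ≤ momentConst β * z.im⁻¹ ^ 2 * (resConst β * (N * ‖s‖) ^ 2 + (N * ‖s‖) ^ 2) := by
        gcongr
    _ = _ := by ring

lemma integral_norm_loopB_sq_le_sq : ∫ x, ‖loopB β z x‖ ^ 2 ∂(gbe β N) ≤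
    momentConst β * (resConst β + 1) * z.im⁻¹ ^ 4 * (N * ‖s‖) ^ 2 := by
  refine (integral_norm_loopB_sq_le' hβ h.pos h.im_pos).trans ?_
  have hK := momentConst_pos hβ
  have h1 := integral_norm_resG_sq_le hβ h
  have h2 : z.im⁻¹ ^ 2 ≤ (N * ‖s‖) ^ 2 := pow_le_pow_left₀ (inv_pos.2 h.im_pos).le h.inv_im_le 2
  calc _ ≤ momentConst β * z.im⁻¹ ^ 4 * (resConst β * (N * ‖s‖) ^ 2 + (N * ‖s‖) ^ 2) := by
        gcongr
    _ = _ := by ring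

/-- The constant bounding the fluctuations of `resG`. -/
noncomputable def distConst (β q : ℝ) : ℝ :=
  q ^ 2 / 2 * (momentConst β * (resConst β + 1) + |1 - 2 / β| ^ 2 * resConst β)

lemma integral_dist_sq_le :
    ∫ x, ‖resG z x + 2 * N * s‖ ^ 2 ∂(gbe β N) ≤ distConst β q * z.im⁻¹ ^ 2 := by
  have := isProbabilityMeasure_gbe hβ h.pos
  have hz := h.im_pos
  have bg := (bddCont_resG (N := N) hz).norm.rpow 2
  have bd := ((bddCont_resG (N := N) hz).add (BddCont.const (2 * N * s))).norm.rpow 2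
  have hA := integral_norm_loopA_sq_le_sq hβ h
  have hG := integral_norm_resG_sq_le hβ h
  have ha := h.norm_pos
  have h1 := integral_le_of_forall_le (μ := gbe β N) (c₁ := q ^ 2 / (2 * (N * ‖s‖) ^ 2))
    (c₂ := q ^ 2 / (2 * (N * ‖s‖) ^ 2) * (|1 - 2 / β| ^ 2 * z.im⁻¹ ^ 2)) (c₃ := 0) (c := 0) bd
    ((bddCont_loopA hz β).norm.rpow 2) bg bg (fun x => by
      have h2 := h.dist_sq_le β x
      have h3 := pow_le_pow_left₀ (norm_nonneg _) (h.norm_psum_two_le x) 2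
      have h4 := mul_le_mul_of_nonneg_left h3
        (by positivity : 0 ≤ q ^ 2 / (2 * (N * ‖s‖) ^ 2) * |1 - 2 / β| ^ 2)
      linarith)
  refine h1.trans ?_
  have h5 := mul_le_mul_of_nonneg_left hA (by positivity : 0 ≤ q ^ 2 / (2 * (N * ‖s‖) ^ 2))
  have h6 := mul_le_mul_of_nonneg_left hG
    (by positivity : 0 ≤ q ^ 2 / (2 * (N * ‖s‖) ^ 2) * (|1 - 2 / β| ^ 2 * z.im⁻¹ ^ 2))
  have h7 : distConst β q * z.im⁻¹ ^ 2 = q ^ 2 / (2 * (N * ‖s‖) ^ 2) *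
      (momentConst β * (resConst β + 1) * z.im⁻¹ ^ 2 * (N * ‖s‖) ^ 2) +
      q ^ 2 / (2 * (N * ‖s‖) ^ 2) * (|1 - 2 / β| ^ 2 * z.im⁻¹ ^ 2) *
      (resConst β * (N * ‖s‖) ^ 2) := by
    have : (N : ℝ) * ‖s‖ ≠ 0 := ha.ne'
    generalize (N : ℝ) * ‖s‖ = a at *
    unfold distConst
    field_simp
  linarith

omit h in
lemma distConst_nonneg (q : ℝ) : 0 ≤ distConst β q := by
  have := momentConst_pos hβ
  have := resConst_nonneg hβ
  unfold distConst
  positivity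

lemma integral_dist_le :
    ∫ x, ‖resG z x + 2 * N * s‖ ∂(gbe β N) ≤ (distConst β q + 1) * z.im⁻¹ := by
  have := isProbabilityMeasure_gbe hβ h.pos
  have hz := h.im_pos
  have hw : 0 < z.im⁻¹ := inv_pos.2 hz
  have bd := ((bddCont_resG (N := N) hz).add (BddCont.const (2 * N * s))).norm
  have h1 := integral_le_of_forall_le (μ := gbe β N) (c₁ := z.im / 2) (c₂ := 0) (c₃ := 0)
    (c := z.im⁻¹ / 2) bd (bd.rpow 2) bd bd (fun x => by
      have h2 : 0 ≤ z.im / 2 * (‖resG z x + 2 * N * s‖ - z.im⁻¹) ^ 2 := by positivity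
      have h3 : z.im / 2 * (‖resG z x + 2 * N * s‖ - z.im⁻¹) ^ 2 =
        z.im / 2 * ‖resG z x + 2 * N * s‖ ^ 2 + z.im⁻¹ / 2 - ‖resG z x + 2 * N * s‖ := by
        field_simp; ring
      linarith)
  have h4 := mul_le_mul_of_nonneg_left (integral_dist_sq_le hβ h) (by positivity : 0 ≤ z.im / 2)
  have h5 : z.im / 2 * (distConst β q * z.im⁻¹ ^ 2) = distConst β q / 2 * z.im⁻¹ := by field_simp
  have h6 := mul_nonneg (distConst_nonneg hβ q) hw.le
  linarith

/-- The constant bounding the fluctuations of `psum z 2`. -/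
noncomputable def psumConst (β q : ℝ) : ℝ :=
  (momentConst β * (resConst β + 1) + 1 + |1 - 2 / β| * (resConst β + 1) + distConst β q +
    resConst β) / 4

lemma integral_psum_dist_le :
    ∫ x, ‖psum z 2 x + 2 * N - 2 * N * z / s‖ ∂(gbe β N) ≤ psumConst β q * z.im⁻¹ ^ 2 := by
  have := isProbabilityMeasure_gbe hβ h.pos
  have hz := h.im_pos
  have hB := integral_norm_loopB_sq_le_sq hβ h
  have hG := integral_norm_resG_sq_le hβ h
  have hd := integral_dist_sq_le hβ h
  have ha := h.norm_pos
  have hs : s ≠ 0 := by rintro rfl; simp at ha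
  have bg := (bddCont_resG (N := N) hz).norm.rpow 2
  have bd := ((bddCont_resG (N := N) hz).add (BddCont.const (2 * N * s))).norm.rpow 2
  have be := (((bddCont_psum (N := N) hz 2).add (BddCont.const (2 * N : ℂ))).sub
    (BddCont.const (2 * N * z / s))).norm
  have key : ∀ x : Fin N → ℝ, 2 * (N * ‖s‖) * ‖psum z 2 x + 2 * N - 2 * N * z / s‖ ≤
      ‖loopB β z x‖ + |1 - 2 / β| * (z.im⁻¹ ^ 2 * ‖resG z x‖) +
        ‖resG z x + 2 * N * s‖ * (z.im⁻¹ * ‖resG z x‖) := fun x => by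
    have e : 2 * (N * s) * (psum z 2 x + 2 * N - 2 * N * z / s) =
        (resG z x + 2 * N * s) * (psum z 2 x + 2 * N) -
          (loopB β z x + (1 - 2 / β) * psum z 3 x) := by
      unfold loopB
      field_simp
      ring
    have h1 : 2 * (N * ‖s‖) * ‖psum z 2 x + 2 * N - 2 * N * z / s‖ =
        ‖2 * (N * s) * (psum z 2 x + 2 * N - 2 * N * z / s)‖ := by simp
    rw [h1, e]
    have hP : ‖psum z 2 x + 2 * N‖ ≤ z.im⁻¹ * ‖resG z x‖ := by
      refine ((norm_add_le _ _).trans (add_le_add (norm_psum_le z 2 x) ?_)).trans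
        (asum_two_le hz x)
      simp
    have h3 : ‖psum z 3 x‖ ≤ z.im⁻¹ ^ 2 * ‖resG z x‖ :=
      (norm_psum_le z 3 x).trans (asum_add_two_le hz 1 x)
    refine (norm_sub_le _ _).trans ?_
    have h4 : ‖loopB β z x + (1 - 2 / β) * psum z 3 x‖ ≤
        ‖loopB β z x‖ + |1 - 2 / β| * (z.im⁻¹ ^ 2 * ‖resG z x‖) := by
      refine (norm_add_le _ _).trans (add_le_add le_rfl ?_)
      rw [norm_mul, norm_kappa]
      exact mul_le_mul_of_nonneg_left h3 (abs_nonneg _)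
    rw [norm_mul]
    have h5 := mul_le_mul_of_nonneg_left hP (norm_nonneg (resG z x + 2 * N * s))
    linarith
  have hk : 0 ≤ |1 - 2 / β| := abs_nonneg _
  have hw : 0 < z.im⁻¹ := inv_pos.2 hz
  unfold psumConst
  have bB := (bddCont_loopB (N := N) hz β).norm.rpow 2
  generalize (N : ℝ) * ‖s‖ = a at *
  generalize |1 - 2 / β| = k at *
  generalize z.im⁻¹ = w at *
  have h2 := integral_le_of_forall_le (μ := gbe β N) (c₁ := (4 * a ^ 2 * w ^ 2)⁻¹)
    (c₂ := (k * w ^ 2 + w ^ 2) / (4 * a ^ 2)) (c₃ := 1 / 4) (c := w ^ 2 / 4 + k * w ^ 2 / 4)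
    be bB bg bd (fun x => by
      have h3 : ‖loopB β z x‖ ≤ (2 * a * w ^ 2)⁻¹ * ‖loopB β z x‖ ^ 2 + a * w ^ 2 / 2 := by
        have h4 : 0 ≤ (2 * a * w ^ 2)⁻¹ * (‖loopB β z x‖ - a * w ^ 2) ^ 2 := by positivity
        have h5 : (2 * a * w ^ 2)⁻¹ * (‖loopB β z x‖ - a * w ^ 2) ^ 2 =
          (2 * a * w ^ 2)⁻¹ * ‖loopB β z x‖ ^ 2 + a * w ^ 2 / 2 - ‖loopB β z x‖ := by
          field_simp; ring
        linarith
      have h4 : ‖resG z x‖ ≤ (2 * a)⁻¹ * ‖resG z x‖ ^ 2 + a / 2 := by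
        have h4 : 0 ≤ (2 * a)⁻¹ * (‖resG z x‖ - a) ^ 2 := by positivity
        have h5 : (2 * a)⁻¹ * (‖resG z x‖ - a) ^ 2 =
          (2 * a)⁻¹ * ‖resG z x‖ ^ 2 + a / 2 - ‖resG z x‖ := by
          field_simp; ring
        linarith
      have h5 : ‖resG z x + 2 * N * s‖ * (w * ‖resG z x‖) ≤
          a / 2 * ‖resG z x + 2 * N * s‖ ^ 2 + (2 * a)⁻¹ * (w ^ 2 * ‖resG z x‖ ^ 2) := by
        have h4 : 0 ≤ (2 * a)⁻¹ * (a * ‖resG z x + 2 * N * s‖ - w * ‖resG z x‖) ^ 2 := by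
          positivity
        have h5 : (2 * a)⁻¹ * (a * ‖resG z x + 2 * N * s‖ - w * ‖resG z x‖) ^ 2 =
            a / 2 * ‖resG z x + 2 * N * s‖ ^ 2 + (2 * a)⁻¹ * (w ^ 2 * ‖resG z x‖ ^ 2) -
            ‖resG z x + 2 * N * s‖ * (w * ‖resG z x‖) := by
          field_simp; ring
        linarith
      have h6 := mul_le_mul_of_nonneg_left h4 (by positivity : 0 ≤ k * w ^ 2)
      refine le_of_mul_le_mul_left (a := 2 * a) ?_ (by positivity)
      refine (key x).trans ?_
      have h7 : 2 * a * ((4 * a ^ 2 * w ^ 2)⁻¹ * ‖loopB β z x‖ ^ 2 +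
          (k * w ^ 2 + w ^ 2) / (4 * a ^ 2) * ‖resG z x‖ ^ 2 +
          1 / 4 * ‖resG z x + 2 * N * s‖ ^ 2 + (w ^ 2 / 4 + k * w ^ 2 / 4)) =
          ((2 * a * w ^ 2)⁻¹ * ‖loopB β z x‖ ^ 2 + a * w ^ 2 / 2) +
          k * w ^ 2 * ((2 * a)⁻¹ * ‖resG z x‖ ^ 2 + a / 2) +
          (a / 2 * ‖resG z x + 2 * N * s‖ ^ 2 + (2 * a)⁻¹ * (w ^ 2 * ‖resG z x‖ ^ 2)) := by
        field_simp
        ring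
      rw [h7]
      linarith)
  refine h2.trans ?_
  calc _ ≤ (4 * a ^ 2 * w ^ 2)⁻¹ * (momentConst β * (resConst β + 1) * w ^ 4 * a ^ 2) +
        (k * w ^ 2 + w ^ 2) / (4 * a ^ 2) * (resConst β * a ^ 2) +
        1 / 4 * (distConst β q * w ^ 2) + (w ^ 2 / 4 + k * w ^ 2 / 4) := by gcongr
    _ = _ := by field_simp; ring

/-- The constant bounding the fluctuations of `resG` far from the spectrum. -/
noncomputable def farConst (β q : ℝ) : ℝ :=
  q ^ 2 / 2 * (2 / β * (resConst β + 1 + 2 * |1 - 2 / β|) + |1 - 2 / β| ^ 2)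

lemma integral_dist_le_of_one_le (hy : 1 ≤ z.im) (hs : z.im ≤ ‖s‖) :
    ∫ x, ‖resG z x + 2 * N * s‖ ∂(gbe β N) ≤ (farConst β q + 1) * z.im⁻¹ ^ 2 := by
  have := isProbabilityMeasure_gbe hβ h.pos
  have hz := h.im_pos
  have hG := integral_norm_resG_sq_le hβ h
  have hA := integral_norm_loopA_sq_le hβ h.pos hz
  have ha := h.norm_pos
  have hw : 0 < z.im⁻¹ := inv_pos.2 hz
  have hw1 : z.im⁻¹ ≤ 1 := inv_le_one_of_one_le₀ hy
  have hwa := h.inv_im_le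
  have hNa : (N : ℝ) ≤ N * ‖s‖ * z.im⁻¹ := by
    rw [← div_eq_mul_inv, le_div_iff₀ hz]
    exact mul_le_mul_of_nonneg_left hs (by positivity)
  have hT : ∀ k : ℕ, ∀ x : Fin N → ℝ, asum z k x ≤ N * ‖s‖ * z.im⁻¹ ^ (k + 1) := fun k x => by
    refine (asum_le hz k x).trans ?_
    rw [div_eq_mul_inv, ← inv_pow]
    refine (mul_le_mul_of_nonneg_right hNa (by positivity)).trans_eq ?_
    ring
  have bg := (bddCont_resG (N := N) hz).norm
  have bd := ((bddCont_resG (N := N) hz).add (BddCont.const (2 * N * s))).norm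
  have hk : 0 ≤ |1 - 2 / β| := abs_nonneg _
  have bT := ((((BddCont.const (2 : ℝ)).mul bg).mul (bddCont_asum hz 3)).add
      ((BddCont.const (2 * |1 - 2 / β|)).mul (bddCont_asum hz 4)))
  have bA := (bddCont_loopA (N := N) hz β).norm.rpow 2
  have hD := fun x => h.dist_sq_le β x
  have hp2 := fun x => (norm_psum_le z 2 x).trans (hT 2 x)
  have hT3 := hT 3
  have hT4 := hT 4
  unfold farConst
  generalize (N : ℝ) * ‖s‖ = a at *
  generalize |1 - 2 / β| = k at *
  generalize z.im⁻¹ = w at *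
  have h1 := integral_le_of_forall_le (μ := gbe β N) (c₁ := w ^ 4) (c₂ := 0) (c₃ := 0)
    (c := w ^ 4 * a ^ 2 + 2 * k * (a * w ^ 5)) bT (bg.rpow 2) bg bg (fun x => by
      have h2 := mul_le_mul_of_nonneg_left (hT3 x) (by positivity : 0 ≤ 2 * ‖resG z x‖)
      have h3 := mul_le_mul_of_nonneg_left (hT4 x) (by positivity : 0 ≤ 2 * k)
      have h4 : 0 ≤ w ^ 4 * (‖resG z x‖ - a) ^ 2 := by positivity
      norm_num at h2 h3
      nlinarith)
  have h5 : ∫ x, ‖loopA β z x‖ ^ 2 ∂(gbe β N) ≤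
      2 / β * (resConst β + 1 + 2 * k) * a ^ 2 * w ^ 4 := by
    refine hA.trans ?_
    calc _ ≤ 2 / β * (w ^ 4 * (resConst β * a ^ 2) + (w ^ 4 * a ^ 2 + 2 * k * (a * w ^ 4 * a))) := by
          refine mul_le_mul_of_nonneg_left (h1.trans ?_) (by positivity)
          have h6 := mul_le_mul_of_nonneg_left hG (by positivity : 0 ≤ w ^ 4)
          have h7 := mul_le_mul_of_nonneg_left hwa (by positivity : 0 ≤ 2 * k * (a * w ^ 4))
          nlinarith
      _ = _ := by ring
  have h8 := integral_le_of_forall_le (μ := gbe β N)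
    (c₁ := q ^ 2 / (4 * a ^ 2 * w ^ 2)) (c₂ := 0) (c₃ := 0)
    (c := w ^ 2 / 2 + q ^ 2 / 4 * (k ^ 2 * w ^ 2)) bd bA bg bg (fun x => by
      have h9 := hD x
      have h10 := pow_le_pow_left₀ (norm_nonneg _) (hp2 x) 2
      have h11 := mul_le_mul_of_nonneg_left h10
        (by positivity : 0 ≤ q ^ 2 / (2 * a ^ 2) * k ^ 2)
      have h12 : ‖resG z x + 2 * N * s‖ ≤ (2 * w ^ 2)⁻¹ * ‖resG z x + 2 * N * s‖ ^ 2 +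
          w ^ 2 / 2 := by
        have h4 : 0 ≤ (2 * w ^ 2)⁻¹ * (‖resG z x + 2 * N * s‖ - w ^ 2) ^ 2 := by positivity
        have h5 : (2 * w ^ 2)⁻¹ * (‖resG z x + 2 * N * s‖ - w ^ 2) ^ 2 =
          (2 * w ^ 2)⁻¹ * ‖resG z x + 2 * N * s‖ ^ 2 + w ^ 2 / 2 - ‖resG z x + 2 * N * s‖ := by
          field_simp; ring
        linarith
      have h13 : ‖resG z x + 2 * N * s‖ ^ 2 ≤ q ^ 2 / (2 * a ^ 2) * ‖loopA β z x‖ ^ 2 +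
          q ^ 2 / (2 * a ^ 2) * k ^ 2 * (a * w ^ (2 + 1)) ^ 2 := by linarith
      have h14 := mul_le_mul_of_nonneg_left h13 (by positivity : 0 ≤ (2 * w ^ 2)⁻¹)
      have h15 : (2 * w ^ 2)⁻¹ * (q ^ 2 / (2 * a ^ 2) * ‖loopA β z x‖ ^ 2 +
          q ^ 2 / (2 * a ^ 2) * k ^ 2 * (a * w ^ (2 + 1)) ^ 2) =
          q ^ 2 / (4 * a ^ 2 * w ^ 2) * ‖loopA β z x‖ ^ 2 + q ^ 2 / 4 * (k ^ 2 * w ^ 4) := by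
        field_simp
        ring
      have h16 : w ^ 4 ≤ w ^ 2 := pow_le_pow_of_le_one hw.le hw1 (by norm_num)
      have h17 := mul_le_mul_of_nonneg_left h16 (by positivity : 0 ≤ q ^ 2 / 4 * k ^ 2)
      linarith)
  refine h8.trans ?_
  have hr := resConst_nonneg hβ
  calc _ ≤ q ^ 2 / (4 * a ^ 2 * w ^ 2) * (2 / β * (resConst β + 1 + 2 * k) * a ^ 2 * w ^ 4) +
        (w ^ 2 / 2 + q ^ 2 / 4 * (k ^ 2 * w ^ 2)) := by
        have := mul_le_mul_of_nonneg_left h5 (by positivity : 0 ≤ q ^ 2 / (4 * a ^ 2 * w ^ 2))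
        linarith
    _ = (q ^ 2 / 4 * (2 / β * (resConst β + 1 + 2 * k) + k ^ 2) + 1 / 2) * w ^ 2 := by
        field_simp; ring
    _ ≤ _ := by
        gcongr <;> norm_num

end admissibleBounds

end bounds


/-- The branch of `√(z² - 1)` with positive imaginary part on the upper half plane. -/
noncomputable def sqrtBranch (z : ℂ) : ℂ := Complex.I * Complex.exp (Complex.log (1 - z ^ 2) / 2)

section branch

variable {z : ℂ} (hz : 0 < z.im)
include hz

lemma one_sub_sq_mem_slitPlane : 1 - z ^ 2 ∈ Complex.slitPlane := by
  rw [Complex.mem_slitPlane_iff]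
  by_cases h : z.re = 0
  · left
    simp [sq, h]
    nlinarith
  · right
    simp [sq]
    intro h1
    have : z.re * z.im = 0 := by linarith
    rcases mul_eq_zero.1 this with h2 | h2
    · exact h h2
    · exact hz.ne' h2

lemma sqrtBranch_sq : sqrtBranch z ^ 2 = z ^ 2 - 1 := by
  unfold sqrtBranch
  rw [mul_pow, Complex.I_sq, ← Complex.exp_nat_mul, Nat.cast_ofNat,
    mul_div_cancel₀ _ (two_ne_zero), Complex.exp_log
    (Complex.slitPlane_ne_zero (one_sub_sq_mem_slitPlane hz))]
  ring

lemma sqrtBranch_im_pos : 0 < (sqrtBranch z).im := by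
  unfold sqrtBranch
  rw [Complex.I_mul_im, Complex.exp_re]
  refine mul_pos (Real.exp_pos _) (Real.cos_pos_of_mem_Ioo ?_)
  have h1 := Complex.neg_pi_lt_arg (1 - z ^ 2)
  have h2 := (Complex.arg_le_pi (1 - z ^ 2)).lt_of_ne
    (Complex.mem_slitPlane_iff_arg.1 (one_sub_sq_mem_slitPlane hz)).1
  have h3 : (Complex.log (1 - z ^ 2) / 2).im = Complex.arg (1 - z ^ 2) / 2 := by
    rw [← Complex.log_im]; simp
  rw [h3]
  constructor <;> linarith

lemma sqrtBranch_ne_zero : sqrtBranch z ≠ 0 := fun h => by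
  have := sqrtBranch_im_pos hz
  simp [h] at this

lemma hasDerivAt_sqrtBranch : HasDerivAt sqrtBranch (z / sqrtBranch z) z := by
  have h1 : HasDerivAt (fun z : ℂ => 1 - z ^ 2) (-(2 * z)) z := by
    simpa using ((hasDerivAt_id z).pow 2).const_sub 1
  have h2 := ((h1.clog (one_sub_sq_mem_slitPlane hz)).div_const 2).cexp.const_mul Complex.I
  refine h2.congr_deriv ?_
  have h3 := sqrtBranch_sq hz
  have h4 := sqrtBranch_ne_zero hz
  have h5 := Complex.slitPlane_ne_zero (one_sub_sq_mem_slitPlane hz)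
  rw [← mul_assoc]
  change sqrtBranch z * _ = _
  field_simp
  rw [h3]
  ring

lemma add_sqrtBranch_mem_slitPlane : z + sqrtBranch z ∈ Complex.slitPlane := by
  rw [Complex.mem_slitPlane_iff]
  right
  have := sqrtBranch_im_pos hz
  rw [Complex.add_im]
  positivity

omit hz in
lemma norm_sqrtBranch_le (hz : 0 < z.im) : ‖sqrtBranch z‖ ≤ ‖z‖ + 1 := by
  have h1 : ‖sqrtBranch z‖ ^ 2 ≤ ‖z‖ ^ 2 + 1 := by
    rw [← norm_pow, sqrtBranch_sq hz]
    refine (norm_sub_le _ _).trans_eq ?_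
    simp
  nlinarith [norm_nonneg z, norm_nonneg (sqrtBranch z)]

end branch

/-- The logarithmic potential of the semicircle law. -/
noncomputable def potential (z : ℂ) : ℂ :=
  z ^ 2 - z * sqrtBranch z + Complex.log (z + sqrtBranch z) - 1 / 2 - Real.log 2

lemma hasDerivAt_potential {z : ℂ} (hz : 0 < z.im) :
    HasDerivAt potential (2 * z - 2 * sqrtBranch z) z := by
  have hs := hasDerivAt_sqrtBranch hz
  have hid := hasDerivAt_id z
  have h1 := ((((hid.fun_pow 2).fun_sub (hid.fun_mul hs)).fun_add ((hid.fun_add hs).clog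
    (add_sqrtBranch_mem_slitPlane hz))).sub_const (1 / 2)).sub_const (Real.log 2 : ℂ)
  refine h1.congr_deriv ?_
  have h3 := sqrtBranch_sq hz
  have h4 := sqrtBranch_ne_zero hz
  have h5 := Complex.slitPlane_ne_zero (add_sqrtBranch_mem_slitPlane hz)
  simp only [id]
  generalize sqrtBranch z = s at *
  field_simp
  push_cast
  linear_combination (z + s) * h3

/-- The centred logarithm of the modulus of the characteristic polynomial. -/
noncomputable def logD {N : ℕ} (z : ℂ) (x : Fin N → ℝ) : ℝ :=
  (∑ i, Complex.log (z - x i) - N * potential z).re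

section logD

variable {N : ℕ}

lemma sub_ofReal_mem_slitPlane {z : ℂ} (hz : 0 < z.im) (t : ℝ) : z - t ∈ Complex.slitPlane := by
  rw [Complex.mem_slitPlane_iff]
  right
  simpa using hz.ne'

lemma hasDerivAt_logD {γ : ℝ → ℂ} {γ' : ℂ} {t : ℝ} (hγ : HasDerivAt γ γ' t) (ht : 0 < (γ t).im)
    (x : Fin N → ℝ) : HasDerivAt (fun t => logD (γ t) x)
      (γ' * (resG (γ t) x + 2 * N * sqrtBranch (γ t))).re t := by
  have h1 : ∀ i ∈ (Finset.univ : Finset (Fin N)),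
      HasDerivAt (fun t => Complex.log (γ t - x i)) (γ' / (γ t - x i)) t := fun i _ =>
    (hγ.sub_const _).clog_real (sub_ofReal_mem_slitPlane ht (x i))
  have h2 : HasDerivAt (fun t => potential (γ t)) (γ' * (2 * γ t - 2 * sqrtBranch (γ t))) t := by
    simpa [Function.comp_def] using (hasDerivAt_potential ht).scomp t hγ
  have h3 := (HasDerivAt.fun_sum h1).fun_sub (h2.const_mul (N : ℂ))
  have h4 := Complex.reCLM.hasFDerivAt.comp_hasDerivAt t h3
  refine h4.congr_deriv ?_
  simp only [Complex.reCLM_apply]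
  congr 1
  unfold resG psum res
  simp only [pow_one, div_eq_mul_inv, ← Finset.mul_sum]
  ring

lemma continuous_logD {z : ℂ} (hz : 0 < z.im) : Continuous (logD (N := N) z) := by
  unfold logD
  refine Complex.continuous_re.comp (Continuous.sub (continuous_finsetSum _ fun i _ => ?_)
    continuous_const)
  exact Continuous.clog (by fun_prop) fun x => sub_ofReal_mem_slitPlane hz _

lemma hasLineDerivAt_logD {z : ℂ} (hz : 0 < z.im) (x : Fin N → ℝ) (i : Fin N) :
    HasLineDerivAt ℝ (logD z) (-(res z (x i)).re) x (Pi.single i 1) := by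
  have h1 : ∀ t : ℝ, HasDerivAt (fun t : ℝ => Complex.log (z - t)) (-res z t) t := fun t => by
    have h2 : HasDerivAt (fun t : ℝ => z - (t : ℂ)) (-1) t := by
      simpa using (Complex.ofRealCLM.hasDerivAt (x := t)).const_sub z
    refine (h2.clog_real (sub_ofReal_mem_slitPlane hz t)).congr_deriv ?_
    unfold res
    rw [div_eq_mul_inv, neg_one_mul]
  have h3 : HasDerivAt (fun t : ℝ => ∑ j, Complex.log (z - ((x + t •
      (Pi.single i 1 : Fin N → ℝ)) j : ℝ))) (-res z (x i)) 0 := hasLineDerivAt_sum h1 x i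
  have h4 := Complex.reCLM.hasFDerivAt.comp_hasDerivAt 0 (h3.sub_const (N * potential z))
  simpa [HasLineDerivAt, logD, Function.comp_def] using h4

lemma norm_resG_add_le {z : ℂ} (hz : 0 < z.im) (x : Fin N → ℝ) :
    ‖resG z x + 2 * N * sqrtBranch z‖ ≤ N * (1 / z.im + 4 * ‖z‖ + 2) := by
  have h1 : ‖psum z 1 x‖ ≤ N / z.im := by
    simpa using (norm_psum_le z 1 x).trans (asum_le hz 1 x)
  have h2 := norm_sqrtBranch_le hz
  unfold resG
  refine (norm_add_le _ _).trans ((add_le_add (norm_sub_le _ _) le_rfl).trans ?_)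
  simp only [norm_mul, Complex.norm_ofNat, Complex.norm_natCast]
  have h3 := mul_le_mul_of_nonneg_left h2 (by positivity : (0 : ℝ) ≤ 2 * N)
  calc _ ≤ N / z.im + 2 * N * ‖z‖ + 2 * N * (‖z‖ + 1) := by linarith
    _ = _ := by ring

/-- Differentiation of expectations of functions of `logD` along a line in the upper half plane. -/
lemma hasDerivAt_integral_logD {β : ℝ} (hβ : 0 < β) (hN : 0 < N) {Φ Φ' : ℝ → ℂ}
    (hΦ : ∀ u, HasDerivAt Φ (Φ' u) u) (hΦ' : Continuous Φ') {C C' : ℝ} (bΦ : ∀ u, ‖Φ u‖ ≤ C)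
    (bΦ' : ∀ u, ‖Φ' u‖ ≤ C') {z₀ v : ℂ} {t₀ c : ℝ} (ht : 0 < (z₀ + t₀ * v).im)
    {B : (Fin N → ℝ) → ℝ} (hB : Continuous B) :
    HasDerivAt (fun t : ℝ => ∫ x, Φ (c * (logD (z₀ + t * v) x - B x)) ∂(gbe β N))
      (∫ x, ((c * (v * (resG (z₀ + t₀ * v) x + 2 * N * sqrtBranch (z₀ + t₀ * v))).re : ℝ) : ℂ) *
        Φ' (c * (logD (z₀ + t₀ * v) x - B x)) ∂(gbe β N)) t₀ := by
  have := isProbabilityMeasure_gbe hβ hN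
  set y := (z₀ + t₀ * v).im with hy
  have hγ : ∀ t : ℝ, HasDerivAt (fun t : ℝ => z₀ + t * v) v t := fun t => by
    simpa using ((Complex.ofRealCLM.hasDerivAt (x := t)).mul_const v).const_add z₀
  have hcont : Continuous fun t : ℝ => z₀ + t * v := by fun_prop
  have hev : ∀ᶠ t : ℝ in 𝓝 t₀, y / 2 < (z₀ + t * v).im ∧ ‖z₀ + t * v‖ < ‖z₀ + t₀ * v‖ + 1 :=
    ((Complex.continuous_im.comp hcont).continuousAt.eventually (lt_mem_nhds (by
      simp only [Function.comp_apply]; linarith))).and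
      (hcont.norm.continuousAt.eventually (gt_mem_nhds (by linarith)))
  have hC' : 0 ≤ C' := (norm_nonneg _).trans (bΦ' 0)
  set K := |c| * (‖v‖ * (N * (2 / y + 4 * (‖z₀ + t₀ * v‖ + 1) + 2))) * C' with hK
  have hcomp : ∀ t : ℝ, 0 < (z₀ + t * v).im → Continuous fun x : Fin N → ℝ =>
      c * (logD (z₀ + t * v) x - B x) := fun t h =>
    continuous_const.mul ((continuous_logD h).sub hB)
  have hΦc : Continuous Φ := continuous_iff_continuousAt.2 fun u => (hΦ u).continuousAt
  refine (hasDerivAt_integral_of_dominated_loc_of_deriv_le (bound := fun _ => K)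
    (F' := fun (t : ℝ) x => ((c * (v * (resG (z₀ + t * v) x + 2 * N * sqrtBranch (z₀ + t * v))).re : ℝ) : ℂ) *
        Φ' (c * (logD (z₀ + t * v) x - B x))) hev ?_ ?_ ?_ ?_ (integrable_const _) ?_).2
  · filter_upwards [hev] with t h
    exact (hΦc.comp (hcomp t ((half_pos ht).trans h.1))).aestronglyMeasurable
  · exact Integrable.of_bound (hΦc.comp (hcomp t₀ ht)).aestronglyMeasurable C
      (Eventually.of_forall fun x => bΦ _)
  · refine Continuous.aestronglyMeasurable (Continuous.mul (Complex.continuous_ofReal.comp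
      (continuous_const.mul (Complex.continuous_re.comp (continuous_const.mul
      ((bddCont_resG ht).1.add continuous_const))))) (hΦ'.comp (hcomp t₀ ht)))
  · refine Eventually.of_forall fun x t h => ?_
    have h0 : 0 < (z₀ + t * v).im := (half_pos ht).trans h.1
    rw [norm_mul, Complex.norm_real, norm_mul, Real.norm_eq_abs, Real.norm_eq_abs]
    refine mul_le_mul (mul_le_mul_of_nonneg_left ((Complex.abs_re_le_norm _).trans ?_)
      (abs_nonneg _)) (bΦ' _) (norm_nonneg _) (by positivity)
    rw [norm_mul]
    refine mul_le_mul_of_nonneg_left ((norm_resG_add_le h0 x).trans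
      (mul_le_mul_of_nonneg_left ?_ (by positivity))) (norm_nonneg _)
    have h1 : 1 / (z₀ + t * v).im ≤ 2 / y := by
      rw [div_le_div_iff₀ h0 ht]; linarith [h.1]
    linarith [h.2]
  · refine Eventually.of_forall fun x t h => ?_
    have h0 : 0 < (z₀ + t * v).im := (half_pos ht).trans h.1
    have h1 := ((hasDerivAt_logD (hγ t) h0 x).sub_const (B x)).const_mul c
    have h2 := (hΦ _).scomp t h1
    simpa [Function.comp_def] using h2

end logD


section sqrtBranch

variable {z : ℂ} (hz : 0 < z.im)
include hz

lemma norm_sqrtBranch_sq : ‖sqrtBranch z‖ ^ 2 = ‖z ^ 2 - 1‖ := by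
  rw [← norm_pow, sqrtBranch_sq hz]

lemma two_mul_im_sqrtBranch_sq : 2 * (sqrtBranch z).im ^ 2 = ‖z ^ 2 - 1‖ - (z ^ 2 - 1).re := by
  have h1 : (sqrtBranch z ^ 2).re = (sqrtBranch z).re ^ 2 - (sqrtBranch z).im ^ 2 := by
    simp [sq]
  have h2 : ‖sqrtBranch z‖ ^ 2 = (sqrtBranch z).re ^ 2 + (sqrtBranch z).im ^ 2 := by
    rw [← Complex.normSq_eq_norm_sq, Complex.normSq_apply]; ring
  rw [norm_sqrtBranch_sq hz] at h2
  rw [sqrtBranch_sq hz] at h1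
  linarith

lemma admissible_sqrtBranch {N : ℕ} (hN : 0 < N) {q : ℝ} (hq : 0 ≤ q)
    (h1 : 2 * ‖z ^ 2 - 1‖ ≤ q ^ 2 * (‖z ^ 2 - 1‖ - (z ^ 2 - 1).re))
    (h2 : 1 ≤ (N : ℝ) ^ 2 * ‖z ^ 2 - 1‖ * z.im ^ 2) : Admissible q N z (sqrtBranch z) where
  pos := hN
  im_pos := hz
  sq_eq := sqrtBranch_sq hz
  im_sqrt_pos := sqrtBranch_im_pos hz
  norm_le := by
    have := sqrtBranch_im_pos hz
    refine le_of_sq_le_sq ?_ (by positivity)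
    rw [norm_sqrtBranch_sq hz, mul_pow]
    have := two_mul_im_sqrtBranch_sq hz
    rw [← this] at h1
    linarith
  one_le := by
    refine le_of_sq_le_sq ?_ (by positivity)
    rw [one_pow, mul_pow, mul_pow, norm_sqrtBranch_sq hz]
    exact h2

end sqrtBranch

/-- The vertical line through the spectral edge. -/
lemma sq_sub_one_vertical (y : ℝ) : (1 + y * Complex.I : ℂ) ^ 2 - 1 = ⟨-y ^ 2, 2 * y⟩ := by
  apply Complex.ext <;> simp [sq]
  ring

lemma im_vertical (y : ℝ) : (1 + y * Complex.I : ℂ).im = y := by simp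

section vertical

variable {y : ℝ}

lemma two_mul_le_norm_vertical : 2 * y ≤ ‖(1 + y * Complex.I : ℂ) ^ 2 - 1‖ := by
  rw [sq_sub_one_vertical]
  exact (le_abs_self _).trans (Complex.abs_im_le_norm ⟨-y ^ 2, 2 * y⟩)

lemma sq_le_norm_vertical : y ^ 2 ≤ ‖(1 + y * Complex.I : ℂ) ^ 2 - 1‖ := by
  rw [sq_sub_one_vertical]
  refine le_trans ?_ (Complex.abs_re_le_norm ⟨-y ^ 2, 2 * y⟩)
  simp

variable (hy : 0 < y)
include hy

lemma sqrt_le_norm_sqrtBranch_vertical : √y ≤ ‖sqrtBranch (1 + y * Complex.I)‖ := by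
  have h := norm_sqrtBranch_sq (z := 1 + y * Complex.I) (by simpa using hy)
  rw [Real.sqrt_le_iff]
  exact ⟨norm_nonneg _, by linarith [(two_mul_le_norm_vertical (y := y))]⟩

lemma le_norm_sqrtBranch_vertical : y ≤ ‖sqrtBranch (1 + y * Complex.I)‖ := by
  have h := norm_sqrtBranch_sq (z := 1 + y * Complex.I) (by simpa using hy)
  refine le_of_sq_le_sq ?_ (norm_nonneg _)
  rw [h]
  exact sq_le_norm_vertical

lemma admissible_vertical {N : ℕ} (hN : 0 < N) (h : 1 ≤ (N : ℝ) ^ 2 * y ^ 3) :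
    Admissible 2 N (1 + y * Complex.I) (sqrtBranch (1 + y * Complex.I)) := by
  refine admissible_sqrtBranch (by simpa using hy) hN (by norm_num) ?_ ?_
  · have h1 : ((1 + y * Complex.I : ℂ) ^ 2 - 1).re ≤ 0 := by
      rw [sq_sub_one_vertical]
      simp only
      nlinarith
    nlinarith [norm_nonneg ((1 + y * Complex.I : ℂ) ^ 2 - 1)]
  · rw [im_vertical]
    have h1 := mul_le_mul_of_nonneg_left ((two_mul_le_norm_vertical (y := y)))
      (by positivity : 0 ≤ (N : ℝ) ^ 2 * y ^ 2)
    nlinarith [pow_pos hy 3]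

end vertical

lemma admissible_horizontal {N : ℕ} (hN : 0 < N) {a η L : ℝ} (hη : 0 < η) (hL : 0 ≤ L)
    (ha : |a - 1| ≤ L * η) (ha' : |a - 1| ≤ 1 / 2) (h : 1 ≤ (N : ℝ) ^ 2 * η ^ 3) :
    Admissible (6 * (L + 1)) N (a + η * Complex.I) (sqrtBranch (a + η * Complex.I)) := by
  have him : (a + η * Complex.I : ℂ).im = η := by simp
  have hre2 : ((a + η * Complex.I : ℂ) ^ 2 - 1).re = a ^ 2 - η ^ 2 - 1 := by
    simp [sq]
  have him2 : ((a + η * Complex.I : ℂ) ^ 2 - 1).im = 2 * a * η := by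
    simp [sq]; ring
  have ha1 := (abs_le.1 ha').1
  have ha2 := (abs_le.1 ha').2
  have hI : η ≤ ((a + η * Complex.I : ℂ) ^ 2 - 1).im := by rw [him2]; nlinarith
  have hR : ((a + η * Complex.I : ℂ) ^ 2 - 1).re ≤ 3 * L * η := by
    rw [hre2]
    have : (a - 1) * (a + 1) ≤ |a - 1| * (a + 1) :=
      mul_le_mul_of_nonneg_right (le_abs_self _) (by linarith)
    have h1 : |a - 1| * (a + 1) ≤ L * η * 3 :=
      mul_le_mul ha (by linarith) (by linarith) (by positivity)
    nlinarith [sq_nonneg η]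
  have hn : ‖(a + η * Complex.I : ℂ) ^ 2 - 1‖ ^ 2 = ((a + η * Complex.I : ℂ) ^ 2 - 1).re ^ 2 +
      ((a + η * Complex.I : ℂ) ^ 2 - 1).im ^ 2 := by
    rw [← Complex.normSq_eq_norm_sq, Complex.normSq_apply]; ring
  have hn1 := (le_abs_self _).trans (Complex.abs_im_le_norm ((a + η * Complex.I : ℂ) ^ 2 - 1))
  have hn2 := (le_abs_self _).trans (Complex.abs_re_le_norm ((a + η * Complex.I : ℂ) ^ 2 - 1))
  refine admissible_sqrtBranch (by simpa using hη) hN (by positivity) ?_ ?_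
  · generalize ((a + η * Complex.I : ℂ) ^ 2 - 1).re = r at *
    generalize ((a + η * Complex.I : ℂ) ^ 2 - 1).im = m at *
    generalize ‖(a + η * Complex.I : ℂ) ^ 2 - 1‖ = n at *
    have hq : (36 : ℝ) * (L ^ 2 + 1) ≤ (6 * (L + 1)) ^ 2 := by nlinarith
    refine le_trans ?_ (mul_le_mul_of_nonneg_right hq (by linarith))
    rcases le_or_gt r 0 with hr | hr
    · nlinarith [mul_nonneg (sq_nonneg L) (by linarith : 0 ≤ n - r)]
    · have hnp : 0 < n := by linarith
      have h1 : r ^ 2 ≤ 9 * L ^ 2 * m ^ 2 := by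
        have : r ≤ 3 * L * m := hR.trans (by gcongr)
        calc r ^ 2 ≤ (3 * L * m) ^ 2 := by gcongr
          _ = _ := by ring
      have h2 : (n - r) * (2 * n) ≥ m ^ 2 := by nlinarith
      have h3 : n ^ 2 ≤ (9 * (L ^ 2 + 1)) * m ^ 2 := by nlinarith [sq_nonneg m]
      have h4 : n ^ 2 ≤ (9 * (L ^ 2 + 1)) * ((n - r) * (2 * n)) :=
        h3.trans (mul_le_mul_of_nonneg_left h2 (by positivity))
      have h5 : n ≤ (9 * (L ^ 2 + 1)) * (2 * (n - r)) := by
        refine le_of_mul_le_mul_right ?_ hnp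
        linarith
      linarith
  · rw [him]
    have h1 := mul_le_mul_of_nonneg_left (hI.trans hn1) (by positivity : 0 ≤ (N : ℝ) ^ 2 * η ^ 2)
    nlinarith [pow_pos hη 3]

section far

variable {N : ℕ}

lemma logD_eq {z : ℂ} (hz : 0 < z.im) (x : Fin N → ℝ) : logD z x =
    ∑ i, Real.log ‖1 - x i / z‖ - N * ((1 / (1 + sqrtBranch z / z)).re +
      Real.log ‖1 + sqrtBranch z / z‖ - 1 / 2 - Real.log 2) := by
  have hz0 : z ≠ 0 := fun h => by simp [h] at hz
  have h1 : ∀ i, Real.log ‖z - x i‖ = Real.log ‖1 - x i / z‖ + Real.log ‖z‖ := fun i => by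
    have h2 : z - x i = (1 - x i / z) * z := by field_simp
    have h3 : z - x i ≠ 0 := Complex.slitPlane_ne_zero (sub_ofReal_mem_slitPlane hz _)
    rw [h2] at h3 ⊢
    rw [norm_mul, Real.log_mul (norm_ne_zero_iff.2 (left_ne_zero_of_mul h3)) (by simpa)]
  have h4 : Real.log ‖z + sqrtBranch z‖ = Real.log ‖1 + sqrtBranch z / z‖ + Real.log ‖z‖ := by
    have h2 : z + sqrtBranch z = (1 + sqrtBranch z / z) * z := by field_simp
    have h3 : z + sqrtBranch z ≠ 0 :=
      Complex.slitPlane_ne_zero (add_sqrtBranch_mem_slitPlane hz)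
    rw [h2] at h3 ⊢
    rw [norm_mul, Real.log_mul (norm_ne_zero_iff.2 (left_ne_zero_of_mul h3)) (by simpa)]
  have h5 : z ^ 2 - z * sqrtBranch z = 1 / (1 + sqrtBranch z / z) := by
    have h3 : z + sqrtBranch z ≠ 0 :=
      Complex.slitPlane_ne_zero (add_sqrtBranch_mem_slitPlane hz)
    have h6 := sqrtBranch_sq hz
    field_simp
    linear_combination (-1) * h6
  unfold logD potential
  rw [h5, Complex.sub_re, Complex.re_sum, ← Complex.ofReal_natCast, Complex.re_ofReal_mul]
  simp only [Complex.log_re, Complex.add_re, Complex.sub_re, h1, h4, Complex.ofReal_re,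
    Finset.sum_add_distrib]
  simp
  ring

lemma norm_sqrtBranch_div_sub_one_le {z : ℂ} (hz : 0 < z.im) :
    ‖sqrtBranch z / z - 1‖ ≤ 1 / z.im ^ 2 := by
  have hz0 : z ≠ 0 := fun h => by simp [h] at hz
  have h3 : z + sqrtBranch z ≠ 0 :=
    Complex.slitPlane_ne_zero (add_sqrtBranch_mem_slitPlane hz)
  have h5 : sqrtBranch z / z - 1 = -1 / ((z + sqrtBranch z) * z) := by
    have h6 := sqrtBranch_sq hz
    field_simp
    linear_combination h6
  rw [h5, norm_div, norm_mul, norm_neg, norm_one]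
  have h7 := (le_abs_self _).trans (Complex.abs_im_le_norm z)
  have h8 := (le_abs_self _).trans (Complex.abs_im_le_norm (z + sqrtBranch z))
  rw [Complex.add_im] at h8
  have := sqrtBranch_im_pos hz
  refine one_div_le_one_div_of_le (by positivity) ?_
  rw [sq]
  exact mul_le_mul (by linarith) h7 hz.le (norm_nonneg _)

lemma tendsto_logD_vertical (x : Fin N → ℝ) :
    Tendsto (fun y : ℝ => logD (1 + y * Complex.I) x) atTop (𝓝 0) := by
  have h1 : Tendsto (fun y : ℝ => sqrtBranch (1 + y * Complex.I) / (1 + y * Complex.I)) atTop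
      (𝓝 1) := by
    rw [tendsto_iff_norm_sub_tendsto_zero]
    refine squeeze_zero' (Eventually.of_forall fun _ => norm_nonneg _) ?_
      (g := fun y : ℝ => 1 / y ^ 2) ?_
    · filter_upwards [eventually_gt_atTop 0] with y hy
      simpa using norm_sqrtBranch_div_sub_one_le (z := 1 + y * Complex.I) (by simpa using hy)
    · simpa [Function.comp_def] using tendsto_inv_atTop_zero.comp (tendsto_pow_atTop (α := ℝ) two_ne_zero)
  have h2 : Tendsto (fun y : ℝ => (1 + y * Complex.I : ℂ)) atTop (Bornology.cobounded ℂ) := by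
    rw [← tendsto_norm_atTop_iff_cobounded]
    refine tendsto_atTop_mono (fun y => ?_) tendsto_id
    simpa using (le_abs_self _).trans (Complex.abs_im_le_norm (1 + y * Complex.I))
  have h3 : Tendsto (fun y : ℝ => (1 + y * Complex.I : ℂ)⁻¹) atTop (𝓝 0) :=
    tendsto_inv₀_cobounded.comp h2
  have h4 : Tendsto (fun y : ℝ => ∑ i, Real.log ‖1 - x i / (1 + y * Complex.I)‖ -
      N * ((1 / (1 + sqrtBranch (1 + y * Complex.I) / (1 + y * Complex.I))).re +
      Real.log ‖1 + sqrtBranch (1 + y * Complex.I) / (1 + y * Complex.I)‖ - 1 / 2 - Real.log 2))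
      atTop (𝓝 (∑ i : Fin N, Real.log ‖1 - (x i : ℂ) * 0‖ - N * ((1 / (1 + (1 : ℂ))).re +
      Real.log ‖1 + (1 : ℂ)‖ - 1 / 2 - Real.log 2))) := by
    have h5 := h1.const_add 1
    refine Tendsto.sub (tendsto_finsetSum _ fun i _ => ?_) (Tendsto.const_mul _
      (((((Complex.continuous_re.tendsto _).comp ?_)).add ?_).sub_const _ |>.sub_const _))
    · exact Tendsto.log (tendsto_const_nhds.sub (h3.const_mul _)).norm (by simp)
    · exact tendsto_const_nhds.div h5 (by norm_num)
    · exact Tendsto.log h5.norm (by norm_num)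
  have h6 : (∑ i : Fin N, Real.log ‖1 - (x i : ℂ) * 0‖ - N * ((1 / (1 + (1 : ℂ))).re +
      Real.log ‖1 + (1 : ℂ)‖ - 1 / 2 - Real.log 2)) = 0 := by
    have : (1 + 1 : ℂ) = (2 : ℝ) := by norm_num
    rw [this, ← Complex.ofReal_one, ← Complex.ofReal_div, Complex.ofReal_re, Complex.norm_real]
    simp
  rw [h6] at h4
  refine h4.congr' ?_
  filter_upwards [eventually_gt_atTop 0] with y hy
  exact (logD_eq (by simpa using hy) x).symm

end far

/-- Characteristic function of the centred logarithm on the vertical line through the edge. -/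
noncomputable def cfVertical (β : ℝ) (N : ℕ) (τ y : ℝ) : ℂ :=
  ∫ x, Complex.exp (τ * logD (1 + y * Complex.I) x * Complex.I) ∂(gbe β N)

section cf

variable {β : ℝ} {N : ℕ} (hβ : 0 < β) (hN : 0 < N)
include hβ hN

lemma hasDerivAt_cfVertical (τ : ℝ) {y : ℝ} (hy : 0 < y) : HasDerivAt (cfVertical β N τ)
    (∫ x, (-(τ * Complex.I) * (resG (1 + y * Complex.I) x +
      2 * N * sqrtBranch (1 + y * Complex.I)).im) *
      Complex.exp (τ * logD (1 + y * Complex.I) x * Complex.I) ∂(gbe β N)) y := by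
  have h1 : ∀ u : ℝ, HasDerivAt (fun u : ℝ => Complex.exp (u * Complex.I))
      (Complex.exp (u * Complex.I) * Complex.I) u := fun u => by
    simpa using ((Complex.ofRealCLM.hasDerivAt (x := u)).mul_const Complex.I).cexp
  have h2 := hasDerivAt_integral_logD (c := τ) (v := Complex.I) (z₀ := 1) (t₀ := y)
    (B := fun _ => 0) hβ hN h1 (by fun_prop) (C := 1) (C' := 1)
    (fun u => by simp [Complex.norm_exp_ofReal_mul_I])
    (fun u => by simp [Complex.norm_exp_ofReal_mul_I]) (by simpa using hy) continuous_const
  unfold cfVertical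
  convert h2 using 1
  · funext y
    simp
  · refine integral_congr_ae (Eventually.of_forall fun x => ?_)
    simp only [sub_zero, Complex.I_mul_re]
    push_cast
    ring

lemma tendsto_cfVertical (τ : ℝ) : Tendsto (cfVertical β N τ) atTop (𝓝 1) := by
  have := isProbabilityMeasure_gbe hβ hN
  have h : Tendsto (fun y : ℝ => ∫ x, Complex.exp (τ * logD (1 + y * Complex.I) x * Complex.I)
      ∂(gbe β N)) atTop (𝓝 (∫ x, 1 ∂(gbe β N))) := by
    refine tendsto_integral_filter_of_dominated_convergence (fun _ => 1) ?_ ?_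
      (integrable_const _) (Eventually.of_forall fun x => ?_)
    · filter_upwards [eventually_gt_atTop 0] with y hy
      have := continuous_logD (N := N) (z := 1 + y * Complex.I) (by simpa using hy)
      exact Continuous.aestronglyMeasurable (by fun_prop)
    · refine Eventually.of_forall fun y => Eventually.of_forall fun x => ?_
      rw [← Complex.ofReal_mul, Complex.norm_exp_ofReal_mul_I]
    · have h1 : Tendsto (fun y : ℝ => Complex.exp (τ * logD (1 + y * Complex.I) x * Complex.I))
          atTop (𝓝 (Complex.exp (τ * (0 : ℝ) * Complex.I))) :=
        (Complex.continuous_exp.tendsto _).comp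
          (((((Complex.continuous_ofReal.tendsto _).comp
            (tendsto_logD_vertical x)).const_mul _)).mul_const _)
      simpa using h1
  rwa [integral_const, probReal_univ, one_smul] at h

lemma norm_integral_mul_exp_le {g : (Fin N → ℝ) → ℂ} (hg : BddCont g) (h : (Fin N → ℝ) → ℝ) :
    ‖∫ x, g x * Complex.exp (h x * Complex.I) ∂(gbe β N)‖ ≤ ∫ x, ‖g x‖ ∂(gbe β N) := by
  have := isProbabilityMeasure_gbe hβ hN
  refine norm_integral_le_of_norm_le (hg.norm.integrable _) (Eventually.of_forall fun x => ?_)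
  rw [norm_mul, Complex.norm_exp_ofReal_mul_I, mul_one]

lemma norm_cfVertical_one_sub_one_le (τ : ℝ) :
    ‖cfVertical β N τ 1 - 1‖ ≤ |τ| * (farConst β 2 + 1) := by
  have := isProbabilityMeasure_gbe hβ hN
  set K := |τ| * (farConst β 2 + 1) with hK
  have hder : ∀ y : ℝ, 1 ≤ y → ‖deriv (cfVertical β N τ) y‖ ≤ K * (y ^ 2)⁻¹ := fun y hy => by
    have hy0 : 0 < y := by linarith
    have hz : 0 < (1 + y * Complex.I : ℂ).im := by simpa using hy0
    rw [(hasDerivAt_cfVertical hβ hN τ hy0).deriv]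
    have hb : BddCont fun x : Fin N → ℝ => (-(τ * Complex.I) * (resG (1 + y * Complex.I) x +
      2 * N * sqrtBranch (1 + y * Complex.I)).im : ℂ) :=
      (BddCont.const _).mul (((bddCont_resG hz).add (BddCont.const _)).im.ofReal)
    have h1 := norm_integral_mul_exp_le hβ hN hb (fun x => τ * logD (1 + y * Complex.I) x)
    push_cast at h1
    refine h1.trans ?_
    have hadm : Admissible 2 N (1 + y * Complex.I) (sqrtBranch (1 + y * Complex.I)) := by
      refine admissible_vertical hy0 hN ?_
      have : (1 : ℝ) ≤ N := by exact_mod_cast hN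
      have h2 := one_le_pow₀ this (n := 2)
      have h3 := one_le_pow₀ hy (n := 3)
      nlinarith
    have h4 := integral_dist_le_of_one_le hβ hadm (by simpa using hy)
      (by simpa using le_norm_sqrtBranch_vertical hy0)
    rw [im_vertical, inv_pow] at h4
    calc _ ≤ ∫ x, |τ| * ‖resG (1 + y * Complex.I) x + 2 * N * sqrtBranch (1 + y * Complex.I)‖
          ∂(gbe β N) := by
          refine integral_mono (hb.norm.integrable _)
            (((bddCont_resG hz).add (BddCont.const _)).norm.integrable _ |>.const_mul _) fun x => ?_
          simp only [norm_mul, norm_neg, Complex.norm_real, Complex.norm_I, mul_one,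
            Real.norm_eq_abs]
          exact mul_le_mul_of_nonneg_left (Complex.abs_im_le_norm _) (abs_nonneg _)
      _ ≤ _ := by
          rw [integral_const_mul]
          exact (mul_le_mul_of_nonneg_left h4 (abs_nonneg τ)).trans_eq (by ring)
  have hfar : ∀ R : ℝ, 1 ≤ R → ‖cfVertical β N τ R - cfVertical β N τ 1‖ ≤ K := fun R hR => by
    have h1 := image_norm_le_of_norm_deriv_right_le_deriv_boundary' (a := 1) (b := R)
      (f := fun y => cfVertical β N τ y - cfVertical β N τ 1) (f' := deriv (cfVertical β N τ))
      (B := fun y => K * (1 - y⁻¹)) (B' := fun y => K * (y ^ 2)⁻¹)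
      (fun y hy => ((hasDerivAt_cfVertical hβ hN τ (by linarith [hy.1])).continuousAt.sub
        continuousAt_const).continuousWithinAt)
      (fun y hy => ((hasDerivAt_cfVertical hβ hN τ (by linarith [hy.1])).differentiableAt.hasDerivAt
        |>.sub_const _).hasDerivWithinAt) (by simp)
      (fun y hy => ContinuousAt.continuousWithinAt (by
        have : y ≠ 0 := by linarith [hy.1]
        fun_prop (disch := assumption)))
      (fun y hy => by
        have h2 := ((hasDerivAt_inv (by linarith [hy.1] : y ≠ 0)).const_sub 1).const_mul K
        simpa using h2.hasDerivWithinAt)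
      (fun y hy => hder y hy.1) ⟨hR, le_rfl⟩
    refine h1.trans ?_
    have h2 : 0 < R⁻¹ := inv_pos.2 (by linarith)
    have hK0 : 0 ≤ K := by
      have := (norm_nonneg _).trans (hder 1 le_rfl)
      simpa using this
    nlinarith
  have h5 := (tendsto_cfVertical hβ hN τ).sub_const (cfVertical β N τ 1)
  rw [norm_sub_rev]
  exact le_of_tendsto h5.norm ((eventually_ge_atTop 1).mono hfar)

end cf


section vertical

variable {N : ℕ} {y : ℝ} (hN : 0 < N) (hy : 0 < y)
include hN hy

lemma abs_im_psum_vertical_le : |(-(4 * N * sqrtBranch (1 + y * Complex.I))⁻¹ *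
    (2 * N * (1 + y * Complex.I) / sqrtBranch (1 + y * Complex.I) - 2 * N)).im - 1 / (4 * y)| ≤
    1 / 8 + 1 / 2 * ‖sqrtBranch (1 + y * Complex.I)‖⁻¹ := by
  have hz : 0 < (1 + y * Complex.I : ℂ).im := by simpa using hy
  have hs := sqrtBranch_sq hz
  have hs0 := sqrtBranch_ne_zero hz
  generalize sqrtBranch (1 + y * Complex.I) = s at *
  have hN' : (N : ℂ) ≠ 0 := by exact_mod_cast hN.ne'
  have hy' : (y : ℂ) ≠ 0 := by exact_mod_cast hy.ne'
  have h2 : (2 + y * Complex.I : ℂ) ≠ 0 := fun h => by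
    have := congrArg Complex.re h
    simp at this
  have hs2 : s ^ 2 = Complex.I * y * (2 + y * Complex.I) := by
    rw [hs]; ring
  have h1 : -(4 * N * s)⁻¹ * (2 * N * (1 + y * Complex.I) / s - 2 * N) =
      ((1 / (4 * y) : ℝ) : ℂ) * Complex.I + (-(4 * (2 + y * Complex.I))⁻¹ + 1 / 2 * s⁻¹) := by
    have h3 : -(4 * N * s)⁻¹ * (2 * N * (1 + y * Complex.I) / s - 2 * N) =
      -(1 + y * Complex.I) / (2 * s ^ 2) + 1 / 2 * s⁻¹ := by
      field_simp
      ring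
    rw [h3, hs2, ← add_assoc]
    congr 1
    push_cast
    field_simp
    ring_nf
    simp only [Complex.I_sq, Complex.I_pow_three]
    ring
  rw [h1, Complex.add_im, Complex.im_ofReal_mul, Complex.I_im, mul_one, add_sub_cancel_left]
  refine (Complex.abs_im_le_norm _).trans ((norm_add_le _ _).trans (add_le_add ?_ ?_))
  · rw [norm_neg, norm_inv, norm_mul, ← one_div]
    have := (le_abs_self _).trans (Complex.abs_re_le_norm (2 + y * Complex.I))
    simp at this
    refine one_div_le_one_div_of_le (by norm_num) ?_
    simp only [Complex.norm_ofNat]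
    linarith
  · rw [norm_mul, norm_inv]; norm_num

lemma abs_im_asum_vertical_le : |(-(4 * N * sqrtBranch (1 + y * Complex.I))⁻¹ *
    ((2 * N * (sqrtBranch (1 + y * Complex.I)).im / y - 2 * N : ℝ) : ℂ)).im - 1 / (4 * y)| ≤
    1 / 8 + 1 / 2 * ‖sqrtBranch (1 + y * Complex.I)‖⁻¹ := by
  have hz : 0 < (1 + y * Complex.I : ℂ).im := by simpa using hy
  have hs1 := two_mul_im_sqrtBranch_sq hz
  have hs2 := norm_sqrtBranch_sq hz
  have hs0 := sqrtBranch_ne_zero hz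
  have hw := two_mul_le_norm_vertical (y := y)
  rw [← hs2] at hs1 hw
  rw [sq_sub_one_vertical] at hs1
  simp only [sub_neg_eq_add] at hs1
  generalize sqrtBranch (1 + y * Complex.I) = s at *
  have hN' : (N : ℂ) ≠ 0 := by exact_mod_cast hN.ne'
  have hy' : (y : ℂ) ≠ 0 := by exact_mod_cast hy.ne'
  have h1 : -(4 * N * s)⁻¹ * ((2 * N * s.im / y - 2 * N : ℝ) : ℂ) =
      ((-(s.im / (2 * y)) : ℝ) : ℂ) * s⁻¹ + 1 / 2 * s⁻¹ := by
    push_cast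
    field_simp
    ring
  have hn : 0 < ‖s‖ ^ 2 := by linarith
  have h2 : (((-(s.im / (2 * y)) : ℝ) : ℂ) * s⁻¹).im = 1 / (4 * y) + y / (4 * ‖s‖ ^ 2) := by
    rw [Complex.im_ofReal_mul, Complex.inv_im, Complex.normSq_eq_norm_sq]
    field_simp
    linarith
  rw [h1, Complex.add_im, h2, add_assoc, add_sub_cancel_left]
  refine (abs_add_le _ _).trans (add_le_add ?_ ((Complex.abs_im_le_norm _).trans ?_))
  · rw [abs_of_nonneg (by positivity), div_le_div_iff₀ (by positivity) (by norm_num)]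
    linarith
  · rw [norm_mul, norm_inv]; norm_num

end vertical

section loop

variable {β : ℝ} {N : ℕ} {z : ℂ} (hβ : 0 < β) (hN : 0 < N) (hz : 0 < z.im)

lemma mul_re_eq (a : ℂ) : a * a.re = (a ^ 2 + (‖a‖ ^ 2 : ℝ)) / 2 := by
  have h1 : (a.re : ℂ) = (a + (starRingEnd ℂ) a) / 2 := by
    rw [Complex.add_conj]; push_cast; ring
  have h2 := Complex.mul_conj' a
  push_cast
  rw [h1, ← h2]
  ring

lemma im_eq (w : ℂ) : (w.im : ℂ) = (w - (starRingEnd ℂ) w) / (2 * Complex.I) := by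
  rw [Complex.sub_conj]
  have := Complex.I_ne_zero
  push_cast
  field_simp

lemma BddCont.exp_logD (hz : 0 < z.im) (τ : ℝ) :
    BddCont fun x : Fin N → ℝ => Complex.exp (τ * logD z x * Complex.I) := by
  refine ⟨?_, 1, fun x => ?_⟩
  · have := continuous_logD (N := N) hz
    fun_prop
  · simp only [← Complex.ofReal_mul, Complex.norm_exp_ofReal_mul_I, le_refl]

lemma BddCont.im' {f : (Fin N → ℝ) → ℂ} (hf : BddCont f) : BddCont fun x => ((f x).im : ℂ) :=
  hf.im.ofReal

lemma hasLineDerivAt_exp_logD (hz : 0 < z.im) (τ : ℝ) (i : Fin N) (x : Fin N → ℝ) :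
    HasLineDerivAt ℝ (fun x : Fin N → ℝ => Complex.exp (τ * logD z x * Complex.I))
      (Complex.exp (τ * logD z x * Complex.I) * (-(τ * (res z (x i)).re) * Complex.I))
      x (Pi.single i 1) := by
  have h1 : HasDerivAt (fun t : ℝ => logD z (x + t • Pi.single i 1)) (-(res z (x i)).re) 0 :=
    hasLineDerivAt_logD hz x i
  have h2 := ((h1.ofReal_comp.const_mul (τ : ℂ)).mul_const Complex.I).cexp
  simpa [HasLineDerivAt] using h2

include hβ hN hz

lemma integral_im_mul_loopA (τ : ℝ) (c : ℂ) :
    ∫ x, ((c * loopA β z x).im : ℂ) * Complex.exp (τ * logD z x * Complex.I) ∂(gbe β N) =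
      τ * Complex.I / β * ∫ x, ((c * (psum z 2 x + asum z 2 x)).im : ℂ) *
        Complex.exp (τ * logD z x * Complex.I) ∂(gbe β N) := by
  have := isProbabilityMeasure_gbe hβ hN
  have bF := BddCont.exp_logD (N := N) hz τ
  have bF' : ∀ i : Fin N, BddCont fun x : Fin N → ℝ =>
      Complex.exp (τ * logD z x * Complex.I) * (-(τ * (res z (x i)).re) * Complex.I) := fun i =>
    bF.mul ((((BddCont.const (τ : ℂ)).mul (bddCont_res_apply hz i).re.ofReal).neg).mul
      (BddCont.const _))
  have hF := hasLineDerivAt_exp_logD (N := N) hz τ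
  have h1 := loop_one hβ hN hz bF bF' hF
  have h2 := loop_one hβ hN hz bF.conj (fun i => (bF' i).conj)
    (fun i x => hasLineDerivAt_conj (hF i x))
  have h3 := congrArg (starRingEnd ℂ) h2
  rw [← integral_conj, map_zero] at h3
  have bA := bddCont_loopA (N := N) hz β
  have bP := bddCont_psum (N := N) hz 2
  have bS := (bddCont_asum (N := N) hz 2).ofReal
  have i1 := (((BddCont.const c).mul bA).im'.mul bF).integrable (gbe β N)
  have i2 := (((BddCont.const c).mul (bP.add bS)).im'.mul bF).integrable (gbe β N)
  have b3 : BddCont fun x : Fin N → ℝ => ∑ i, res z (x i) * (Complex.exp (τ * logD z x * Complex.I) *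
      (-(τ * (res z (x i)).re) * Complex.I)) + β / 2 * (Complex.exp (τ * logD z x * Complex.I) *
      loopA β z x) :=
    (BddCont.sum Finset.univ fun i _ => (bddCont_res_apply hz i).mul (bF' i)).add
      ((BddCont.const _).mul (bF.mul bA))
  have b4 : BddCont fun x : Fin N → ℝ => (starRingEnd ℂ) (∑ i, res z (x i) *
      (starRingEnd ℂ) (Complex.exp (τ * logD z x * Complex.I) *
      (-(τ * (res z (x i)).re) * Complex.I)) + β / 2 * ((starRingEnd ℂ)
      (Complex.exp (τ * logD z x * Complex.I)) * loopA β z x)) :=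
    ((BddCont.sum Finset.univ fun i _ => (bddCont_res_apply hz i).mul (bF' i).conj).add
      ((BddCont.const _).mul (bF.conj.mul bA))).conj
  rw [← sub_eq_zero, ← integral_const_mul, ← integral_sub i1 (i2.const_mul _)]
  have h4 : ∫ x, ((β * Complex.I)⁻¹ * c * (∑ i, res z (x i) *
      (Complex.exp (τ * logD z x * Complex.I) *
      (-(τ * (res z (x i)).re) * Complex.I)) + β / 2 * (Complex.exp (τ * logD z x * Complex.I) *
      loopA β z x)) - (β * Complex.I)⁻¹ * (starRingEnd ℂ) c *
      (starRingEnd ℂ) (∑ i, res z (x i) *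
      (starRingEnd ℂ) (Complex.exp (τ * logD z x * Complex.I) *
      (-(τ * (res z (x i)).re) * Complex.I)) + β / 2 * ((starRingEnd ℂ)
      (Complex.exp (τ * logD z x * Complex.I)) * loopA β z x))) ∂(gbe β N) = 0 := by
    rw [integral_sub ((b3.integrable _).const_mul _) ((b4.integrable _).const_mul _),
      integral_const_mul, integral_const_mul, h1, h3, mul_zero, mul_zero, sub_zero]
  rw [← h4]
  refine integral_congr_ae (Eventually.of_forall fun x => ?_)
  simp only
  have h5 : ∑ i, res z (x i) * (Complex.exp (τ * logD z x * Complex.I) *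
      (-(τ * (res z (x i)).re) * Complex.I)) = -(τ * Complex.I / 2) *
      Complex.exp (τ * logD z x * Complex.I) * (psum z 2 x + asum z 2 x) := by
    unfold psum asum
    push_cast
    rw [← Finset.sum_add_distrib, Finset.mul_sum]
    refine Finset.sum_congr rfl fun i _ => ?_
    have := mul_re_eq (res z (x i))
    push_cast at this
    linear_combination (-(τ * Complex.I) * Complex.exp (τ * logD z x * Complex.I)) * this
  have h6 : (starRingEnd ℂ) (∑ i, res z (x i) * (starRingEnd ℂ)
      (Complex.exp (τ * logD z x * Complex.I) * (-(τ * (res z (x i)).re) * Complex.I))) =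
      -(τ * Complex.I / 2) * Complex.exp (τ * logD z x * Complex.I) *
      ((starRingEnd ℂ) (psum z 2 x) + asum z 2 x) := by
    unfold psum asum
    push_cast
    rw [map_sum, map_sum, ← Finset.sum_add_distrib, Finset.mul_sum]
    refine Finset.sum_congr rfl fun i _ => ?_
    have := congrArg (starRingEnd ℂ) (mul_re_eq (res z (x i)))
    simp only [map_mul, map_div₀, map_add, Complex.conj_ofReal, map_ofNat] at this
    rw [map_mul, Complex.conj_conj]
    push_cast at this
    linear_combination (-(τ * Complex.I) * Complex.exp (τ * logD z x * Complex.I)) * this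
  rw [map_add, h6, h5, im_eq, im_eq]
  have hβ' : (β : ℂ) ≠ 0 := by exact_mod_cast hβ.ne'
  have hI := Complex.I_ne_zero
  simp only [map_mul, map_add, map_div₀, Complex.conj_ofReal, map_ofNat, Complex.conj_conj]
  field_simp
  ring_nf

end loop


/-- Constants in the differential inequality for the characteristic function. -/
noncomputable def odeConst (β : ℝ) : ℝ :=
  (1 / β + |1 - 2 / β|) * |psumConst β 2| + 1 / β * (distConst β 2 + 1) + distConst β 2

section step

variable {β : ℝ} {N : ℕ} {z s : ℂ} {q : ℝ}

lemma Admissible.resG_add_eq (h : Admissible q N z s) (β : ℝ) (x : Fin N → ℝ) :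
    resG z x + 2 * N * s = -(4 * N * s)⁻¹ * loopA β z x +
      (-(4 * N * s)⁻¹ * psum z 2 x * (1 - 2 / β) -
        -(4 * N * s)⁻¹ * (resG z x + 2 * N * s) ^ 2) := by
  have h1 := h.prod_eq β x
  have hs : s ≠ 0 := fun h0 => by simpa [h0] using h.im_sqrt_pos
  have hN : (N : ℂ) ≠ 0 := by exact_mod_cast h.pos.ne'
  rw [eq_sub_of_add_eq h1.symm]
  field_simp
  ring

lemma abs_asum_sub_le (h : Admissible q N z s) (x : Fin N → ℝ) :
    ‖(asum z 2 x : ℂ) - (2 * N * s.im / z.im - 2 * N : ℝ)‖ ≤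
      z.im⁻¹ * ‖resG z x + 2 * N * s‖ := by
  have hz := h.im_pos
  have h1 := im_resG (z := z) x
  rw [← Complex.ofReal_sub, Complex.norm_real, Real.norm_eq_abs]
  have h2 : asum z 2 x - (2 * N * s.im / z.im - 2 * N) =
      -(z.im⁻¹ * (resG z x + 2 * N * s).im) := by
    rw [Complex.add_im, h1]
    have : (2 * N * s : ℂ).im = 2 * N * s.im := by
      have h3 : (2 * N * s : ℂ) = ((2 * N : ℝ) : ℂ) * s := by push_cast; ring
      rw [h3, Complex.im_ofReal_mul]
    rw [this]
    field_simp
    ring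
  rw [h2, abs_neg, abs_mul, abs_of_pos (inv_pos.2 hz)]
  exact mul_le_mul_of_nonneg_left (Complex.abs_im_le_norm _) (inv_pos.2 hz).le

/-- The characteristic function satisfies the Gaussian differential equation up to an error. -/
lemma norm_integral_step_le (hβ : 0 < β) (h : Admissible 2 N z s) {τ m d : ℝ} (hτ : |τ| ≤ 1)
    (hd : 0 ≤ d)
    (h1 : |(-(4 * N * s)⁻¹ * (2 * N * z / s - 2 * N)).im - m / 2| ≤ d)
    (h2 : |(-(4 * N * s)⁻¹ * ((2 * N * s.im / z.im - 2 * N : ℝ) : ℂ)).im - m / 2| ≤ d) :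
    ‖∫ x, (-(τ * Complex.I) * (resG z x + 2 * N * s).im) *
        Complex.exp (τ * logD z x * Complex.I) ∂(gbe β N) -
      (τ ^ 2 / β * m - τ * Complex.I * (1 - 2 / β) * (m / 2)) *
        ∫ x, Complex.exp (τ * logD z x * Complex.I) ∂(gbe β N)‖ ≤
    |τ| * (odeConst β * ((4 * (N * ‖s‖))⁻¹ * z.im⁻¹ ^ 2) + 2 * (1 / β + |1 - 2 / β|) * d) := by
  have hN := h.pos
  have hz := h.im_pos
  have := isProbabilityMeasure_gbe hβ hN
  have bF := BddCont.exp_logD (N := N) hz τ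
  have bA := bddCont_loopA (N := N) hz β
  have bP := bddCont_psum (N := N) hz 2
  have bS := (bddCont_asum (N := N) hz 2).ofReal
  have bG : BddCont fun x : Fin N → ℝ => resG z x + 2 * N * s :=
    (bddCont_resG hz).add (BddCont.const _)
  set c : ℂ := -(4 * N * s)⁻¹ with hc
  have hcn : ‖c‖ = (4 * (N * ‖s‖))⁻¹ := by
    rw [hc, norm_neg, norm_inv, norm_mul, norm_mul]; norm_num; ring
  have bcA := ((BddCont.const c).mul bA).im'
  have bcP := ((BddCont.const c).mul bP).im'
  have bcPS := ((BddCont.const c).mul (bP.add bS)).im'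
  have bcG := ((BddCont.const c).mul (bG.pow 2)).im'
  set E : (Fin N → ℝ) → ℂ := fun x => τ ^ 2 / β * ((c * (psum z 2 x + asum z 2 x)).im - m) -
    τ * Complex.I * (1 - 2 / β) * ((c * psum z 2 x).im - m / 2) +
    τ * Complex.I * (c * (resG z x + 2 * N * s) ^ 2).im with hE
  have bE : BddCont E := (((BddCont.const _).mul (bcPS.sub (BddCont.const _))).sub
    ((BddCont.const _).mul (bcP.sub (BddCont.const _)))).add ((BddCont.const _).mul bcG)
  have key : ∫ x, (-(τ * Complex.I) * (resG z x + 2 * N * s).im) *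
        Complex.exp (τ * logD z x * Complex.I) ∂(gbe β N) -
      (τ ^ 2 / β * m - τ * Complex.I * (1 - 2 / β) * (m / 2)) *
        ∫ x, Complex.exp (τ * logD z x * Complex.I) ∂(gbe β N) =
      ∫ x, E x * Complex.exp ((τ * logD z x : ℝ) * Complex.I) ∂(gbe β N) := by
    have hL := integral_im_mul_loopA hβ hN hz τ c
    have i1 := (bcA.mul bF).integrable (gbe β N)
    have i2 := (bcPS.mul bF).integrable (gbe β N)
    have i3 := ((((BddCont.const (-(τ * Complex.I))).mul bG.im').mul bF)).integrable (gbe β N)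
    have iE := ((bE.mul (BddCont.exp_logD hz τ)).congr (g := fun x => E x *
      Complex.exp ((τ * logD z x : ℝ) * Complex.I)) fun x => by push_cast; rfl).integrable (gbe β N)
    have iF := (bF.integrable (gbe β N)).const_mul
      (τ ^ 2 / β * m - τ * Complex.I * (1 - 2 / β) * (m / 2))
    have iL := ((BddCont.const (τ * Complex.I)).mul ((bcA.mul bF).sub
      ((BddCont.const (τ * Complex.I / β)).mul (bcPS.mul bF)))).integrable (gbe β N)
    rw [sub_eq_iff_eq_add, ← integral_const_mul, ← integral_add iE iF, ← add_zero (∫ x, _ ∂_),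
      ← mul_zero (τ * Complex.I), ← sub_self (∫ x, ((c * loopA β z x).im : ℂ) *
        Complex.exp (τ * logD z x * Complex.I) ∂(gbe β N))]
    nth_rewrite 2 [hL]
    rw [← integral_const_mul, ← integral_sub i1 (i2.const_mul _), ← integral_const_mul,
      ← integral_add i3 iL]
    refine integral_congr_ae (Eventually.of_forall fun x => ?_)
    have h3 : (resG z x + 2 * N * s).im = (c * loopA β z x).im +
        ((1 - 2 / β) * (c * psum z 2 x).im - (c * (resG z x + 2 * N * s) ^ 2).im) := by
      conv_lhs => rw [h.resG_add_eq β x]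
      rw [← hc, Complex.add_im, Complex.sub_im]
      have h4 : c * psum z 2 x * (1 - 2 / β) = ((1 - 2 / β : ℝ) : ℂ) * (c * psum z 2 x) := by
        push_cast; ring
      rw [h4, Complex.im_ofReal_mul]
    simp only [hE]
    rw [h3]
    push_cast
    ring_nf
    simp only [Complex.I_sq]
    ring
  rw [key]
  refine (norm_integral_mul_exp_le hβ hN bE _).trans ?_
  have hβ' : 0 ≤ 1 / β := by positivity
  have hκ := abs_nonneg (1 - 2 / β)
  set A := 1 / β + |1 - 2 / β| with hA
  set P : (Fin N → ℝ) → ℝ := fun x => ‖psum z 2 x + 2 * N - 2 * N * z / s‖ with hP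
  set Q : (Fin N → ℝ) → ℝ := fun x => ‖resG z x + 2 * N * s‖ with hQ
  have bPP : BddCont P := ((bP.add (BddCont.const _)).sub (BddCont.const _)).norm
  have bQ : BddCont Q := bG.norm
  have hpt : ∀ x, ‖E x‖ ≤ (|τ| * (‖c‖ * A)) * P x + (|τ| * (‖c‖ * (1 / β * z.im⁻¹))) * Q x +
      (|τ| * ‖c‖) * Q x ^ 2 + |τ| * (2 * A * d) := fun x => by
    have e1 : |(c * psum z 2 x).im - m / 2| ≤ ‖c‖ * P x + d := by
      have : (c * psum z 2 x).im - m / 2 = (c * (psum z 2 x + 2 * N - 2 * N * z / s)).im +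
          ((c * (2 * N * z / s - 2 * N)).im - m / 2) := by
        rw [add_sub, ← Complex.add_im]; congr 2; ring
      rw [this]
      refine (abs_add_le _ _).trans (add_le_add ((Complex.abs_im_le_norm _).trans ?_) h1)
      rw [norm_mul]
    have e2 : |(c * (asum z 2 x : ℂ)).im - m / 2| ≤ ‖c‖ * (z.im⁻¹ * Q x) + d := by
      have : (c * (asum z 2 x : ℂ)).im - m / 2 =
          (c * ((asum z 2 x : ℂ) - (2 * N * s.im / z.im - 2 * N : ℝ))).im +
          ((c * ((2 * N * s.im / z.im - 2 * N : ℝ) : ℂ)).im - m / 2) := by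
        rw [add_sub, ← Complex.add_im]; congr 2; ring
      rw [this]
      refine (abs_add_le _ _).trans (add_le_add ((Complex.abs_im_le_norm _).trans ?_) h2)
      rw [norm_mul]
      exact mul_le_mul_of_nonneg_left (abs_asum_sub_le h x) (norm_nonneg _)
    have e3 : |(c * (psum z 2 x + asum z 2 x)).im - m| ≤
        ‖c‖ * (P x + z.im⁻¹ * Q x) + 2 * d := by
      have : (c * (psum z 2 x + asum z 2 x)).im - m = ((c * psum z 2 x).im - m / 2) +
          ((c * (asum z 2 x : ℂ)).im - m / 2) := by
        rw [mul_add, Complex.add_im]; ring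
      rw [this]
      refine (abs_add_le _ _).trans ?_
      linarith
    have e4 : |(c * (resG z x + 2 * N * s) ^ 2).im| ≤ ‖c‖ * Q x ^ 2 := by
      refine (Complex.abs_im_le_norm _).trans ?_
      rw [norm_mul, norm_pow]
    have n1 : ‖(τ ^ 2 / β * ((c * (psum z 2 x + asum z 2 x)).im - m) : ℂ)‖ =
        |τ| ^ 2 * (1 / β) * |(c * (psum z 2 x + asum z 2 x)).im - m| := by
      have : (τ ^ 2 / β * ((c * (psum z 2 x + asum z 2 x)).im - m) : ℂ) =
        ((τ ^ 2 * (1 / β) * ((c * (psum z 2 x + asum z 2 x)).im - m) : ℝ) : ℂ) := by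
        push_cast; ring
      rw [this, Complex.norm_real, Real.norm_eq_abs, abs_mul, abs_mul, abs_pow,
        abs_of_nonneg hβ']
    have n2 : ‖(τ * Complex.I * (1 - 2 / β) * ((c * psum z 2 x).im - m / 2) : ℂ)‖ =
        |τ| * |1 - 2 / β| * |(c * psum z 2 x).im - m / 2| := by
      have : (τ * Complex.I * (1 - 2 / β) * ((c * psum z 2 x).im - m / 2) : ℂ) =
        ((τ * (1 - 2 / β) * ((c * psum z 2 x).im - m / 2) : ℝ) : ℂ) * Complex.I := by
        push_cast; ring
      rw [this, norm_mul, Complex.norm_I, mul_one, Complex.norm_real, Real.norm_eq_abs, abs_mul,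
        abs_mul]
    have n3 : ‖(τ * Complex.I * (c * (resG z x + 2 * N * s) ^ 2).im : ℂ)‖ =
        |τ| * |(c * (resG z x + 2 * N * s) ^ 2).im| := by
      rw [norm_mul, norm_mul, Complex.norm_I, mul_one, Complex.norm_real, Complex.norm_real,
        Real.norm_eq_abs, Real.norm_eq_abs]
    have hτ2 : |τ| ^ 2 ≤ |τ| := by nlinarith [abs_nonneg τ]
    calc ‖E x‖ ≤ |τ| ^ 2 * (1 / β) * |(c * (psum z 2 x + asum z 2 x)).im - m| +
        |τ| * |1 - 2 / β| * |(c * psum z 2 x).im - m / 2| +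
        |τ| * |(c * (resG z x + 2 * N * s) ^ 2).im| := by
          rw [← n1, ← n2, ← n3]
          exact (norm_add_le _ _).trans (add_le_add_left (norm_sub_le _ _) _)
      _ ≤ |τ| * (1 / β) * (‖c‖ * (P x + z.im⁻¹ * Q x) + 2 * d) +
        |τ| * |1 - 2 / β| * (‖c‖ * P x + 2 * d) + |τ| * (‖c‖ * Q x ^ 2) := by
          have := e1.trans (by linarith : _ ≤ ‖c‖ * P x + 2 * d)
          gcongr
      _ = _ := by rw [hA]; ring
  refine (integral_le_of_forall_le bE.norm bPP bQ (bQ.rpow 2) hpt).trans ?_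
  have f1 := (integral_psum_dist_le hβ h).trans
    (mul_le_mul_of_nonneg_right (le_abs_self (psumConst β 2)) (by positivity))
  have f2 := integral_dist_le hβ h
  have f3 := integral_dist_sq_le hβ h
  have hy := inv_pos.2 hz
  calc _ ≤ |τ| * (‖c‖ * A) * (|psumConst β 2| * z.im⁻¹ ^ 2) +
      |τ| * (‖c‖ * (1 / β * z.im⁻¹)) * ((distConst β 2 + 1) * z.im⁻¹) +
      |τ| * ‖c‖ * (distConst β 2 * z.im⁻¹ ^ 2) + |τ| * (2 * A * d) := by
        have hA0 : 0 ≤ A := by positivity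
        gcongr
    _ = _ := by rw [← hcn, odeConst, ← hA]; ring

end step


section verticalFlow

variable {β : ℝ} {N : ℕ} (hβ : 0 < β) {η : ℝ} (hη : 0 < η) (hη1 : η ≤ 1)
  (hNη : (N : ℝ) ^ 2 * η ^ 3 = 1)

/-- Constant in the differential inequality along the vertical line. -/
noncomputable def verticalConst (β : ℝ) : ℝ := |odeConst β| + 2 * (1 / β + |1 - 2 / β|)

lemma verticalConst_nonneg (hβ : 0 < β) : 0 ≤ verticalConst β := by
  unfold verticalConst
  positivity

lemma pos_of_scale (hNη : (N : ℝ) ^ 2 * η ^ 3 = 1) : 0 < N := by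
  rcases Nat.eq_zero_or_pos N with h | h
  · simp [h] at hNη
  · exact h

include hβ hη hNη

lemma norm_cfVertical_ode_le {τ y : ℝ} (hτ : |τ| ≤ 1) (hy : η ≤ y) (hy1 : y ≤ 1) :
    ‖deriv (cfVertical β N τ) y + (τ * Complex.I * (1 - 2 / β) / 4 - τ ^ 2 / (2 * β)) / y *
      cfVertical β N τ y‖ ≤ |τ| * verticalConst β * (η / y ^ 2 + 1 / √y) := by
  have hy0 : 0 < y := hη.trans_le hy
  have hN := pos_of_scale hNη
  have hN0 : (0 : ℝ) < N := by exact_mod_cast hN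
  have hadm := admissible_vertical hy0 hN (by rw [← hNη]; gcongr)
  have hsy : 0 < √y := Real.sqrt_pos.2 hy0
  have hsy1 : √y ≤ 1 := Real.sqrt_le_one.2 hy1
  have hs := sqrt_le_norm_sqrtBranch_vertical hy0
  have hd : 1 / 8 + 1 / 2 * ‖sqrtBranch (1 + y * Complex.I)‖⁻¹ ≤ 1 / √y := by
    have h1 : ‖sqrtBranch (1 + y * Complex.I)‖⁻¹ ≤ (√y)⁻¹ := by gcongr
    have h2 : 1 ≤ (√y)⁻¹ := (one_le_inv₀ hsy).2 hsy1
    rw [one_div (√y)]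
    linarith
  have hm : 1 / (2 * y) / 2 = 1 / (4 * y) := by field_simp; norm_num
  have h1 := abs_im_psum_vertical_le hN hy0
  have h2 := abs_im_asum_vertical_le hN hy0
  rw [← hm] at h1 h2
  have h3 := norm_integral_step_le hβ hadm (m := 1 / (2 * y)) hτ (by positivity : 0 ≤ 1 / √y)
    (h1.trans hd) (by rw [im_vertical]; exact h2.trans hd)
  rw [(hasDerivAt_cfVertical hβ hN τ hy0).deriv]
  unfold cfVertical
  have h4 : ((τ * Complex.I * (1 - 2 / β) / 4 - τ ^ 2 / (2 * β)) / y : ℂ) =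
      -(τ ^ 2 / β * ((1 / (2 * y) : ℝ) : ℂ) - τ * Complex.I * (1 - 2 / β) *
        (((1 / (2 * y) : ℝ) : ℂ) / 2)) := by
    have h5 : (y : ℂ) ≠ 0 := by exact_mod_cast hy0.ne'
    have h6 : (β : ℂ) ≠ 0 := by exact_mod_cast hβ.ne'
    push_cast
    field_simp
    ring
  rw [h4, neg_mul, ← sub_eq_add_neg]
  refine h3.trans ?_
  rw [im_vertical, mul_assoc |τ|]
  refine mul_le_mul_of_nonneg_left ?_ (abs_nonneg τ)
  have h5 : (4 * (N * ‖sqrtBranch (1 + y * Complex.I)‖))⁻¹ * y⁻¹ ^ 2 ≤ η / y ^ 2 := by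
    rw [div_eq_mul_inv, inv_pow]
    refine mul_le_mul_of_nonneg_right ?_ (by positivity)
    rw [inv_le_iff_one_le_mul₀ (mul_pos (by norm_num) (mul_pos hN0 (hsy.trans_le hs)))]
    have h6 : 1 ≤ N * √y * η := by
      refine le_of_sq_le_sq ?_ (by positivity)
      rw [one_pow, mul_pow, mul_pow, Real.sq_sqrt hy0.le, ← hNη]
      have : (N : ℝ) ^ 2 * η ^ 3 = N ^ 2 * η * η ^ 2 := by ring
      rw [this]
      gcongr
    have h7 : N * √y * η ≤ η * (N * ‖sqrtBranch (1 + y * Complex.I)‖) := by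
      rw [mul_comm _ η]; gcongr
    have h8 : 0 ≤ η * (N * ‖sqrtBranch (1 + y * Complex.I)‖) := by positivity
    linarith
  have hK : odeConst β ≤ |odeConst β| := le_abs_self _
  have h9 : 0 ≤ η / y ^ 2 := by positivity
  have h10 : 0 ≤ 1 / √y := by positivity
  have h11 : 0 ≤ 2 * (1 / β + |1 - 2 / β|) := by positivity
  unfold verticalConst
  calc _ ≤ |odeConst β| * (η / y ^ 2) + 2 * (1 / β + |1 - 2 / β|) * (1 / √y) := by gcongr
    _ ≤ _ := by
      have := mul_nonneg (abs_nonneg (odeConst β)) h10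
      have := mul_nonneg h11 h9
      linarith

include hη1

/-- Asymptotics of the characteristic function of the logarithm above the spectral edge. -/
lemma norm_cfVertical_scale_sub_le {τ : ℝ} (hτ : |τ| ≤ 1) :
    ‖Complex.exp (τ * ((1 - 2 / β) / 4 * Real.log η : ℝ) * Complex.I) * cfVertical β N τ η -
      Real.exp (τ ^ 2 / (2 * β) * Real.log η)‖ ≤
    |τ| * (3 * verticalConst β + (farConst β 2 + 1)) := by
  have hN := pos_of_scale hNη
  set γ := τ ^ 2 / (2 * β) with hγ
  have hγ0 : 0 ≤ γ := by positivity
  set a : ℂ := τ * Complex.I * (1 - 2 / β) / 4 - γ with ha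
  have hare : a.re = -γ := by
    have : a = ((τ * (1 - 2 / β) / 4 : ℝ) : ℂ) * Complex.I - γ := by rw [ha]; push_cast; ring
    rw [this]
    simp
  set v : ℝ → ℂ := fun y => Complex.exp (a * Real.log y + γ * Real.log η) * cfVertical β N τ y
    with hv
  have hder : ∀ y, 0 < y → HasDerivAt v (Complex.exp (a * Real.log y + γ * Real.log η) *
      (deriv (cfVertical β N τ) y + a / y * cfVertical β N τ y)) y := fun y hy => by
    have h1 := (((Real.hasDerivAt_log hy.ne').ofReal_comp.const_mul a).add_const
      (γ * Real.log η : ℂ)).cexp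
    have h2 := h1.mul (hasDerivAt_cfVertical hβ hN τ hy).differentiableAt.hasDerivAt
    refine h2.congr_deriv ?_
    push_cast
    ring
  set K := |τ| * verticalConst β with hK
  have hK0 : 0 ≤ K := mul_nonneg (abs_nonneg _) (verticalConst_nonneg hβ)
  have h1 := image_norm_le_of_norm_deriv_right_le_deriv_boundary' (a := η) (b := 1)
    (f := fun y => v y - v η) (f' := fun y => Complex.exp (a * Real.log y + γ * Real.log η) *
      (deriv (cfVertical β N τ) y + a / y * cfVertical β N τ y))
    (B := fun y => K * ((1 - η * y⁻¹) + (2 * √y - 2 * √η)))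
    (B' := fun y => K * (η / y ^ 2 + 1 / √y))
    (fun y hy => ((hder y (hη.trans_le hy.1)).continuousAt.sub
        continuousAt_const).continuousWithinAt)
    (fun y hy => ((hder y (hη.trans_le hy.1)).sub_const _).hasDerivWithinAt)
    (by simp [hη.ne'])
    (fun y hy => ContinuousAt.continuousWithinAt (by
      have : y ≠ 0 := (hη.trans_le hy.1).ne'
      fun_prop (disch := assumption)))
    (fun y hy => by
      have hy0 := hη.trans_le hy.1
      have h2 := ((((hasDerivAt_inv hy0.ne').const_mul η).const_sub 1).fun_add
        (((Real.hasDerivAt_sqrt hy0.ne').const_mul 2).sub_const (2 * √η))).const_mul K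
      refine (h2.congr_deriv ?_).hasDerivWithinAt
      have := Real.sqrt_pos.2 hy0
      field_simp)
    (fun y hy => by
      have hy0 := hη.trans_le hy.1
      rw [norm_mul, Complex.norm_exp]
      have h3 := norm_cfVertical_ode_le hβ hη hNη hτ hy.1 hy.2.le
      refine (mul_le_of_le_one_left (norm_nonneg _) ?_).trans (by
        have h4 : (γ : ℂ) = τ ^ 2 / (2 * β) := by rw [hγ]; push_cast; ring
        rw [ha, h4]; exact h3)
      refine Real.exp_le_one_iff.2 ?_
      rw [Complex.add_re, Complex.re_mul_ofReal, hare, ← Complex.ofReal_mul, Complex.ofReal_re]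
      have := Real.log_le_log hη hy.1
      nlinarith) (x := 1) ⟨hη1, le_rfl⟩
  have h2 := norm_cfVertical_one_sub_one_le hβ hN τ
  have hv1 : v 1 = Real.exp (γ * Real.log η) * cfVertical β N τ 1 := by
    simp [hv]
  have hvη : v η = Complex.exp (τ * ((1 - 2 / β) / 4 * Real.log η : ℝ) * Complex.I) *
      cfVertical β N τ η := by
    simp only [hv, ha]
    congr 2
    push_cast
    ring
  rw [hvη, hv1] at h1
  rw [norm_sub_rev] at h1
  calc _ = ‖(Complex.exp (τ * ((1 - 2 / β) / 4 * Real.log η : ℝ) * Complex.I) *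
        cfVertical β N τ η - Real.exp (γ * Real.log η) * cfVertical β N τ 1) +
        Real.exp (γ * Real.log η) * (cfVertical β N τ 1 - 1)‖ := by congr 1; ring
    _ ≤ K * 3 + 1 * (|τ| * (farConst β 2 + 1)) := by
      refine (norm_add_le _ _).trans (add_le_add (h1.trans ?_) ?_)
      · refine mul_le_mul_of_nonneg_left ?_ hK0
        have := Real.sqrt_nonneg η
        simp only [Real.sqrt_one, inv_one, mul_one]
        linarith
      · rw [norm_mul, Complex.norm_real, Real.norm_eq_abs, abs_of_pos (Real.exp_pos _)]
        refine mul_le_mul ?_ h2 (norm_nonneg _) zero_le_one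
        refine Real.exp_le_one_iff.2 ?_
        exact mul_nonpos_of_nonneg_of_nonpos hγ0 (Real.log_nonpos hη.le hη1)
    _ = _ := by rw [hK]; ring

end verticalFlow


/-- Spectral parameters `a + iη` at the edge scale: `η = N^{-2/3}` and `a` within `O(η)` of `1`. -/
structure EdgeScale (N : ℕ) (η L a : ℝ) : Prop where
  pos : 0 < η
  le_one : η ≤ 1
  scale : (N : ℝ) ^ 2 * η ^ 3 = 1
  nonneg : 0 ≤ L
  abs_sub_le : |a - 1| ≤ L * η
  abs_sub_le_half : |a - 1| ≤ 1 / 2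

/-- Constant in the moment bounds at the edge scale. -/
noncomputable def scaleConst (β L : ℝ) : ℝ :=
  resConst β * (3 * L + 4) + momentConst β * (resConst β + 1) * (3 * L + 4) +
    (distConst β (6 * (L + 1)) + 1) + 1

section scale

variable {β : ℝ} {N : ℕ} {η L a : ℝ} (h : EdgeScale N η L a)
include h

lemma EdgeScale.im_pos : 0 < (a + η * Complex.I : ℂ).im := by simpa using h.pos

omit h in
lemma im_add_mul_I : (a + η * Complex.I : ℂ).im = η := by simp

lemma EdgeScale.card_pos : 0 < N := pos_of_scale h.scale

lemma EdgeScale.admissible :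
    Admissible (6 * (L + 1)) N (a + η * Complex.I) (sqrtBranch (a + η * Complex.I)) :=
  admissible_horizontal h.card_pos h.pos h.nonneg h.abs_sub_le h.abs_sub_le_half h.scale.ge

lemma EdgeScale.norm_sqrtBranch_sq_le :
    ‖sqrtBranch (a + η * Complex.I)‖ ^ 2 ≤ (3 * L + 4) * η := by
  rw [norm_sqrtBranch_sq h.im_pos]
  have hre2 : ((a + η * Complex.I : ℂ) ^ 2 - 1).re = a ^ 2 - η ^ 2 - 1 := by
    simp [sq]
  have him2 : ((a + η * Complex.I : ℂ) ^ 2 - 1).im = 2 * a * η := by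
    simp [sq]; ring
  refine (Complex.norm_le_abs_re_add_abs_im _).trans ?_
  rw [hre2, him2]
  have hη := h.pos
  have hη1 := h.le_one
  have ha1 := (abs_le.1 h.abs_sub_le_half).1
  have ha2 := (abs_le.1 h.abs_sub_le_half).2
  have h1 : |a ^ 2 - η ^ 2 - 1| ≤ 3 * L * η + η := by
    have : a ^ 2 - η ^ 2 - 1 = (a - 1) * (a + 1) - η * η := by ring
    rw [this]
    refine (abs_sub _ _).trans (add_le_add ?_ ?_)
    · rw [abs_mul, abs_of_pos (by linarith : 0 < a + 1)]
      have := mul_le_mul h.abs_sub_le (by linarith : a + 1 ≤ 3) (by linarith)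
        (mul_nonneg h.nonneg hη.le)
      linarith
    · rw [abs_of_pos (by positivity)]
      nlinarith
  have h2 : |2 * a * η| ≤ 3 * η := by
    rw [abs_of_pos (mul_pos (by linarith) hη)]
    nlinarith
  linarith

lemma EdgeScale.sq_le : (N * ‖sqrtBranch (a + η * Complex.I)‖) ^ 2 ≤ (3 * L + 4) * η⁻¹ ^ 2 := by
  have hη := h.pos
  rw [mul_pow]
  calc _ ≤ (N : ℝ) ^ 2 * ((3 * L + 4) * η) := by
        gcongr; exact h.norm_sqrtBranch_sq_le
    _ = (3 * L + 4) * η⁻¹ ^ 2 * ((N : ℝ) ^ 2 * η ^ 3) := by field_simp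
    _ = _ := by rw [h.scale, mul_one]

variable (hβ : 0 < β)
include hβ

omit h in
lemma le_scaleConst (hL : 0 ≤ L) : resConst β * (3 * L + 4) ≤ scaleConst β L ∧
    momentConst β * (resConst β + 1) * (3 * L + 4) ≤ scaleConst β L ∧
    distConst β (6 * (L + 1)) + 1 ≤ scaleConst β L ∧ 1 ≤ scaleConst β L := by
  have h1 := momentConst_pos hβ
  have h2 := resConst_nonneg hβ
  have h3 := distConst_nonneg hβ (6 * (L + 1))
  have h4 : 0 ≤ resConst β * (3 * L + 4) := by positivity
  have h5 : 0 ≤ momentConst β * (resConst β + 1) * (3 * L + 4) := by positivity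
  unfold scaleConst
  refine ⟨?_, ?_, ?_, ?_⟩ <;> linarith

lemma EdgeScale.integral_norm_resG_sq_le :
    ∫ x, ‖resG (N := N) (a + η * Complex.I) x‖ ^ 2 ∂(gbe β N) ≤ scaleConst β L * η⁻¹ ^ 2 := by
  refine (GaussianBeta.integral_norm_resG_sq_le hβ h.admissible).trans ?_
  have := resConst_nonneg hβ
  have := h.pos
  calc _ ≤ resConst β * ((3 * L + 4) * η⁻¹ ^ 2) := by gcongr; exact h.sq_le
    _ = resConst β * (3 * L + 4) * η⁻¹ ^ 2 := by ring
    _ ≤ _ := by gcongr; exact (le_scaleConst hβ h.nonneg).1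

lemma EdgeScale.integral_norm_loopA_sq_le :
    ∫ x, ‖loopA (N := N) β (a + η * Complex.I) x‖ ^ 2 ∂(gbe β N) ≤ scaleConst β L * η⁻¹ ^ 4 := by
  refine (integral_norm_loopA_sq_le_sq hβ h.admissible).trans ?_
  have := resConst_nonneg hβ
  have := momentConst_pos hβ
  have := h.pos
  rw [im_add_mul_I]
  calc _ ≤ momentConst β * (resConst β + 1) * η⁻¹ ^ 2 * ((3 * L + 4) * η⁻¹ ^ 2) := by
        gcongr; exact h.sq_le
    _ = momentConst β * (resConst β + 1) * (3 * L + 4) * η⁻¹ ^ 4 := by ring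
    _ ≤ _ := by gcongr; exact (le_scaleConst hβ h.nonneg).2.1

lemma EdgeScale.integral_dist_le : ∫ x, ‖resG (N := N) (a + η * Complex.I) x +
    2 * N * sqrtBranch (a + η * Complex.I)‖ ∂(gbe β N) ≤ scaleConst β L * η⁻¹ := by
  have h1 := GaussianBeta.integral_dist_le hβ h.admissible
  rw [im_add_mul_I] at h1
  refine h1.trans ?_
  have := h.pos
  gcongr
  exact (le_scaleConst hβ h.nonneg).2.2.1

lemma EdgeScale.mul_integral_norm_resG_le :
    η * ∫ x, ‖resG (N := N) (a + η * Complex.I) x‖ ∂(gbe β N) ≤ scaleConst β L := by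
  have := isProbabilityMeasure_gbe hβ h.card_pos
  have b := (bddCont_resG (N := N) h.im_pos).norm
  have hη := h.pos
  have h1 := integral_le_of_forall_le (μ := gbe β N) b (b.rpow 2) b b (c₁ := η / 2) (c₂ := 0)
    (c₃ := 0) (c := η⁻¹ / 2) fun x => by
      have h2 := sq_nonneg (η * ‖resG (N := N) (a + η * Complex.I) x‖ - 1)
      have h3 : 0 ≤ η⁻¹ * (η * ‖resG (N := N) (a + η * Complex.I) x‖ - 1) ^ 2 := by positivity
      have h4 : η⁻¹ * (η * ‖resG (N := N) (a + η * Complex.I) x‖ - 1) ^ 2 =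
        η * ‖resG (N := N) (a + η * Complex.I) x‖ ^ 2 -
          2 * ‖resG (N := N) (a + η * Complex.I) x‖ + η⁻¹ := by
        field_simp; ring
      linarith
  have h2 := mul_le_mul_of_nonneg_left (h.integral_norm_resG_sq_le hβ)
    (by positivity : 0 ≤ η ^ 2 / 2)
  have h3 := mul_le_mul_of_nonneg_left h1 hη.le
  have h4 := (le_scaleConst hβ h.nonneg).2.2.2
  have h5 : η ^ 2 / 2 * (scaleConst β L * η⁻¹ ^ 2) = scaleConst β L / 2 := by field_simp
  have h6 : η * (η⁻¹ / 2) = 1 / 2 := by field_simp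
  linarith

end scale

/-! ### Absence of points very close to a real edge parameter -/

/-- A bounded test function whose derivative concentrates at scale `ε`. -/
noncomputable def testFun (ε u : ℝ) : ℝ := Real.arctan (u / ε) / (1 + u ^ 2)

/-- The derivative of `testFun`. -/
noncomputable def testDeriv (ε u : ℝ) : ℝ :=
  ε / (ε ^ 2 + u ^ 2) / (1 + u ^ 2) - 2 * u * Real.arctan (u / ε) / (1 + u ^ 2) ^ 2

section test

variable {ε : ℝ} (hε : 0 < ε)
include hε

lemma hasDerivAt_testFun (u : ℝ) : HasDerivAt (testFun ε) (testDeriv ε u) u := by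
  have h1 := ((hasDerivAt_id u).div_const ε).arctan
  have h2 := (hasDerivAt_pow 2 u).const_add 1
  have h3 : (1 + u ^ 2) ≠ 0 := by positivity
  refine (h1.div h2 h3).congr_deriv ?_
  have h4 : ε ^ 2 + u ^ 2 ≠ 0 := by positivity
  unfold testDeriv
  simp only [id]
  field_simp
  push_cast
  ring

omit hε in
lemma abs_arctan_le (u : ℝ) : |Real.arctan u| ≤ 2 := by
  rw [abs_le]
  have := Real.arctan_lt_pi_div_two u
  have := Real.neg_pi_div_two_lt_arctan u
  have := Real.pi_lt_four
  constructor <;> linarith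

omit hε in
lemma abs_testFun_le (u : ℝ) : |testFun ε u| ≤ 2 / (1 + u ^ 2) := by
  have h : (0 : ℝ) < 1 + u ^ 2 := by positivity
  rw [testFun, abs_div, abs_of_pos h]
  gcongr
  exact abs_arctan_le _

omit hε in
lemma abs_testDeriv_add_le (u : ℝ) :
    |testDeriv ε u - ε / (ε ^ 2 + u ^ 2) / (1 + u ^ 2)| ≤ 2 := by
  have h : (0 : ℝ) < 1 + u ^ 2 := by positivity
  rw [testDeriv, sub_sub_cancel_left, abs_neg, abs_div, abs_of_pos (pow_pos h 2),
    div_le_iff₀ (pow_pos h 2), abs_mul, abs_mul, abs_two]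
  have h1 : 2 * |u| ≤ 1 + u ^ 2 := by nlinarith [sq_nonneg (|u| - 1), sq_abs u]
  have := mul_le_mul h1 (abs_arctan_le (u / ε)) (abs_nonneg _) h.le
  nlinarith

lemma abs_testDeriv_le (u : ℝ) : |testDeriv ε u| ≤ 1 / ε + 2 := by
  have h1 := abs_testDeriv_add_le (ε := ε) u
  have h2 : ε / (ε ^ 2 + u ^ 2) / (1 + u ^ 2) ≤ 1 / ε := by
    rw [div_div, div_le_div_iff₀ (by positivity) hε]
    nlinarith [mul_nonneg (sq_nonneg ε) (sq_nonneg u), sq_nonneg u, sq_nonneg (u ^ 2)]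
  have h3 : 0 ≤ ε / (ε ^ 2 + u ^ 2) / (1 + u ^ 2) := by positivity
  rw [abs_le] at h1 ⊢
  constructor <;> linarith

lemma continuous_testDeriv : Continuous (testDeriv ε) := by
  unfold testDeriv
  have h1 : ∀ u : ℝ, ε ^ 2 + u ^ 2 ≠ 0 := fun u => by positivity
  have h2 : ∀ u : ℝ, 1 + u ^ 2 ≠ 0 := fun u => by positivity
  fun_prop (disch := first | assumption | intro; positivity)

end test


/-- The weight detecting points within `ε` of the origin. -/
noncomputable def nearWeight (ε u : ℝ) : ℝ := ε / (ε ^ 2 + u ^ 2) / (1 + u ^ 2) ^ 2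

lemma nearWeight_nonneg {ε : ℝ} (hε : 0 < ε) (u : ℝ) : 0 ≤ nearWeight ε u := by
  unfold nearWeight; positivity

lemma one_le_mul_nearWeight {ε u : ℝ} (hε : 0 < ε) (hε1 : ε ≤ 1) (hu : |u| ≤ ε) :
    1 ≤ 8 * ε * nearWeight ε u := by
  have hu2 : u ^ 2 ≤ ε ^ 2 := sq_le_sq' (neg_le_of_abs_le hu) (le_of_abs_le hu)
  have hu1 : u ^ 2 ≤ 1 := hu2.trans (pow_le_one₀ hε.le hε1)
  unfold nearWeight
  rw [div_div, mul_div_assoc', le_div_iff₀ (by positivity), one_mul]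
  have h1 : ε ^ 2 + u ^ 2 ≤ 2 * ε ^ 2 := by linarith
  have h2 : (1 + u ^ 2) ^ 2 ≤ 4 := by nlinarith [sq_nonneg u]
  calc _ ≤ 2 * ε ^ 2 * 4 := by gcongr
    _ = _ := by ring

lemma nearWeight_le {ε : ℝ} (u : ℝ) :
    nearWeight ε u ≤ testDeriv ε u / (1 + u ^ 2) + 2 / (1 + u ^ 2) := by
  have h : (0 : ℝ) < 1 + u ^ 2 := by positivity
  have h1 := (abs_le.1 (abs_testDeriv_add_le (ε := ε) u)).1
  have h2 : nearWeight ε u = ε / (ε ^ 2 + u ^ 2) / (1 + u ^ 2) / (1 + u ^ 2) := by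
    unfold nearWeight; rw [sq (1 + u ^ 2), ← div_div]
  rw [h2, ← add_div]
  gcongr
  linarith

lemma continuous_nearWeight {ε : ℝ} (hε : 0 < ε) : Continuous (nearWeight ε) := by
  unfold nearWeight
  fun_prop (disch := intro; positivity)

lemma nearWeight_le_inv {ε : ℝ} (hε : 0 < ε) (u : ℝ) : nearWeight ε u ≤ 1 / ε := by
  unfold nearWeight
  rw [div_div, div_le_div_iff₀ (by positivity) hε]
  have : ε ^ 2 * 1 ≤ (ε ^ 2 + u ^ 2) * (1 + u ^ 2) ^ 2 := by
    gcongr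
    · nlinarith [sq_nonneg u]
    · exact one_le_pow₀ (by nlinarith [sq_nonneg u])
  linarith

section near

variable {β : ℝ} {N : ℕ} {η L a : ℝ}

lemma norm_res_add_mul_I_sq (hη : 0 < η) (t : ℝ) :
    ‖res (a + η * Complex.I) t‖ ^ 2 = η⁻¹ ^ 2 * (1 / (1 + ((t - a) / η) ^ 2)) := by
  unfold res
  rw [norm_inv, inv_pow, ← Complex.normSq_eq_norm_sq, Complex.normSq_apply]
  simp
  have h1 : (a - t) * (a - t) + η * η ≠ 0 :=
    (add_pos_of_nonneg_of_pos (mul_self_nonneg _) (by positivity)).ne'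
  have h2 : 1 + ((t - a) / η) ^ 2 ≠ 0 := by positivity
  have h3 : η ^ 2 + (t - a) ^ 2 ≠ 0 := by positivity
  field_simp
  ring

variable (h : EdgeScale N η L a)
include h

lemma EdgeScale.sum_inv_le (x : Fin N → ℝ) :
    ∑ i, 1 / (1 + ((x i - a) / η) ^ 2) ≤ η * ‖resG (N := N) (a + η * Complex.I) x‖ := by
  have hη := h.pos
  have h1 := asum_two_le h.im_pos x
  rw [im_add_mul_I] at h1
  have h2 : asum (N := N) (a + η * Complex.I) 2 x =
      η⁻¹ ^ 2 * ∑ i, 1 / (1 + ((x i - a) / η) ^ 2) := by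
    unfold asum
    rw [Finset.mul_sum]
    exact Finset.sum_congr rfl fun i _ => norm_res_add_mul_I_sq hη _
  have h3 : ∑ i, 1 / (1 + ((x i - a) / η) ^ 2) =
      η ^ 2 * asum (N := N) (a + η * Complex.I) 2 x := by
    rw [h2]; field_simp
  have h4 : (0 : ℝ) ≤ 2 * N := by positivity
  rw [h3]
  calc _ ≤ η ^ 2 * (η⁻¹ * ‖resG (N := N) (a + η * Complex.I) x‖) := by gcongr; linarith
    _ = _ := by field_simp

lemma EdgeScale.integral_sum_nearWeight_le (hβ : 0 < β) {ε : ℝ} (hε : 0 < ε) :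
    ∫ x : Fin N → ℝ, ∑ i, nearWeight ε ((x i - a) / η) ∂(gbe β N) ≤
      (β + 2) * scaleConst β L := by
  have := isProbabilityMeasure_gbe hβ h.card_pos
  have hη := h.pos
  have hz := h.im_pos
  set z : ℂ := a + η * Complex.I with hzdef
  have hcu : ∀ i : Fin N, Continuous fun x : Fin N → ℝ => (x i - a) / η := fun i => by fun_prop
  have bT : BddCont (testFun ε) := ⟨continuous_iff_continuousAt.2 fun u =>
    (hasDerivAt_testFun hε u).continuousAt, 2, fun u => (abs_testFun_le u).trans
      (div_le_self (by norm_num) (by nlinarith [sq_nonneg u]))⟩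
  have bD : BddCont (testDeriv ε) := ⟨continuous_testDeriv hε, _, abs_testDeriv_le hε⟩
  have bW : BddCont (nearWeight ε) := ⟨continuous_nearWeight hε, _, fun u => by
    rw [Real.norm_of_nonneg (nearWeight_nonneg hε u)]; exact nearWeight_le_inv hε u⟩
  have bF : BddCont fun x : Fin N → ℝ => ∑ i, ((testFun ε ((x i - a) / η) : ℝ) : ℂ) :=
    BddCont.sum _ fun i _ => (bT.comp (hcu i)).ofReal
  have bF' : ∀ i : Fin N, BddCont fun x : Fin N → ℝ =>
      ((η⁻¹ * testDeriv ε ((x i - a) / η) : ℝ) : ℂ) := fun i =>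
    ((BddCont.const _).mul (bD.comp (hcu i))).ofReal
  have hd : ∀ t, HasDerivAt (fun t : ℝ => ((testFun ε ((t - a) / η) : ℝ) : ℂ))
      ((η⁻¹ * testDeriv ε ((t - a) / η) : ℝ) : ℂ) t := fun t => by
    refine HasDerivAt.ofReal_comp ?_
    have h1 : HasDerivAt (fun t : ℝ => (t - a) / η) (1 / η) t :=
      ((hasDerivAt_id t).sub_const a).div_const η
    refine ((hasDerivAt_testFun hε _).comp t h1).congr_deriv ?_
    rw [one_div, mul_comm]
  have h1 := loop_one hβ h.card_pos hz bF bF' fun i x => hasLineDerivAt_sum hd x i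
  have bA := bddCont_loopA (N := N) hz β
  have bH : BddCont fun x : Fin N → ℝ => ∑ i, res z (x i) *
      ((η⁻¹ * testDeriv ε ((x i - a) / η) : ℝ) : ℂ) + β / 2 *
      ((∑ i, ((testFun ε ((x i - a) / η) : ℝ) : ℂ)) * loopA β z x) :=
    (BddCont.sum _ fun i _ => (bddCont_res_apply hz i).mul (bF' i)).add
      ((BddCont.const _).mul (bF.mul bA))
  have h2 : ∫ x : Fin N → ℝ, (∑ i, res z (x i) *
      ((η⁻¹ * testDeriv ε ((x i - a) / η) : ℝ) : ℂ) + β / 2 *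
      ((∑ i, ((testFun ε ((x i - a) / η) : ℝ) : ℂ)) * loopA β z x)).im ∂(gbe β N) = 0 := by
    have := integral_im (bH.integrable (gbe β N))
    rw [h1] at this
    simpa only [RCLike.im_to_complex, Complex.zero_im] using this
  have bS : BddCont fun x : Fin N → ℝ => ∑ i, nearWeight ε ((x i - a) / η) :=
    BddCont.sum _ fun i _ => bW.comp (hcu i)
  have bG := (bddCont_resG (N := N) hz).norm
  have h3 := integral_le_of_forall_le (μ := gbe β N)
    (bS.add ((BddCont.const (η ^ 2)).mul bH.im)) (bG.rpow 2) (bA.norm.rpow 2) bG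
    (c₁ := β / 2 * η ^ 2) (c₂ := β / 2 * η ^ 4) (c₃ := 2 * η) (c := 0) fun x => by
      have hs := h.sum_inv_le x
      rw [← hzdef] at hs
      have e1 : (∑ i, res z (x i) * ((η⁻¹ * testDeriv ε ((x i - a) / η) : ℝ) : ℂ)).im =
          -(η⁻¹ ^ 2 * ∑ i, testDeriv ε ((x i - a) / η) / (1 + ((x i - a) / η) ^ 2)) := by
        rw [Complex.im_sum, Finset.mul_sum, ← Finset.sum_neg_distrib]
        refine Finset.sum_congr rfl fun i _ => ?_
        rw [Complex.im_mul_ofReal, im_res, norm_res_add_mul_I_sq hη, hzdef, im_add_mul_I]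
        field_simp
      have e2 : ((β / 2 : ℂ) * ((∑ i, ((testFun ε ((x i - a) / η) : ℝ) : ℂ)) *
          loopA β z x)).im = β / 2 * ((∑ i, testFun ε ((x i - a) / η)) * (loopA β z x).im) := by
        have : (β / 2 : ℂ) * ((∑ i, ((testFun ε ((x i - a) / η) : ℝ) : ℂ)) * loopA β z x) =
            ((β / 2 * (∑ i, testFun ε ((x i - a) / η)) : ℝ) : ℂ) * loopA β z x := by
          push_cast; ring
        rw [this, Complex.im_ofReal_mul]; ring
      have e3 : ∑ i, nearWeight ε ((x i - a) / η) ≤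
          ∑ i, testDeriv ε ((x i - a) / η) / (1 + ((x i - a) / η) ^ 2) +
            2 * ∑ i, 1 / (1 + ((x i - a) / η) ^ 2) := by
        rw [Finset.mul_sum, ← Finset.sum_add_distrib]
        refine Finset.sum_le_sum fun i _ => (nearWeight_le _).trans_eq ?_
        ring
      have e4 : |∑ i, testFun ε ((x i - a) / η)| ≤ 2 * (η * ‖resG z x‖) := by
        refine (Finset.abs_sum_le_sum_abs _ _).trans ?_
        calc _ ≤ ∑ i, 2 * (1 / (1 + ((x i - a) / η) ^ 2)) :=
              Finset.sum_le_sum fun i _ => (abs_testFun_le _).trans_eq (by ring)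
          _ ≤ _ := by rw [← Finset.mul_sum]; gcongr
      have e5 : (∑ i, testFun ε ((x i - a) / η)) * (loopA β z x).im ≤
          2 * (η * ‖resG z x‖) * ‖loopA β z x‖ := by
        refine (le_abs_self _).trans ?_
        rw [abs_mul]
        exact mul_le_mul e4 (Complex.abs_im_le_norm _) (abs_nonneg _) (by positivity)
      have e6 : η ^ 2 * (2 * (η * ‖resG z x‖) * ‖loopA β z x‖) ≤
          η ^ 2 * ‖resG z x‖ ^ 2 + η ^ 4 * ‖loopA β z x‖ ^ 2 := by
        nlinarith [sq_nonneg (η * ‖resG z x‖ - η ^ 2 * ‖loopA β z x‖)]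
      have e7 := mul_le_mul_of_nonneg_left
        ((mul_le_mul_of_nonneg_left e5 (sq_nonneg η)).trans e6) (by positivity : 0 ≤ β / 2)
      rw [Complex.add_im, e1, e2, mul_add, mul_neg, ← mul_assoc, ← mul_pow,
        mul_inv_cancel₀ hη.ne', one_pow, one_mul]
      linarith
  rw [integral_add (bS.integrable _) (((BddCont.const _).mul bH.im).integrable _),
    integral_const_mul, h2, mul_zero, add_zero] at h3
  refine h3.trans ?_
  have i1 := mul_le_mul_of_nonneg_left (h.integral_norm_resG_sq_le hβ)
    (by positivity : 0 ≤ β / 2 * η ^ 2)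
  have i2 := mul_le_mul_of_nonneg_left (h.integral_norm_loopA_sq_le hβ)
    (by positivity : 0 ≤ β / 2 * η ^ 4)
  have i3 := h.mul_integral_norm_resG_le hβ
  rw [← hzdef] at i1 i2 i3
  have j1 : β / 2 * η ^ 2 * (scaleConst β L * η⁻¹ ^ 2) = β / 2 * scaleConst β L := by field_simp
  have j2 : β / 2 * η ^ 4 * (scaleConst β L * η⁻¹ ^ 4) = β / 2 * scaleConst β L := by field_simp
  linarith

end near


/-- A bounded smooth function comparable with `min 1 (u ^ 2)`. -/
noncomputable def bump (u : ℝ) : ℝ := u ^ 2 / (1 + u ^ 2)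

lemma bump_nonneg (u : ℝ) : 0 ≤ bump u := by unfold bump; positivity

lemma bump_le_one (u : ℝ) : bump u ≤ 1 := by
  unfold bump
  rw [div_le_one (by positivity)]
  linarith

lemma hasDerivAt_bump (u : ℝ) : HasDerivAt bump (2 * u / (1 + u ^ 2) ^ 2) u := by
  have h := (hasDerivAt_pow 2 u).div ((hasDerivAt_pow 2 u).const_add 1)
    (by positivity : 1 + u ^ 2 ≠ 0)
  refine h.congr_deriv ?_
  congr 1
  push_cast
  ring

lemma continuous_bump : Continuous bump :=
  continuous_iff_continuousAt.2 fun u => (hasDerivAt_bump u).continuousAt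

lemma abs_deriv_bump_le (u : ℝ) : |2 * u / (1 + u ^ 2) ^ 2| ≤ 1 := by
  have h : (0 : ℝ) < 1 + u ^ 2 := by positivity
  rw [abs_div, abs_of_pos (pow_pos h 2), div_le_one (pow_pos h 2), abs_mul, abs_two]
  have h1 : 2 * |u| ≤ 1 + u ^ 2 := by nlinarith [sq_nonneg (|u| - 1), sq_abs u]
  nlinarith [sq_nonneg u]

lemma min_one_abs_le {ε u : ℝ} (hε : 0 < ε) (hε1 : ε ≤ 1) : min 1 |u| ≤ ε + 2 / ε * bump u := by
  have hb := bump_nonneg u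
  rcases le_total |u| ε with h | h
  · exact (min_le_right _ _).trans (h.trans (by linarith [mul_nonneg (by positivity : 0 ≤ 2 / ε) hb]))
  · have h1 : min 1 |u| * (ε * (1 + u ^ 2)) ≤ 2 * u ^ 2 := by
      rw [← sq_abs u]
      have hu := hε.trans_le h
      rcases le_total |u| 1 with h2 | h2
      · rw [min_eq_right h2]
        nlinarith [mul_le_mul_of_nonneg_left h hu.le, sq_nonneg |u|,
          mul_le_mul h (pow_le_one₀ hu.le h2 : |u| ^ 2 ≤ 1) (by positivity) hu.le]
      · rw [min_eq_left h2]
        nlinarith [mul_le_mul_of_nonneg_right hε1 (sq_nonneg |u|)]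
    have h2 : min 1 |u| ≤ 2 / ε * bump u := by
      unfold bump
      rw [div_mul_div_comm, le_div_iff₀ (by positivity)]
      exact h1
    linarith

section horizontal

variable {β : ℝ} {N : ℕ} {η L a : ℝ} (h : EdgeScale N η L a)
include h

lemma EdgeScale.segment {t : ℝ} (ht : t ∈ Set.Icc (0 : ℝ) 1) :
    EdgeScale N η L (1 + t * (a - 1)) where
  pos := h.pos
  le_one := h.le_one
  scale := h.scale
  nonneg := h.nonneg
  abs_sub_le := by
    rw [add_sub_cancel_left, abs_mul, abs_of_nonneg ht.1]
    exact (mul_le_of_le_one_left (abs_nonneg _) ht.2).trans h.abs_sub_le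
  abs_sub_le_half := by
    rw [add_sub_cancel_left, abs_mul, abs_of_nonneg ht.1]
    exact (mul_le_of_le_one_left (abs_nonneg _) ht.2).trans h.abs_sub_le_half

lemma EdgeScale.integral_bump_le (hβ : 0 < β) {c : ℝ} (hc : 0 ≤ c) :
    ∫ x : Fin N → ℝ, bump (c * (logD (a + η * Complex.I) x - logD (1 + η * Complex.I) x))
      ∂(gbe β N) ≤ c * (L * scaleConst β L) := by
  have := isProbabilityMeasure_gbe hβ h.card_pos
  have hη := h.pos
  have hpt : ∀ t : ℝ, (1 + η * Complex.I + t * ((a - 1 : ℝ) : ℂ) : ℂ) =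
      ((1 + t * (a - 1) : ℝ) : ℂ) + η * Complex.I := fun t => by push_cast; ring
  have hd : ∀ t ∈ Set.Icc (0 : ℝ) 1, _ := fun t ht =>
    hasDerivAt_integral_logD (N := N) hβ h.card_pos
      (Φ := fun u => (bump u : ℂ)) (Φ' := fun u => ((2 * u / (1 + u ^ 2) ^ 2 : ℝ) : ℂ))
      (fun u => (hasDerivAt_bump u).ofReal_comp)
      (Complex.continuous_ofReal.comp (by fun_prop (disch := intro; positivity)))
      (C := 1) (C' := 1)
      (fun u => by
        rw [Complex.norm_real, Real.norm_of_nonneg (bump_nonneg u)]; exact bump_le_one u)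
      (fun u => by rw [Complex.norm_real]; exact abs_deriv_bump_le u)
      (z₀ := 1 + η * Complex.I) (v := ((a - 1 : ℝ) : ℂ)) (t₀ := t) (c := c)
      (by rw [hpt]; exact (h.segment ht).im_pos)
      (B := logD (1 + η * Complex.I)) (continuous_logD (by simpa using hη))
  have hb : ∀ t ∈ Set.Ico (0 : ℝ) 1, ‖∫ x : Fin N → ℝ, ((c * (((a - 1 : ℝ) : ℂ) *
      (resG (1 + η * Complex.I + t * ((a - 1 : ℝ) : ℂ)) x + 2 * N *
        sqrtBranch (1 + η * Complex.I + t * ((a - 1 : ℝ) : ℂ)))).re : ℝ) : ℂ) *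
      (((fun u : ℝ => 2 * u / (1 + u ^ 2) ^ 2) (c *
        (logD (1 + η * Complex.I + t * ((a - 1 : ℝ) : ℂ)) x - logD (1 + η * Complex.I) x)) : ℝ) : ℂ)
      ∂(gbe β N)‖ ≤ c * (L * scaleConst β L) := fun t ht => by
    have hs := h.segment ⟨ht.1, ht.2.le⟩
    rw [hpt]
    have hi := hs.integral_dist_le hβ
    have bd := ((bddCont_resG (N := N) hs.im_pos).add (BddCont.const
      (2 * N * sqrtBranch (((1 + t * (a - 1) : ℝ) : ℂ) + η * Complex.I)))).norm
    refine (norm_integral_le_of_norm_le ((((BddCont.const (c * |a - 1|)).mul bd)).integrable _)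
      (Eventually.of_forall fun x => ?_)).trans (b := ∫ x : Fin N → ℝ, (c * |a - 1|) *
        ‖resG (((1 + t * (a - 1) : ℝ) : ℂ) + η * Complex.I) x + 2 * N *
          sqrtBranch (((1 + t * (a - 1) : ℝ) : ℂ) + η * Complex.I)‖ ∂(gbe β N)) ?_
    · rw [norm_mul, Complex.norm_real, Complex.norm_real, Complex.re_ofReal_mul, norm_mul, norm_mul,
        Real.norm_of_nonneg hc, Real.norm_eq_abs (a - 1), Real.norm_eq_abs, Real.norm_eq_abs,
        ← mul_assoc]
      refine (mul_le_of_le_one_right (by positivity) (abs_deriv_bump_le _)).trans ?_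
      gcongr
      exact Complex.abs_re_le_norm _
    · rw [integral_const_mul, mul_assoc]
      refine mul_le_mul_of_nonneg_left ?_ hc
      refine (mul_le_mul h.abs_sub_le hi (integral_nonneg fun x => norm_nonneg _)
        (mul_nonneg h.nonneg hη.le)).trans_eq ?_
      field_simp
  have h1 := norm_image_sub_le_of_norm_deriv_le_segment_01'
    (fun t ht => (hd t ht).hasDerivWithinAt) hb
  have h0 : bump 0 = 0 := by simp [bump]
  have e1 : (1 + η * Complex.I + ((1 : ℝ) : ℂ) * ((a - 1 : ℝ) : ℂ) : ℂ) = a + η * Complex.I := by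
    push_cast; ring
  have e0 : (1 + η * Complex.I + ((0 : ℝ) : ℂ) * ((a - 1 : ℝ) : ℂ) : ℂ) = 1 + η * Complex.I := by
    push_cast; ring
  rw [e0, e1] at h1
  simp only [sub_self, mul_zero, h0, Complex.ofReal_zero, integral_zero, sub_zero] at h1
  rw [integral_complex_ofReal, Complex.norm_real] at h1
  exact (le_abs_self _).trans h1

end horizontal


/-! ### The deterministic normalisation -/

lemma norm_log_add_sub_mul_le {z s : ℂ} (hz : s ^ 2 = z ^ 2 - 1) (hz1 : 1 ≤ ‖z + 1‖)
    (hs : ‖s‖ ≤ 1 / 4) : ‖Complex.log (z + s) - z * s‖ ≤ 9 * ‖s‖ ^ 3 := by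
  have hz0 : z + 1 ≠ 0 := norm_pos_iff.1 (by linarith)
  have hn := norm_nonneg s
  have hw : ‖z - 1‖ ≤ ‖s‖ ^ 2 := by
    have h1 : ‖s‖ ^ 2 = ‖z - 1‖ * ‖z + 1‖ := by
      rw [← norm_pow, hz, ← norm_mul]; ring_nf
    rw [h1]
    exact le_mul_of_one_le_right (norm_nonneg _) hz1
  set u := s + (z - 1) with hu
  have hu1 : ‖u‖ ≤ 2 * ‖s‖ := by
    refine (norm_add_le _ _).trans ?_
    nlinarith
  have hu2 : ‖u‖ ≤ 1 / 2 := by linarith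
  have h1 := Complex.norm_log_sub_logTaylor_le 2 (lt_of_le_of_lt hu2 (by norm_num))
  have h2 : Complex.logTaylor (2 + 1) u = u - u ^ 2 / 2 := by
    simp only [Complex.logTaylor_succ, Complex.logTaylor_zero]
    norm_num
    ring
  have h3 : ‖u‖ ^ (2 + 1) * (1 - ‖u‖)⁻¹ / ((2 : ℕ) + 1) ≤ 6 * ‖s‖ ^ 3 := by
    have : (1 - ‖u‖)⁻¹ ≤ 2 := by
      rw [inv_le_comm₀ (by linarith) (by norm_num)]; linarith
    have h4 : 0 < 1 - ‖u‖ := by linarith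
    calc _ ≤ (2 * ‖s‖) ^ (2 + 1) * 2 / ((2 : ℕ) + 1) := by gcongr
      _ ≤ _ := by push_cast; nlinarith [pow_nonneg hn 3]
  have h4 : Complex.log (z + s) - z * s =
      (Complex.log (1 + u) - Complex.logTaylor (2 + 1) u) + (-(z - 1) ^ 2 - 2 * s * (z - 1)) := by
    rw [h2, hu]
    have : 1 + (s + (z - 1)) = z + s := by ring
    rw [this]
    linear_combination (-1 / 2 : ℂ) * hz
  rw [h4]
  refine (norm_add_le _ _).trans ?_
  have h5 : ‖-(z - 1) ^ 2 - 2 * s * (z - 1)‖ ≤ 3 * ‖s‖ ^ 3 := by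
    refine (norm_sub_le _ _).trans ?_
    rw [norm_neg, norm_pow, norm_mul, norm_mul, Complex.norm_two]
    calc ‖z - 1‖ ^ 2 + 2 * ‖s‖ * ‖z - 1‖ ≤ (‖s‖ ^ 2) ^ 2 + 2 * ‖s‖ * ‖s‖ ^ 2 := by gcongr
      _ ≤ _ := by nlinarith [pow_nonneg hn 3]
  linarith [h1.trans h3]

lemma exists_abs_log_factorial_sub_le : ∃ C : ℝ, ∀ N : ℕ, 0 < N →
    |Real.log N.factorial - (N * Real.log N - N + Real.log N / 2)| ≤ C := by
  have h1 : Tendsto (fun n => |Real.log (Stirling.stirlingSeq n)|) atTop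
      (𝓝 |Real.log √Real.pi|) :=
    ((Real.continuousAt_log (by positivity)).tendsto.comp
      Stirling.tendsto_stirlingSeq_sqrt_pi).abs
  obtain ⟨C, hC⟩ := h1.bddAbove_range
  refine ⟨C + Real.log 2, fun N hN => ?_⟩
  have h2 : |Real.log (Stirling.stirlingSeq N)| ≤ C := hC ⟨N, rfl⟩
  have hN0 : (0 : ℝ) < N := by exact_mod_cast hN
  rw [Stirling.log_stirlingSeq_formula, Real.log_div hN0.ne' (Real.exp_pos 1).ne', Real.log_exp,
    Real.log_mul two_ne_zero hN0.ne'] at h2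
  have h3 := Real.log_pos one_lt_two
  rw [abs_le] at h2 ⊢
  constructor <;> linarith [h2.1, h2.2]

/-- Constant in the Stirling bound for `log N!`. -/
noncomputable def stirlingConst : ℝ := exists_abs_log_factorial_sub_le.choose

lemma log_wN {N : ℕ} (hN : 0 < N) {a : ℝ} (ha : 0 < a) :
    Real.log (wN N a) = -(Real.log (2 * Real.pi) / 4 + N * a ^ 2 - N * Real.log 2 -
      (Real.log N + 2 * Real.log a) / 12 + (Real.log N.factorial - N * Real.log N) / 2) := by
  have hN0 : (0 : ℝ) < N := by exact_mod_cast hN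
  have hf : (0 : ℝ) < N.factorial := by exact_mod_cast N.factorial_pos
  unfold wN
  rw [Real.log_inv, Real.log_mul (by positivity) (by positivity),
    Real.log_mul (by positivity) (by positivity), Real.log_mul (by positivity) (by positivity),
    Real.log_mul (by positivity) (by positivity), Real.log_rpow (by positivity), Real.log_exp,
    Real.log_rpow (by positivity), Real.log_rpow (by positivity), Real.log_sqrt (by positivity),
    Real.log_div hf.ne' (by positivity), Real.log_pow, Real.log_mul hN0.ne' (by positivity),
    Real.log_pow]
  push_cast
  ring

lemma wN_pos {N : ℕ} (hN : 0 < N) {a : ℝ} (ha : 0 < a) : 0 < wN N a := by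
  have hN0 : (0 : ℝ) < N := by exact_mod_cast hN
  have hf : (0 : ℝ) < N.factorial := by exact_mod_cast N.factorial_pos
  unfold wN
  positivity

/-- Constant bounding the deterministic correction. -/
noncomputable def bracketConst (L : ℝ) : ℝ :=
  |Real.log (2 * Real.pi)| + stirlingConst + 9 * (3 * L + 4) ^ 2 + 2

section bracket

variable {N : ℕ} {η L a : ℝ} (h : EdgeScale N η L a)
include h

lemma EdgeScale.pos_param : 0 < a := by
  have := (abs_le.1 h.abs_sub_le_half).1
  linarith

lemma EdgeScale.abs_bracket_le (hη : (3 * L + 4) * η ≤ 1 / 16) :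
    |Real.log (wN N a) + N * (potential (a + η * Complex.I)).re + Real.log N / 6| ≤
      bracketConst L := by
  have hN := h.card_pos
  have hN0 : (0 : ℝ) < N := by exact_mod_cast hN
  have hη0 := h.pos
  have hL := h.nonneg
  have ha := h.pos_param
  have ha1 := (abs_le.1 h.abs_sub_le_half).1
  have ha2 := (abs_le.1 h.abs_sub_le_half).2
  set z : ℂ := a + η * Complex.I with hz
  have hs := h.norm_sqrtBranch_sq_le
  rw [← hz] at hs
  have hs1 : ‖sqrtBranch z‖ ≤ 1 / 4 :=
    abs_le_of_sq_le_sq' (by nlinarith) (by norm_num) |>.2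
  have h1 : 1 ≤ ‖z + 1‖ := by
    have := (le_abs_self _).trans (Complex.abs_re_le_norm (z + 1))
    have h2 : (z + 1).re = a + 1 := by simp [hz]
    linarith
  have h2 := norm_log_add_sub_mul_le (sqrtBranch_sq h.im_pos) h1 hs1
  have h3 : N * ‖sqrtBranch z‖ ^ 3 ≤ (3 * L + 4) ^ 2 := by
    refine abs_le_of_sq_le_sq' ?_ (by positivity) |>.2
    calc (N * ‖sqrtBranch z‖ ^ 3) ^ 2 = (N : ℝ) ^ 2 * (‖sqrtBranch z‖ ^ 2) ^ 3 := by ring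
      _ ≤ (N : ℝ) ^ 2 * ((3 * L + 4) * η) ^ 3 := by gcongr
      _ = (3 * L + 4) ^ 3 * ((N : ℝ) ^ 2 * η ^ 3) := by ring
      _ = (3 * L + 4) ^ 3 := by rw [h.scale, mul_one]
      _ ≤ (3 * L + 4) ^ 4 := pow_le_pow_right₀ (by linarith) (by norm_num)
      _ = _ := by ring
  have h4 : |N * (Complex.log (z + sqrtBranch z) - z * sqrtBranch z).re| ≤
      9 * (3 * L + 4) ^ 2 := by
    rw [abs_mul, abs_of_pos hN0]
    have := (Complex.abs_re_le_norm _).trans h2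
    nlinarith [mul_le_mul_of_nonneg_left this hN0.le]
  have h5 : N * η ^ 2 ≤ 1 := by
    refine abs_le_of_sq_le_sq' ?_ (by positivity) |>.2
    calc (N * η ^ 2) ^ 2 = (N : ℝ) ^ 2 * η ^ 3 * η := by ring
      _ ≤ 1 ^ 2 := by rw [h.scale]; linarith [h.le_one]
  have h6 : |Real.log a| ≤ 1 := by
    rw [abs_le]
    have l1 := Real.log_le_sub_one_of_pos ha
    have l2 := Real.one_sub_inv_le_log_of_pos ha
    have l3 : a⁻¹ ≤ 2 := by
      rw [inv_le_comm₀ ha (by norm_num)]; linarith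
    constructor <;> linarith
  have h7 : |Real.log N.factorial - (N * Real.log N - N + Real.log N / 2)| ≤ stirlingConst :=
    exists_abs_log_factorial_sub_le.choose_spec N hN
  have h8 : (potential z).re = a ^ 2 - η ^ 2 +
      (Complex.log (z + sqrtBranch z) - z * sqrtBranch z).re - 1 / 2 - Real.log 2 := by
    have e1 : potential z = z ^ 2 + (Complex.log (z + sqrtBranch z) - z * sqrtBranch z) -
        ((1 / 2 + Real.log 2 : ℝ) : ℂ) := by
      unfold potential; push_cast; ring
    have e2 : (z ^ 2).re = a ^ 2 - η ^ 2 := by simp [hz, sq]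
    rw [e1, Complex.sub_re, Complex.add_re, e2, Complex.ofReal_re]
    ring
  rw [log_wN hN ha, h8]
  have h9 := neg_abs_le (Real.log (2 * Real.pi))
  have h10 := le_abs_self (Real.log (2 * Real.pi))
  have h11 : 0 ≤ N * η ^ 2 := by positivity
  unfold bracketConst
  rw [abs_le] at h4 h6 h7 ⊢
  obtain ⟨h4, h4'⟩ := h4
  obtain ⟨h6, h6'⟩ := h6
  obtain ⟨h7, h7'⟩ := h7
  constructor <;> nlinarith

end bracket


lemma re_log_add_mul_I {a η t : ℝ} (hη : 0 < η) (ht : t ≠ a) :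
    (Complex.log (a + η * Complex.I - t)).re =
      Real.log |a - t| + Real.log (1 + 1 / ((t - a) / η) ^ 2) / 2 := by
  have h0 : a - t ≠ 0 := sub_ne_zero.2 ht.symm
  have h0' : t - a ≠ 0 := sub_ne_zero.2 ht
  have h1 : ‖(a + η * Complex.I - t : ℂ)‖ ^ 2 = |a - t| ^ 2 * (1 + 1 / ((t - a) / η) ^ 2) := by
    rw [← Complex.normSq_eq_norm_sq, Complex.normSq_apply, sq_abs]
    simp
    field_simp
    ring
  have h2 := congrArg Real.log h1
  rw [Real.log_pow, Real.log_mul (by positivity) (by positivity), Real.log_pow] at h2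
  rw [Complex.log_re]
  push_cast at h2
  linarith

/-- The limiting variable, evaluated at distance `η` above the edge. -/
noncomputable def edgeVar (β : ℝ) (N : ℕ) (η : ℝ) (x : Fin N → ℝ) : ℝ :=
  (√(2 / (3 * β) * Real.log N))⁻¹ *
    (logD (1 + η * Complex.I) x + (1 - 2 / β) / 4 * Real.log η)

section comparison

variable {β : ℝ} {N : ℕ} {η L a : ℝ} (h : EdgeScale N η L a)
include h

lemma EdgeScale.abs_logD_sub_le {ε : ℝ} (hε : 0 < ε) {x : Fin N → ℝ}
    (hx : ∀ i, ε < |(x i - a) / η|) :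
    |logD (a + η * Complex.I) x - (Real.log |∏ i, (a - x i)| -
      N * (potential (a + η * Complex.I)).re)| ≤
      (1 + 1 / ε ^ 2) / 2 * (η * ‖resG (a + η * Complex.I) x‖) := by
  have hη := h.pos
  have hne : ∀ i, x i ≠ a := fun i hi => by
    have := hx i
    rw [hi, sub_self, zero_div, abs_zero] at this
    linarith
  have h1 : logD (a + η * Complex.I) x - (Real.log |∏ i, (a - x i)| -
      N * (potential (a + η * Complex.I)).re) =
      ∑ i, Real.log (1 + 1 / ((x i - a) / η) ^ 2) / 2 := by
    unfold logD
    rw [Complex.sub_re, Complex.re_sum, ← Complex.ofReal_natCast, Complex.re_ofReal_mul, Finset.abs_prod,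
      Real.log_prod fun i _ => abs_ne_zero.2 (sub_ne_zero.2 (hne i).symm), sub_sub_sub_cancel_right,
      ← Finset.sum_sub_distrib]
    refine Finset.sum_congr rfl fun i _ => ?_
    rw [re_log_add_mul_I hη (hne i), add_sub_cancel_left]
  rw [h1]
  refine (Finset.abs_sum_le_sum_abs _ _).trans ?_
  refine le_trans ?_ (mul_le_mul_of_nonneg_left (h.sum_inv_le x) (by positivity))
  rw [Finset.mul_sum]
  refine Finset.sum_le_sum fun i _ => ?_
  set u := (x i - a) / η
  have hu : ε ^ 2 ≤ u ^ 2 := by rw [← sq_abs u]; exact pow_le_pow_left₀ hε.le (hx i).le 2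
  have hu0 : 0 < u ^ 2 := lt_of_lt_of_le (by positivity) hu
  have h2 : 0 ≤ Real.log (1 + 1 / u ^ 2) := Real.log_nonneg (by
    have : 0 ≤ 1 / u ^ 2 := by positivity
    linarith)
  have h3 := Real.log_le_sub_one_of_pos (by positivity : 0 < 1 + 1 / u ^ 2)
  have h4 : 1 / u ^ 2 ≤ (1 + 1 / ε ^ 2) * (1 / (1 + u ^ 2)) := by
    rw [mul_one_div, div_le_div_iff₀ hu0 (by positivity)]
    have : 1 ≤ 1 / ε ^ 2 * u ^ 2 := by
      rw [one_div_mul_eq_div, one_le_div (by positivity)]; exact hu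
    linarith
  rw [abs_of_nonneg (by linarith)]
  linarith

lemma EdgeScale.log_eq : Real.log η = -(2 / 3) * Real.log N := by
  have hN0 : (0 : ℝ) < N := by exact_mod_cast h.card_pos
  have hη := h.pos
  have h1 := congrArg Real.log h.scale
  rw [Real.log_mul (by positivity) (by positivity), Real.log_pow, Real.log_pow, Real.log_one] at h1
  push_cast at h1
  linarith

lemma EdgeScale.min_one_abs_sub_le (hη : (3 * L + 4) * η ≤ 1 / 16) {lam : ℝ} (ha : zpt N lam = a)
    {ε : ℝ} (hε : 0 < ε) (hε1 : ε ≤ 1) {σ : ℝ} (hσ : σ = √(2 / (3 * β) * Real.log N))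
    (hσ0 : 0 < σ) (x : Fin N → ℝ) :
    min 1 |cltVar β N lam x - edgeVar β N η x| ≤
      8 * ε * ∑ i, nearWeight ε ((x i - a) / η) + (ε + 2 / ε *
        bump (σ⁻¹ * (logD (a + η * Complex.I) x - logD (1 + η * Complex.I) x))) +
        σ⁻¹ * ((1 + 1 / ε ^ 2) / 2 * (η * ‖resG (a + η * Complex.I) x‖)) +
        σ⁻¹ * bracketConst L := by
  have hη0 := h.pos
  have hb := h.abs_bracket_le hη
  have hb0 := (abs_nonneg _).trans hb
  have hbump := bump_nonneg (σ⁻¹ * (logD (a + η * Complex.I) x - logD (1 + η * Complex.I) x))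
  have hsum : 0 ≤ ∑ i, nearWeight ε ((x i - a) / η) :=
    Finset.sum_nonneg fun i _ => nearWeight_nonneg hε _
  have t1 : 0 ≤ 8 * ε * ∑ i, nearWeight ε ((x i - a) / η) := by positivity
  have t2 : 0 ≤ ε + 2 / ε *
        bump (σ⁻¹ * (logD (a + η * Complex.I) x - logD (1 + η * Complex.I) x)) := by positivity
  have t3 : 0 ≤ σ⁻¹ * ((1 + 1 / ε ^ 2) / 2 * (η * ‖resG (a + η * Complex.I) x‖)) := by positivity
  have t4 : 0 ≤ σ⁻¹ * bracketConst L := by positivity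
  by_cases hx : ∀ i, ε < |(x i - a) / η|
  · have h1 := h.abs_logD_sub_le hε hx
    have hne : ∏ i, (a - x i) ≠ 0 := Finset.prod_ne_zero_iff.2 fun i _ hi => by
      have := hx i
      rw [← sub_eq_zero.1 hi, sub_self, zero_div, abs_zero] at this
      linarith
    have h2 : Real.log |PsiN N lam x| = Real.log (wN N a) + Real.log |∏ i, (a - x i)| := by
      have hw := wN_pos h.card_pos h.pos_param
      unfold PsiN
      rw [ha, abs_mul, abs_of_pos hw, Real.log_mul hw.ne' (abs_ne_zero.2 hne)]
    have h3 : cltVar β N lam x - edgeVar β N η x =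
        σ⁻¹ * (logD (a + η * Complex.I) x - logD (1 + η * Complex.I) x) +
        (-(σ⁻¹ * (logD (a + η * Complex.I) x - (Real.log |∏ i, (a - x i)| -
          N * (potential (a + η * Complex.I)).re))) +
        σ⁻¹ * (Real.log (wN N a) + N * (potential (a + η * Complex.I)).re + Real.log N / 6)) := by
      unfold cltVar edgeVar
      rw [h2, ← hσ, h.log_eq]
      rw [← one_div_mul_one_div]
      ring
    have h4 : ∀ A B : ℝ, min 1 |A + B| ≤ min 1 |A| + |B| := fun A B => by
      have := abs_add_le A B
      rcases le_total 1 |A| with hA | hA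
      · rw [min_eq_left hA]
        exact (min_le_left _ _).trans (by linarith [abs_nonneg B])
      · rw [min_eq_right hA]
        exact (min_le_right _ _).trans this
    rw [h3]
    refine (h4 _ _).trans ?_
    have h5 := min_one_abs_le (u := σ⁻¹ *
      (logD (a + η * Complex.I) x - logD (1 + η * Complex.I) x)) hε hε1
    have h6 := abs_add_le (-(σ⁻¹ * (logD (a + η * Complex.I) x - (Real.log |∏ i, (a - x i)| -
          N * (potential (a + η * Complex.I)).re))))
        (σ⁻¹ * (Real.log (wN N a) + N * (potential (a + η * Complex.I)).re + Real.log N / 6))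
    rw [abs_neg, abs_mul, abs_mul, abs_of_pos (inv_pos.2 hσ0)] at h6
    have h7 := mul_le_mul_of_nonneg_left h1 (inv_pos.2 hσ0).le
    have h8 := mul_le_mul_of_nonneg_left hb (inv_pos.2 hσ0).le
    linarith
  · push Not at hx
    obtain ⟨i, hi⟩ := hx
    have h1 := one_le_mul_nearWeight hε hε1 hi
    have h2 := Finset.single_le_sum (f := fun i => nearWeight ε ((x i - a) / η))
      (fun i _ => nearWeight_nonneg hε _) (Finset.mem_univ i)
    have h3 := mul_le_mul_of_nonneg_left h2 (by positivity : 0 ≤ 8 * ε)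
    exact (min_le_left _ _).trans (by linarith)

lemma EdgeScale.integral_min_one_abs_sub_le (hβ : 0 < β) (hη : (3 * L + 4) * η ≤ 1 / 16)
    {lam : ℝ} (ha : zpt N lam = a) {ε : ℝ} (hε : 0 < ε) (hε1 : ε ≤ 1) {σ : ℝ}
    (hσ : σ = √(2 / (3 * β) * Real.log N)) (hσ0 : 0 < σ) :
    ∫ x, min 1 |cltVar β N lam x - edgeVar β N η x| ∂(gbe β N) ≤
      (8 * (β + 2) * scaleConst β L + 1) * ε +
      (2 / ε * (L * scaleConst β L) + (1 + 1 / ε ^ 2) / 2 * scaleConst β L + bracketConst L) *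
        σ⁻¹ := by
  have := isProbabilityMeasure_gbe hβ h.card_pos
  have hη0 := h.pos
  have b1 : BddCont fun x : Fin N → ℝ => ∑ i, nearWeight ε ((x i - a) / η) :=
    BddCont.sum _ fun i _ => BddCont.comp (f := nearWeight ε)
      (g := fun x : Fin N → ℝ => (x i - a) / η) ⟨continuous_nearWeight hε, _, fun u => by
        rw [Real.norm_of_nonneg (nearWeight_nonneg hε u)]; exact nearWeight_le_inv hε u⟩
      (by fun_prop)
  have b2 : BddCont fun x : Fin N → ℝ =>
      bump (σ⁻¹ * (logD (a + η * Complex.I) x - logD (1 + η * Complex.I) x)) :=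
    BddCont.comp (f := bump) ⟨continuous_bump, 1, fun u => by
      rw [Real.norm_of_nonneg (bump_nonneg u)]; exact bump_le_one u⟩
      (continuous_const.mul ((continuous_logD h.im_pos).sub
        (continuous_logD (by simpa using hη0))))
  have b3 := (bddCont_resG (N := N) h.im_pos).norm
  have i1 := (b1.integrable (gbe β N)).const_mul (8 * ε)
  have i2 := (integrable_const (μ := gbe β N) ε).add ((b2.integrable (gbe β N)).const_mul (2 / ε))
  have i3 := (((b3.integrable (gbe β N)).const_mul η).const_mul
    ((1 + 1 / ε ^ 2) / 2)).const_mul σ⁻¹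
  have i4 := integrable_const (μ := gbe β N) (σ⁻¹ * bracketConst L)
  refine (integral_mono_of_nonneg (Eventually.of_forall fun x => by positivity)
    (((i1.add i2).add i3).add i4) (Eventually.of_forall fun x =>
      h.min_one_abs_sub_le hη ha hε hε1 hσ hσ0 x)).trans ?_
  rw [integral_add' ((i1.add i2).add i3) i4, integral_add' (i1.add i2) i3, integral_add' i1 i2,
    integral_add' (integrable_const _) ((b2.integrable (gbe β N)).const_mul (2 / ε))]
  simp only [integral_const_mul, integral_const, probReal_univ, one_smul]
  have e1 := mul_le_mul_of_nonneg_left (h.integral_sum_nearWeight_le hβ hε)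
    (by positivity : 0 ≤ 8 * ε)
  have e2 := mul_le_mul_of_nonneg_left (h.integral_bump_le hβ (inv_pos.2 hσ0).le)
    (by positivity : 0 ≤ 2 / ε)
  have e3 := mul_le_mul_of_nonneg_left (h.mul_integral_norm_resG_le hβ)
    (by positivity : 0 ≤ σ⁻¹ * ((1 + 1 / ε ^ 2) / 2))
  linarith

end comparison


lemma min_one_dist_le_sum {k : ℕ} (x y : Fin k → ℝ) :
    min 1 (dist x y) ≤ ∑ j, min 1 |x j - y j| := by
  have h0 : ∀ j, 0 ≤ min 1 |x j - y j| := fun j => by positivity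
  rcases le_or_gt 1 (∑ j, min 1 |x j - y j|) with h | h
  · exact (min_le_left _ _).trans h
  · refine (min_le_right _ _).trans ((dist_pi_le_iff (Finset.sum_nonneg fun j _ => h0 j)).2
      fun j => ?_)
    have h1 : min 1 |x j - y j| ≤ ∑ j, min 1 |x j - y j| :=
      Finset.single_le_sum (f := fun j => min 1 |x j - y j|) (fun j _ => h0 j) (Finset.mem_univ j)
    rw [Real.dist_eq]
    rcases min_le_iff.1 h1 with h2 | h2
    · linarith
    · exact h2

/-- A random vector all of whose coordinates are close in probability to a single
asymptotically Gaussian variable converges in distribution to `(Z, …, Z)`. -/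
lemma tendsto_integral_of_charFun {Ω : ℕ → Type*} [∀ n, MeasurableSpace (Ω n)]
    {μ : (n : ℕ) → Measure (Ω n)} [∀ n, IsProbabilityMeasure (μ n)] {k : ℕ}
    {X : (n : ℕ) → Ω n → Fin k → ℝ} {W : (n : ℕ) → Ω n → ℝ}
    (hX : ∀ n, Measurable (X n)) (hW : ∀ n, Measurable (W n))
    (hc : ∀ t : ℝ, Tendsto (fun n => ∫ x, Complex.exp (t * W n x * Complex.I) ∂(μ n)) atTop
      (𝓝 (Complex.exp (-(t ^ 2 / 2 : ℝ)))))
    (hXW : ∀ j, Tendsto (fun n => ∫ x, min 1 |X n x j - W n x| ∂(μ n)) atTop (𝓝 0))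
    (f : BoundedContinuousFunction (Fin k → ℝ) ℝ) :
    Tendsto (fun n => ∫ x, f (X n x) ∂(μ n)) atTop
      (𝓝 (∫ z, f (fun _ => z) ∂(gaussianReal 0 1))) := by
  have hdiag : Measurable fun z : ℝ => (fun _ : Fin k => z) := by fun_prop
  let νW : ℕ → ProbabilityMeasure ℝ := fun n =>
    ⟨(μ n).map (W n), Measure.isProbabilityMeasure_map (hW n).aemeasurable⟩
  let γ : ProbabilityMeasure ℝ := ⟨gaussianReal 0 1, inferInstance⟩
  have hWlim : Tendsto νW atTop (𝓝 γ) := by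
    rw [ProbabilityMeasure.tendsto_iff_tendsto_charFun]
    intro t
    have e1 : ∀ n, charFun (νW n : Measure ℝ) t =
        ∫ x, Complex.exp (t * W n x * Complex.I) ∂(μ n) := fun n => by
      rw [charFun_apply_real]
      exact integral_map (hW n).aemeasurable (by fun_prop)
    have e2 : charFun (γ : Measure ℝ) t = Complex.exp (-(t ^ 2 / 2 : ℝ)) := by
      refine (charFun_gaussianReal (μ := 0) (v := 1) t).trans ?_
      congr 1
      push_cast
      ring
    simp_rw [e1, e2]
    exact hc t
  let νX : ℕ → ProbabilityMeasure (Fin k → ℝ) := fun n =>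
    ⟨(μ n).map (X n), Measure.isProbabilityMeasure_map (hX n).aemeasurable⟩
  let γk : ProbabilityMeasure (Fin k → ℝ) :=
    ⟨(gaussianReal 0 1).map fun z _ => z, Measure.isProbabilityMeasure_map hdiag.aemeasurable⟩
  have hXlim : Tendsto νX atTop (𝓝 γk) := by
    rw [tendsto_iff_forall_lipschitz_integral_tendsto]
    rintro F ⟨C, hC⟩ ⟨K, hK⟩
    have hC0 : 0 ≤ C := dist_nonneg.trans (hC 0 0)
    have hFc := hK.continuous
    have e1 : ∀ n, ∫ y, F y ∂(νX n : Measure (Fin k → ℝ)) = ∫ x, F (X n x) ∂(μ n) := fun n =>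
      integral_map (hX n).aemeasurable hFc.aestronglyMeasurable
    have e2 : ∫ y, F y ∂(γk : Measure (Fin k → ℝ)) = ∫ z, F (fun _ => z) ∂(gaussianReal 0 1) :=
      integral_map hdiag.aemeasurable hFc.aestronglyMeasurable
    simp_rw [e1, e2]
    have hbd : ∀ y, ‖F y‖ ≤ ‖F 0‖ + C := fun y => by
      have h1 := hC y 0
      rw [dist_eq_norm] at h1
      have h2 := norm_sub_norm_le (F y) (F 0)
      linarith
    let G : BoundedContinuousFunction ℝ ℝ := BoundedContinuousFunction.ofNormedAddCommGroup
      (fun z => F fun _ => z) (by fun_prop) (‖F 0‖ + C) fun z => hbd _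
    have h1 := (ProbabilityMeasure.tendsto_iff_forall_integral_tendsto.1 hWlim) G
    have e3 : ∀ n, ∫ y, G y ∂(νW n : Measure ℝ) = ∫ x, F (fun _ => W n x) ∂(μ n) := fun n =>
      integral_map (hW n).aemeasurable G.continuous.aestronglyMeasurable
    simp_rw [e3] at h1
    have h2 : Tendsto (fun n => ∫ x, F (X n x) ∂(μ n) - ∫ x, F (fun _ => W n x) ∂(μ n)) atTop
        (𝓝 0) := by
      have h3 : Tendsto (fun n => (C + K) * ∑ j, ∫ x, min 1 |X n x j - W n x| ∂(μ n)) atTop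
          (𝓝 0) := by
        simpa using (tendsto_finsetSum Finset.univ fun j _ => hXW j).const_mul (C + (K : ℝ))
      refine squeeze_zero_norm (fun n => ?_) h3
      have i1 : Integrable (fun x => F (X n x)) (μ n) :=
        Integrable.of_bound (hFc.measurable.comp (hX n)).aestronglyMeasurable _
          (Eventually.of_forall fun x => hbd _)
      have i2 : Integrable (fun x => F fun _ => W n x) (μ n) :=
        Integrable.of_bound (hFc.measurable.comp (hdiag.comp (hW n))).aestronglyMeasurable _
          (Eventually.of_forall fun x => hbd _)
      have i3 : ∀ j, Integrable (fun x => min 1 |X n x j - W n x|) (μ n) := fun j => by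
        have hm := (measurable_pi_apply j).comp (hX n)
        refine Integrable.of_bound (C := 1) (measurable_const.min
          (hm.sub (hW n)).abs).aestronglyMeasurable (Eventually.of_forall fun x => ?_)
        rw [Real.norm_of_nonneg (by positivity)]
        exact min_le_left _ _
      rw [← integral_sub i1 i2, ← integral_finsetSum _ fun j _ => i3 j, ← integral_const_mul]
      refine norm_integral_le_of_norm_le ((integrable_finsetSum _ fun j _ => i3 j).const_mul _)
        (Eventually.of_forall fun x => ?_)
      rw [← dist_eq_norm]
      have h4 := hC (X n x) (fun _ => W n x)
      have h5 := hK.dist_le_mul (X n x) (fun _ => W n x)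
      have h6 := min_one_dist_le_sum (X n x) (fun _ => W n x)
      refine le_trans ?_ (mul_le_mul_of_nonneg_left h6 (by positivity))
      have hK0 : (0 : ℝ) ≤ K := K.2
      rcases le_total 1 (dist (X n x) fun _ => W n x) with h7 | h7
      · rw [min_eq_left h7]
        linarith
      · rw [min_eq_right h7]
        nlinarith [mul_nonneg hC0 (dist_nonneg (x := X n x) (y := fun _ => W n x))]
    have h4 := h2.add h1
    simp only [sub_add_cancel, zero_add] at h4
    exact h4
  have h := (ProbabilityMeasure.tendsto_iff_forall_integral_tendsto.1 hXlim) f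
  have e1 : ∀ n, ∫ y, f y ∂(νX n : Measure (Fin k → ℝ)) = ∫ x, f (X n x) ∂(μ n) := fun n =>
    integral_map (hX n).aemeasurable f.continuous.aestronglyMeasurable
  have e2 : ∫ y, f y ∂(γk : Measure (Fin k → ℝ)) = ∫ z, f (fun _ => z) ∂(gaussianReal 0 1) :=
    integral_map hdiag.aemeasurable f.continuous.aestronglyMeasurable
  simp_rw [e1, e2] at h
  exact h


/-- The edge scale `N^{-2/3}`. -/
noncomputable def edgeEta (N : ℕ) : ℝ := (N : ℝ) ^ (-(2 / 3) : ℝ)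

/-- The normalisation `√((2/(3β)) log N)`. -/
noncomputable def cltStd (β : ℝ) (N : ℕ) : ℝ := √(2 / (3 * β) * Real.log N)

lemma edgeEta_pos {N : ℕ} (hN : 0 < N) : 0 < edgeEta N := by
  have : (0 : ℝ) < N := by exact_mod_cast hN
  unfold edgeEta; positivity

lemma edgeEta_le_one {N : ℕ} (hN : 0 < N) : edgeEta N ≤ 1 :=
  Real.rpow_le_one_of_one_le_of_nonpos (by exact_mod_cast hN) (by norm_num)

lemma edgeEta_scale {N : ℕ} (hN : 0 < N) : (N : ℝ) ^ 2 * edgeEta N ^ 3 = 1 := by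
  have hN0 : (0 : ℝ) < N := by exact_mod_cast hN
  unfold edgeEta
  rw [← Real.rpow_natCast, ← Real.rpow_natCast, ← Real.rpow_mul hN0.le, ← Real.rpow_add hN0]
  norm_num

lemma zpt_sub_one (N : ℕ) (lam : ℝ) : zpt N lam - 1 = lam / 2 * edgeEta N := by
  unfold zpt edgeEta
  rw [Real.rpow_neg (Nat.cast_nonneg N)]
  field_simp
  ring

lemma log_edgeEta {N : ℕ} (hN : 0 < N) : Real.log (edgeEta N) = -(2 / 3) * Real.log N :=
  Real.log_rpow (by exact_mod_cast hN) _

lemma tendsto_edgeEta : Tendsto edgeEta atTop (𝓝 0) :=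
  (tendsto_rpow_neg_atTop (by norm_num)).comp tendsto_natCast_atTop_atTop

lemma tendsto_inv_cltStd {β : ℝ} (hβ : 0 < β) : Tendsto (fun N => (cltStd β N)⁻¹) atTop (𝓝 0) :=
  (Real.tendsto_sqrt_atTop.comp ((Real.tendsto_log_atTop.comp
    tendsto_natCast_atTop_atTop).const_mul_atTop (by positivity))).inv_tendsto_atTop

lemma cltStd_pos {β : ℝ} (hβ : 0 < β) {N : ℕ} (hN : 1 < N) : 0 < cltStd β N :=
  Real.sqrt_pos.2 (mul_pos (by positivity) (Real.log_pos (by exact_mod_cast hN)))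

lemma eventually_edgeScale (lam : ℝ) :
    ∀ᶠ N : ℕ in atTop, EdgeScale N (edgeEta N) (|lam| / 2) (zpt N lam) := by
  have h1 : Tendsto (fun N => |lam| / 2 * edgeEta N) atTop (𝓝 0) := by
    simpa using tendsto_edgeEta.const_mul (|lam| / 2)
  filter_upwards [eventually_gt_atTop 0, h1.eventually_le_const (by norm_num : (0 : ℝ) < 1 / 2)]
    with N hN h
  have h2 : |zpt N lam - 1| = |lam| / 2 * edgeEta N := by
    rw [zpt_sub_one, abs_mul, abs_div, abs_two, abs_of_pos (edgeEta_pos hN)]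
  exact ⟨edgeEta_pos hN, edgeEta_le_one hN, edgeEta_scale hN, by positivity, h2.le, h2.trans_le h⟩

section limits

variable {β : ℝ} (hβ : 0 < β)
include hβ

lemma tendsto_charFun_edgeVar (t : ℝ) :
    Tendsto (fun N => ∫ x, Complex.exp (t * edgeVar β N (edgeEta N) x * Complex.I) ∂(gbe β N))
      atTop (𝓝 (Complex.exp (-(t ^ 2 / 2 : ℝ)))) := by
  rw [tendsto_iff_norm_sub_tendsto_zero]
  have h1 : Tendsto (fun N => |t * (cltStd β N)⁻¹|) atTop (𝓝 0) := by
    simpa using ((tendsto_inv_cltStd hβ).const_mul t).abs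
  have h2 : Tendsto (fun N => |t * (cltStd β N)⁻¹| * (3 * verticalConst β + (farConst β 2 + 1)))
      atTop (𝓝 0) := by simpa using h1.mul_const (3 * verticalConst β + (farConst β 2 + 1))
  refine squeeze_zero' (Eventually.of_forall fun _ => norm_nonneg _) ?_ h2
  filter_upwards [eventually_gt_atTop 1, h1.eventually_le_const one_pos] with N hN hτ
  have hN0 : 0 < N := by omega
  have hσ := cltStd_pos hβ hN
  have h3 := norm_cfVertical_scale_sub_le hβ (edgeEta_pos hN0) (edgeEta_le_one hN0)
    (edgeEta_scale hN0) hτ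
  have e1 : ∫ x, Complex.exp (t * edgeVar β N (edgeEta N) x * Complex.I) ∂(gbe β N) =
      Complex.exp ((t * (cltStd β N)⁻¹ : ℝ) * ((1 - 2 / β) / 4 * Real.log (edgeEta N) : ℝ) *
        Complex.I) * cfVertical β N (t * (cltStd β N)⁻¹) (edgeEta N) := by
    unfold cfVertical
    rw [← integral_const_mul]
    refine integral_congr_ae (Eventually.of_forall fun x => ?_)
    simp only
    rw [← Complex.exp_add]
    congr 1
    unfold edgeVar
    rw [← cltStd]
    push_cast
    ring
  have e2 : (t * (cltStd β N)⁻¹) ^ 2 / (2 * β) * Real.log (edgeEta N) = -(t ^ 2 / 2) := by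
    have hl : 0 < Real.log N := Real.log_pos (by exact_mod_cast hN)
    rw [log_edgeEta hN0, mul_pow, inv_pow, cltStd, Real.sq_sqrt (by positivity)]
    field_simp
  rw [e1, ← Complex.ofReal_neg, ← Complex.ofReal_exp, ← e2]
  exact h3

lemma tendsto_integral_min_one_abs_sub (lam : ℝ) :
    Tendsto (fun N => ∫ x, min 1 |cltVar β N lam x - edgeVar β N (edgeEta N) x| ∂(gbe β N))
      atTop (𝓝 0) := by
  set L := |lam| / 2
  set C := 8 * (β + 2) * scaleConst β L + 1
  have hC : 0 < C := by
    have := (le_scaleConst hβ (by positivity : 0 ≤ L)).2.2.2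
    positivity
  refine tendsto_order.2 ⟨fun a ha => Eventually.of_forall fun N =>
    ha.trans_le (integral_nonneg fun x => by positivity), fun δ hδ => ?_⟩
  set ε := min 1 (δ / (2 * C))
  have hε : 0 < ε := by positivity
  have hCε : C * ε ≤ δ / 2 := by
    calc C * ε ≤ C * (δ / (2 * C)) := by gcongr; exact min_le_right _ _
      _ = δ / 2 := by field_simp
  have h1 : Tendsto (fun N => (2 / ε * (L * scaleConst β L) +
      (1 + 1 / ε ^ 2) / 2 * scaleConst β L + bracketConst L) * (cltStd β N)⁻¹) atTop (𝓝 0) := by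
    simpa using (tendsto_inv_cltStd hβ).const_mul _
  have h2 : Tendsto (fun N => (3 * L + 4) * edgeEta N) atTop (𝓝 0) := by
    simpa using tendsto_edgeEta.const_mul (3 * L + 4)
  filter_upwards [eventually_edgeScale lam, eventually_gt_atTop 1,
    h1.eventually_lt_const (half_pos hδ),
    h2.eventually_le_const (by norm_num : (0 : ℝ) < 1 / 16)] with N hs hN hb hη
  have h3 := hs.integral_min_one_abs_sub_le hβ hη rfl hε (min_le_left _ _) rfl (cltStd_pos hβ hN)
  exact h3.trans_lt ((add_lt_add_of_le_of_lt hCε hb).trans_eq (add_halves δ))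

omit hβ in
lemma measurable_cltVar (β : ℝ) (N : ℕ) (lam : ℝ) : Measurable (cltVar β N lam) := by
  have h : Continuous (PsiN N lam) := by unfold PsiN; fun_prop
  exact ((Real.measurable_log.comp h.measurable.abs).add_const _).div_const _

omit hβ in
lemma measurable_edgeVar (β : ℝ) (N : ℕ) {η : ℝ} (hη : 0 < η) : Measurable (edgeVar β N η) :=
  (continuous_const.mul ((continuous_logD (by simpa using hη)).add
    continuous_const)).measurable

lemma tendsto_integral_cltVar (k : ℕ) (lams : Fin k → ℝ)
    (f : BoundedContinuousFunction (Fin k → ℝ) ℝ) :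
    Tendsto (fun N : ℕ => ∫ x, f (fun j => cltVar β N (lams j) x) ∂(gbe β N)) atTop
      (𝓝 (∫ z, f (fun _ => z) ∂(gaussianReal 0 1))) := by
  rw [← tendsto_add_atTop_iff_nat 1]
  have (n : ℕ) : IsProbabilityMeasure (gbe β (n + 1)) := isProbabilityMeasure_gbe hβ n.succ_pos
  exact tendsto_integral_of_charFun (μ := fun n => gbe β (n + 1))
    (X := fun n x j => cltVar β (n + 1) (lams j) x)
    (W := fun n => edgeVar β (n + 1) (edgeEta (n + 1)))
    (fun n => measurable_pi_lambda _ fun j => measurable_cltVar β (n + 1) (lams j))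
    (fun n => measurable_edgeVar β (n + 1) (edgeEta_pos n.succ_pos))
    (fun t => (tendsto_add_atTop_iff_nat 1).2 (tendsto_charFun_edgeVar hβ t))
    (fun j => (tendsto_add_atTop_iff_nat 1).2 (tendsto_integral_min_one_abs_sub hβ (lams j))) f

end limits

end GaussianBeta

/-- Central limit theorem for the logarithm of the characteristic polynomial of the
Gaussian β-ensemble at the spectral edge: for every `λ`, the rescaled variable
converges in distribution to a standard Gaussian, and jointly for
`λ₁, …, λ_k` the limit is the fully correlated vector `(Z, …, Z)`.
Convergence in distribution is formulated via bounded continuous test functions. -/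
theorem stmt0 (β : ℝ) (hβ : 0 < β) :
    (∀ lam : ℝ, ∀ f : BoundedContinuousFunction ℝ ℝ,
      Tendsto (fun N : ℕ => ∫ x, f (cltVar β N lam x) ∂(gbe β N)) atTop
        (𝓝 (∫ z, f z ∂(gaussianReal 0 1)))) ∧
    (∀ (k : ℕ) (lams : Fin k → ℝ), ∀ f : BoundedContinuousFunction (Fin k → ℝ) ℝ,
      Tendsto (fun N : ℕ => ∫ x, f (fun j => cltVar β N (lams j) x) ∂(gbe β N)) atTop
        (𝓝 (∫ z, f (fun _ => z) ∂(gaussianReal 0 1)))) := by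
  have h := fun k lams f => GaussianBeta.tendsto_integral_cltVar hβ k lams f
  exact ⟨fun lam f => h 1 (fun _ => lam) (f.compContinuous ⟨fun y => y 0, continuous_apply 0⟩), h⟩
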